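/- The canonical homomorphism from the amalgamated free product H1 *_{H1∩K2} K2 (the pushout of the two inclusion homomorphisms H1∩K2 ↪ H1 and H1∩K2 ↪ K2) to Aut(R), induced by the inclusions of H1 and K2 into Aut(R), is injective, and its image equals Stab([x3]) = {σ ∈ Tame(k^3) : σ(x3) = α·x3 + β for some α ∈ k^*, β ∈ k}. -/

import Mathlib

open MvPolynomial

/-- The group of `k`-algebra automorphisms of `k[x1,x2,x3]`. -/
abbrev Aut3 (k : Type) [Field k] := MvPolynomial (Fin 3) k ≃ₐ[k] MvPolynomial (Fin 3) k

/-- `σ` is an affine automorphism: `σ(x_i) = Σ_j a_{ij}·x_j + b_i` with `(a_{ij}) ∈ GL_3(k)`. -/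
def IsAffine (k : Type) [Field k] (σ : Aut3 k) : Prop :=
  ∃ (A : Matrix (Fin 3) (Fin 3) k) (b : Fin 3 → k), IsUnit A ∧
    ∀ i, σ (X i) = (∑ j, C (A i j) * X j) + C (b i)

/-- `σ` is an elementary automorphism: `σ(x1) = x1 + P(x2,x3)`, `σ(x2) = x2`, `σ(x3) = x3`. -/
def IsElementary (k : Type) [Field k] (σ : Aut3 k) : Prop :=
  ∃ P ∈ supported k ({1, 2} : Set (Fin 3)),
    σ (X 0) = X 0 + P ∧ σ (X 1) = X 1 ∧ σ (X 2) = X 2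

/-- The tame automorphism group `Tame(k^3)`. -/
noncomputable def Tame (k : Type) [Field k] : Subgroup (Aut3 k) :=
  Subgroup.closure {σ | IsAffine k σ ∨ IsElementary k σ}

/-- Membership in `H1`: `σ(x1) = a·x1 + t(x3)`, `σ(x2) = d·x2 + P(x1,x3)`,
`σ(x3) = α·x3 + β` with `a, d, α ∈ k^*`. -/
def MemH1 (k : Type) [Field k] (σ : Aut3 k) : Prop :=
  ∃ (a d α β : k) (t P : MvPolynomial (Fin 3) k),
    a ≠ 0 ∧ d ≠ 0 ∧ α ≠ 0 ∧
    t ∈ supported k ({2} : Set (Fin 3)) ∧ P ∈ supported k ({0, 2} : Set (Fin 3)) ∧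
    σ (X 0) = C a * X 0 + t ∧ σ (X 1) = C d * X 1 + P ∧ σ (X 2) = C α * X 2 + C β

/-- Membership in `K2`: `σ(x1) = a·x1 + b·x2 + t(x3)`, `σ(x2) = c·x1 + d·x2 + t'(x3)`,
`σ(x3) = α·x3 + β` with `(a b; c d) ∈ GL_2(k)`, `α ∈ k^*`. -/
def MemK2 (k : Type) [Field k] (σ : Aut3 k) : Prop :=
  ∃ (a b c d α β : k) (t t' : MvPolynomial (Fin 3) k),
    a * d - b * c ≠ 0 ∧ α ≠ 0 ∧
    t ∈ supported k ({2} : Set (Fin 3)) ∧ t' ∈ supported k ({2} : Set (Fin 3)) ∧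
    σ (X 0) = C a * X 0 + C b * X 1 + t ∧ σ (X 1) = C c * X 0 + C d * X 1 + t' ∧
    σ (X 2) = C α * X 2 + C β

/-- The two-element family of groups `{↥A, ↥B}` associated to subgroups `A B ≤ G`. -/
def amalgFam {G : Type*} [Group G] (A B : Subgroup G) : Bool → Type _ :=
  fun i => Bool.rec (motive := fun _ => Type _) ↥B ↥A i

instance {G : Type*} [Group G] (A B : Subgroup G) : ∀ i, Group (amalgFam A B i) :=
  fun i => by cases i <;> dsimp [amalgFam] <;> infer_instance

/-- The inclusions of `A ⊓ B` into `A` and `B`. -/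
def amalgIncl {G : Type*} [Group G] (A B : Subgroup G) :
    ∀ i, ↥(A ⊓ B) →* amalgFam A B i :=
  fun i => by
    cases i
    · exact Subgroup.inclusion inf_le_right
    · exact Subgroup.inclusion inf_le_left

/-- The amalgamated free product `A *_{A ⊓ B} B`, i.e. the pushout of the two inclusion
homomorphisms `A ⊓ B ↪ A` and `A ⊓ B ↪ B`. -/
def AmalgProd {G : Type*} [Group G] (A B : Subgroup G) : Type _ :=
  Monoid.PushoutI (amalgIncl A B)

noncomputable instance {G : Type*} [Group G] (A B : Subgroup G) : Group (AmalgProd A B) := by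
  unfold AmalgProd; infer_instance

/-- The canonical homomorphism `A *_{A ⊓ B} B →* G` induced by the inclusions of `A` and `B`
into `G`. -/
noncomputable def amalgToGroup {G : Type*} [Group G] (A B : Subgroup G) :
    AmalgProd A B →* G :=
  Monoid.PushoutI.lift
    (fun i => by cases i; exacts [B.subtype, A.subtype])
    (A ⊓ B).subtype
    (by intro i; cases i <;> rfl)

namespace TameStab

abbrev Pol (k : Type) [Field k] := MvPolynomial (Fin 3) k

/-- The weight of an exponent vector; the weights of the variables are `√2`, `√3`, `1`. -/
noncomputable def wt (n : Fin 3 →₀ ℕ) : ℝ := n 0 * √2 + n 1 * √3 + n 2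

theorem wt_zero : wt 0 = 0 := by simp [wt]

theorem wt_add (n m : Fin 3 →₀ ℕ) : wt (n + m) = wt n + wt m := by
  simp [wt]; ring

theorem wt_nonneg (n : Fin 3 →₀ ℕ) : 0 ≤ wt n := by
  unfold wt; positivity

theorem sqrt_two_three_indep {a b c : ℤ} (h : a * √2 + b * √3 + c = 0) :
    a = 0 ∧ b = 0 ∧ c = 0 := by
  have h2 : √2 * √2 = 2 := Real.mul_self_sqrt (by norm_num)
  have h3 : √3 * √3 = 3 := Real.mul_self_sqrt (by norm_num)
  have i2 : Irrational √2 := by simpa using (Nat.prime_two.irrational_sqrt)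
  have i3 : Irrational √3 := by simpa using (Nat.prime_three.irrational_sqrt)
  have i6 : Irrational √6 := by
    have := (irrational_sqrt_natCast_iff (n := 6)).2 (by
      rintro ⟨r, hr⟩
      have : r ≤ 2 ∨ 3 ≤ r := by omega
      rcases this with h | h
      · interval_cases r <;> omega
      · nlinarith)
    simpa using this
  have h6 : √2 * √3 = √6 := by
    rw [← Real.sqrt_mul (by norm_num)]; norm_num
  have hq : ((2 * a * b : ℤ) : ℝ) * √6 = ((c * c - 2 * a * a - 3 * b * b : ℤ) : ℝ) := by
    rw [← h6]; push_cast
    have : (a * √2 + b * √3) * (a * √2 + b * √3) = (c : ℝ) * c := by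
      have : a * √2 + b * √3 = -(c : ℝ) := by linarith
      rw [this]; ring
    linear_combination this - a * a * h2 - b * b * h3
  have hab : a = 0 ∨ b = 0 := by
    by_contra hne
    push Not at hne
    have hne' : (2 * a * b : ℤ) ≠ 0 := by
      simp [hne.1, hne.2]
    have := (i6.intCast_mul hne')
    rw [hq] at this
    exact this.ne_int _ rfl
  rcases hab with rfl | rfl
  · by_cases hb : b = 0
    · subst hb; simp at h; exact ⟨rfl, rfl, h⟩
    · exfalso
      have := i3.intCast_mul hb
      have e : (b : ℝ) * √3 = ((-c : ℤ) : ℝ) := by push_cast; push_cast at h; linarith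
      rw [e] at this
      exact this.ne_int _ rfl
  · by_cases hb : a = 0
    · subst hb; simp at h; exact ⟨rfl, rfl, h⟩
    · exfalso
      have := i2.intCast_mul hb
      have e : (a : ℝ) * √2 = ((-c : ℤ) : ℝ) := by push_cast; push_cast at h; linarith
      rw [e] at this
      exact this.ne_int _ rfl

theorem wt_injective : Function.Injective wt := by
  intro n m h
  have : (((n 0 : ℤ) - m 0 : ℤ) : ℝ) * √2 + (((n 1 : ℤ) - m 1 : ℤ) : ℝ) * √3
      + (((n 2 : ℤ) - m 2 : ℤ) : ℝ) = 0 := by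
    unfold wt at h; push_cast; linarith
  obtain ⟨h0, h1, h2⟩ := sqrt_two_three_indep this
  ext i
  fin_cases i <;> simp <;> omega

theorem wt_eq_zero {n : Fin 3 →₀ ℕ} : wt n = 0 ↔ n = 0 := by
  rw [← wt_zero, wt_injective.eq_iff]

theorem finite_wt_le (c : ℝ) : {n | wt n ≤ c}.Finite := by
  apply (Set.finite_Iic (Finsupp.equivFunOnFinite.symm (fun _ : Fin 3 => ⌊c⌋₊))).subset
  intro n hn i
  simp only [Set.mem_ofPred_eq, wt] at hn
  have h2 : 1 ≤ √2 := by rw [Real.one_le_sqrt]; norm_num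
  have h3 : 1 ≤ √3 := by rw [Real.one_le_sqrt]; norm_num
  have e0 : (n 0 : ℝ) ≤ n 0 * √2 := le_mul_of_one_le_right (by positivity) h2
  have e1 : (n 1 : ℝ) ≤ n 1 * √3 := le_mul_of_one_le_right (by positivity) h3
  have p0 : (0:ℝ) ≤ n 0 := by positivity
  have p1 : (0:ℝ) ≤ n 1 := by positivity
  have p2 : (0:ℝ) ≤ n 2 := by positivity
  simp only [Finsupp.equivFunOnFinite_symm_apply_apply]
  apply Nat.le_floor
  fin_cases i <;> simp <;> linarith

/-- The real numbers that occur as weights. -/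
def IsDeg (d : ℝ) : Prop := ∃ n, wt n = d

theorem IsDeg.add {a b : ℝ} (ha : IsDeg a) (hb : IsDeg b) : IsDeg (a + b) := by
  obtain ⟨n, rfl⟩ := ha
  obtain ⟨m, rfl⟩ := hb
  exact ⟨n + m, wt_add _ _⟩

theorem isDeg_induction {P : ℝ → Prop}
    (h : ∀ d, IsDeg d → (∀ d', d' < d → IsDeg d' → P d') → P d) : ∀ d, IsDeg d → P d := by
  have key : ∀ N : ℕ, ∀ d, IsDeg d → {n | wt n ≤ d}.ncard ≤ N → P d := by
    intro N
    induction N with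
    | zero =>
      rintro d ⟨n, rfl⟩ hN
      have : {m | wt m ≤ wt n} = ∅ := by
        rw [← Set.ncard_eq_zero (finite_wt_le _)]; omega
      exact absurd (show n ∈ {m | wt m ≤ wt n} from Set.mem_ofPred.2 le_rfl) (by rw [this]; simp)
    | succ N ih =>
      rintro d ⟨n, rfl⟩ hN
      refine h _ ⟨n, rfl⟩ fun d' hd' hdeg => ih d' hdeg ?_
      have : {m | wt m ≤ d'}.ncard < {m | wt m ≤ wt n}.ncard := by
        apply Set.ncard_lt_ncard _ (finite_wt_le _)
        refine ⟨fun m hm => Set.mem_ofPred.2 (le_trans (Set.mem_ofPred.1 hm) hd'.le), fun hs => ?_⟩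
        have := hs (show n ∈ {m | wt m ≤ wt n} from Set.mem_ofPred.2 le_rfl)
        exact absurd (Set.mem_ofPred.1 this) (not_le.2 hd')
      omega
  exact fun d hd => key _ d hd le_rfl

variable {k : Type} [Field k]

/-- The weighted degree of a polynomial, with value `0` at constants. -/
noncomputable def dg (f : Pol k) : ℝ :=
  (insert 0 f.support).sup' (Finset.insert_nonempty _ _) wt

theorem dg_nonneg (f : Pol k) : 0 ≤ dg f := by
  rw [← wt_zero]; exact Finset.le_sup' wt (Finset.mem_insert_self _ _)

theorem le_dg {f : Pol k} {n} (h : coeff n f ≠ 0) : wt n ≤ dg f :=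
  Finset.le_sup' wt (Finset.mem_insert_of_mem (mem_support_iff.2 h))

theorem dg_le {f : Pol k} {c : ℝ} (hc : 0 ≤ c) (h : ∀ n, coeff n f ≠ 0 → wt n ≤ c) :
    dg f ≤ c := by
  apply Finset.sup'_le
  intro n hn
  rcases Finset.mem_insert.1 hn with rfl | hn
  · rwa [wt_zero]
  · exact h n (mem_support_iff.1 hn)

theorem dg_lt {f : Pol k} {c : ℝ} (hc : 0 < c) (h : ∀ n, coeff n f ≠ 0 → wt n < c) :
    dg f < c := by
  rw [dg, Finset.sup'_lt_iff]
  intro n hn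
  rcases Finset.mem_insert.1 hn with rfl | hn
  · rwa [wt_zero]
  · exact h n (mem_support_iff.1 hn)

theorem exists_top {f : Pol k} (hf : f ≠ 0) : ∃ n, coeff n f ≠ 0 ∧ wt n = dg f := by
  obtain ⟨n, hn, e⟩ := Finset.exists_mem_eq_sup' (s := insert 0 f.support)
    (Finset.insert_nonempty _ _) wt
  change dg f = wt n at e
  rcases Finset.mem_insert.1 hn with rfl | hn
  · obtain ⟨m, hm⟩ := MvPolynomial.ne_zero_iff.1 hf
    have := le_dg hm
    rw [e, wt_zero] at this
    have hm0 := wt_eq_zero.1 (le_antisymm this (wt_nonneg m))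
    subst hm0
    exact ⟨0, hm, e.symm⟩
  · exact ⟨n, mem_support_iff.1 hn, e.symm⟩

theorem dg_zero : dg (0 : Pol k) = 0 :=
  le_antisymm (dg_le le_rfl (by simp)) (dg_nonneg _)

theorem isDeg_dg (f : Pol k) : IsDeg (dg f) := by
  by_cases hf : f = 0
  · subst hf; exact ⟨0, by rw [wt_zero, dg_zero]⟩
  · obtain ⟨n, -, h⟩ := exists_top hf
    exact ⟨n, h⟩

theorem dg_C (c : k) : dg (C c : Pol k) = 0 := by
  refine le_antisymm (dg_le le_rfl fun n hn => ?_) (dg_nonneg _)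
  rw [coeff_C] at hn
  have : 0 = n := by by_contra h; simp [h] at hn
  rw [← this, wt_zero]

theorem dg_eq_zero {f : Pol k} : dg f = 0 ↔ ∃ c, f = C c := by
  refine ⟨fun h => ⟨coeff 0 f, ?_⟩, ?_⟩
  · ext n
    rw [coeff_C]
    split_ifs with h0
    · rw [← h0]
    · by_contra hn
      have := le_dg hn
      rw [h] at this
      exact h0 (wt_eq_zero.1 (le_antisymm this (wt_nonneg n))).symm
  · rintro ⟨c, rfl⟩; exact dg_C c

theorem ne_zero_of_dg_pos {f : Pol k} (h : 0 < dg f) : f ≠ 0 := by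
  rintro rfl; rw [dg_zero] at h; exact lt_irrefl _ h

theorem dg_add_le (f g : Pol k) : dg (f + g) ≤ max (dg f) (dg g) := by
  refine dg_le (le_max_of_le_left (dg_nonneg f)) fun n hn => ?_
  rw [coeff_add] at hn
  by_cases hf : coeff n f = 0
  · rw [hf, zero_add] at hn; exact le_max_of_le_right (le_dg hn)
  · exact le_max_of_le_left (le_dg hf)

theorem dg_neg (f : Pol k) : dg (-f) = dg f := by
  unfold dg; simp only [MvPolynomial.support_neg]

theorem dg_sub_le (f g : Pol k) : dg (f - g) ≤ max (dg f) (dg g) := by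
  rw [sub_eq_add_neg, ← dg_neg g]; exact dg_add_le _ _

theorem dg_sub_comm (f g : Pol k) : dg (f - g) = dg (g - f) := by
  rw [← dg_neg, neg_sub]

theorem dg_add_eq {f g : Pol k} (h : dg g < dg f) : dg (f + g) = dg f := by
  apply le_antisymm
  · exact (dg_add_le f g).trans (max_le le_rfl h.le)
  · have := dg_sub_le (f + g) g
    rw [add_sub_cancel_right] at this
    rcases le_max_iff.1 this with h' | h'
    · exact h'
    · exact absurd h (not_lt.2 h')

theorem dg_add_eq' {f g : Pol k} (h : dg f < dg g) : dg (f + g) = dg g := by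
  rw [add_comm, dg_add_eq h]

theorem dg_sub_eq {f g : Pol k} (h : dg g < dg f) : dg (f - g) = dg f := by
  rw [sub_eq_add_neg]; exact dg_add_eq (by rwa [dg_neg])

theorem coeff_mul_top {f g : Pol k} {n m} (hn : wt n = dg f) (hm : wt m = dg g) :
    coeff (n + m) (f * g) = coeff n f * coeff m g := by
  classical
  rw [coeff_mul, Finset.sum_eq_single (n, m)]
  · rintro ⟨a, b⟩ hab hne
    rw [Finset.HasAntidiagonal.mem_antidiagonal] at hab
    by_contra hc
    have h1 := le_dg (left_ne_zero_of_mul hc)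
    have h2 := le_dg (right_ne_zero_of_mul hc)
    have h3 : wt a + wt b = wt n + wt m := by rw [← wt_add, ← wt_add, ← hab]
    have ha : a = n := wt_injective (by simp only at h1 h2; linarith)
    have hb : b = m := wt_injective (by simp only at h1 h2; linarith)
    exact hne (by rw [ha, hb])
  · intro h; exact absurd (by rw [Finset.HasAntidiagonal.mem_antidiagonal]) h

theorem dg_mul_le (f g : Pol k) : dg (f * g) ≤ dg f + dg g := by
  classical
  refine dg_le (add_nonneg (dg_nonneg _) (dg_nonneg _)) fun n hn => ?_
  rw [coeff_mul] at hn
  obtain ⟨⟨a, b⟩, hab, h⟩ := Finset.exists_ne_zero_of_sum_ne_zero hn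
  rw [← Finset.HasAntidiagonal.mem_antidiagonal.1 hab, wt_add]
  exact add_le_add (le_dg (left_ne_zero_of_mul h)) (le_dg (right_ne_zero_of_mul h))

theorem dg_mul {f g : Pol k} (hf : f ≠ 0) (hg : g ≠ 0) : dg (f * g) = dg f + dg g := by
  refine le_antisymm (dg_mul_le f g) ?_
  obtain ⟨n, hn, en⟩ := exists_top hf
  obtain ⟨m, hm, em⟩ := exists_top hg
  rw [← en, ← em, ← wt_add]
  apply le_dg
  rw [coeff_mul_top en em]
  exact mul_ne_zero hn hm

theorem dg_C_mul {c : k} (hc : c ≠ 0) (f : Pol k) : dg (C c * f) = dg f := by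
  by_cases hf : f = 0
  · simp [hf]
  · rw [dg_mul (by simpa using hc) hf, dg_C, zero_add]

theorem dg_C_mul_le (c : k) (f : Pol k) : dg (C c * f) ≤ dg f := by
  by_cases hc : c = 0
  · subst hc; simp [dg_zero, dg_nonneg]
  · exact (dg_C_mul hc f).le

theorem dg_pow {f : Pol k} (n : ℕ) : dg (f ^ n) = n * dg f := by
  by_cases hf : f = 0
  · subst hf
    rcases Nat.eq_zero_or_pos n with rfl | h
    · simp; exact dg_C (1 : k)
    · rw [zero_pow h.ne', dg_zero, mul_zero]
  induction n with
  | zero => simp; exact dg_C (1 : k)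
  | succ n ih => rw [pow_succ, dg_mul (pow_ne_zero _ hf) hf, ih]; push_cast; ring

theorem dg_sum_le {ι : Type*} (s : Finset ι) (F : ι → Pol k) {c : ℝ} (hc : 0 ≤ c)
    (h : ∀ i ∈ s, dg (F i) ≤ c) : dg (∑ i ∈ s, F i) ≤ c := by
  classical
  induction s using Finset.induction_on with
  | empty => simpa [dg_zero] using hc
  | insert a s ha ih =>
    rw [Finset.sum_insert ha]
    exact (dg_add_le _ _).trans (max_le (h _ (Finset.mem_insert_self _ _))
      (ih fun i hi => h i (Finset.mem_insert_of_mem hi)))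

theorem exists_cancel {f g : Pol k} (h : dg f = dg g) (hg : 0 < dg g) :
    ∃ c : k, c ≠ 0 ∧ dg (f - C c * g) < dg f := by
  obtain ⟨n, hn, en⟩ := exists_top (ne_zero_of_dg_pos (h ▸ hg))
  obtain ⟨m, hm, em⟩ := exists_top (ne_zero_of_dg_pos hg)
  have hnm : n = m := wt_injective (by rw [en, em, h])
  subst hnm
  refine ⟨coeff n f / coeff n g, div_ne_zero hn hm, dg_lt (h ▸ hg) fun a ha => ?_⟩
  have hle : wt a ≤ dg f := by
    refine (le_dg ha).trans ((dg_sub_le _ _).trans (max_le le_rfl ?_))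
    exact (dg_C_mul_le _ _).trans h.ge
  refine lt_of_le_of_ne hle fun e => ha ?_
  have : a = n := wt_injective (by rw [e, en])
  subst this
  rw [coeff_sub, coeff_C_mul]
  field_simp
  simp

theorem exists_min {S : Set (Pol k)} (hS : S.Nonempty) :
    ∃ p ∈ S, ∀ q ∈ S, dg p ≤ dg q := by
  obtain ⟨p, hp⟩ := hS
  by_contra hcon
  push Not at hcon
  have := isDeg_induction (P := fun d => ∀ p ∈ S, dg p = d → False)
    (fun d _ ih p hp e => by
      obtain ⟨q, hq, hlt⟩ := hcon p hp
      exact ih (dg q) (e ▸ hlt) (isDeg_dg q) q hq rfl) (dg p) (isDeg_dg p) p hp rfl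
  exact this

end TameStab

namespace TameStab
variable {k : Type} [Field k]

theorem coeff_X_mul_pderiv {σ : Type*} [DecidableEq σ] (i : σ) (f : MvPolynomial σ k) (n : σ →₀ ℕ) :
    coeff n (X i * pderiv i f) = n i * coeff n f := by
  induction f using MvPolynomial.induction_on' with
  | monomial m r =>
    rw [X_mul_pderiv_monomial, coeff_smul, coeff_monomial]
    split_ifs with h
    · subst h; simp
    · simp
  | add p q hp hq => simp only [map_add, mul_add, coeff_add, hp, hq]

/-- The logarithmic derivative with respect to the `i`-th variable. -/
noncomputable def D (i : Fin 3) : Derivation k (Pol k) (Pol k) := (X i : Pol k) • pderiv i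

theorem D_apply (i : Fin 3) (f : Pol k) : D i f = X i * pderiv i f := rfl

theorem coeff_D (i : Fin 3) (f : Pol k) (n) : coeff n (D i f) = n i * coeff n f := by
  rw [D_apply, coeff_X_mul_pderiv]

theorem dg_D_le (i : Fin 3) (f : Pol k) : dg (D i f) ≤ dg f := by
  refine dg_le (dg_nonneg f) fun n hn => ?_
  rw [coeff_D] at hn
  exact le_dg (right_ne_zero_of_mul hn)

/-- The Euler derivation. -/
noncomputable def E (f : Pol k) : Pol k := D 0 f + D 1 f + D 2 f

theorem E_ne_zero [CharZero k] {f : Pol k} (hf : 0 < dg f) : E f ≠ 0 ∧ dg (E f) = dg f := by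
  have hc : ∀ n, coeff n (E f) = ((n 0 + n 1 + n 2 : ℕ) : k) * coeff n f := by
    intro n; simp only [E, coeff_add, coeff_D]; push_cast; ring
  obtain ⟨n, hn, en⟩ := exists_top (ne_zero_of_dg_pos hf)
  have hn0 : n 0 + n 1 + n 2 ≠ 0 := by
    intro h
    have : wt n = 0 := by
      have h0 : n 0 = 0 := by omega
      have h1 : n 1 = 0 := by omega
      have h2 : n 2 = 0 := by omega
      simp [wt, h0, h1, h2]
    linarith
  have hE : coeff n (E f) ≠ 0 := by
    rw [hc]; exact mul_ne_zero (by exact_mod_cast hn0) hn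
  refine ⟨fun h => hE (by rw [h]; simp), le_antisymm (dg_le (dg_nonneg f) fun m hm => ?_) ?_⟩
  · rw [hc] at hm; exact le_dg (right_ne_zero_of_mul hm)
  · rw [← en]; exact le_dg hE

/-- A component of the wedge product of the logarithmic differentials. -/
noncomputable def br (i j : Fin 3) (f g : Pol k) : Pol k := D i f * D j g - D j f * D i g

theorem dg_br_le (i j : Fin 3) (f g : Pol k) : dg (br i j f g) ≤ dg f + dg g := by
  refine (dg_sub_le _ _).trans (max_le ?_ ?_)
  · exact (dg_mul_le _ _).trans (add_le_add (dg_D_le _ _) (dg_D_le _ _))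
  · exact (dg_mul_le _ _).trans (add_le_add (dg_D_le _ _) (dg_D_le _ _))

/-- The degree of the wedge product of the logarithmic differentials. -/
noncomputable def W (f g : Pol k) : ℝ :=
  (Finset.univ : Finset (Fin 3 × Fin 3)).sup' Finset.univ_nonempty fun p => dg (br p.1 p.2 f g)

theorem dg_br_le_W (i j : Fin 3) (f g : Pol k) : dg (br i j f g) ≤ W f g :=
  Finset.le_sup' (fun p : Fin 3 × Fin 3 => dg (br p.1 p.2 f g)) (Finset.mem_univ (i, j))

theorem W_le {f g : Pol k} {c : ℝ} (h : ∀ i j, dg (br i j f g) ≤ c) : W f g ≤ c :=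
  Finset.sup'_le _ _ fun p _ => h p.1 p.2

theorem exists_W (f g : Pol k) : ∃ i j, dg (br i j f g) = W f g := by
  obtain ⟨p, -, h⟩ := Finset.exists_mem_eq_sup' (Finset.univ_nonempty (α := Fin 3 × Fin 3))
    fun p => dg (br p.1 p.2 f g)
  exact ⟨p.1, p.2, h.symm⟩

theorem W_nonneg (f g : Pol k) : 0 ≤ W f g := (dg_nonneg _).trans (dg_br_le_W 0 0 f g)

theorem W_le_add (f g : Pol k) : W f g ≤ dg f + dg g := W_le fun i j => dg_br_le i j f g

theorem br_swap (i j : Fin 3) (f g : Pol k) : br i j f g = -br i j g f := by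
  simp only [br]; ring

theorem W_comm (f g : Pol k) : W f g = W g f := by
  unfold W; congr 1; ext p; rw [br_swap, dg_neg]

/-- Two polynomials whose differentials are linearly independent. -/
def Ind (f g : Pol k) : Prop := ∃ i j, br i j f g ≠ 0

theorem Ind.symm {f g : Pol k} (h : Ind f g) : Ind g f := by
  obtain ⟨i, j, h⟩ := h
  exact ⟨i, j, by rwa [br_swap, neg_ne_zero]⟩

theorem br_dg_pos {i j : Fin 3} {f g : Pol k} (h : br i j f g ≠ 0) : 0 < dg (br i j f g) := by
  have e : br i j f g = X i * (X j * (pderiv i f * pderiv j g - pderiv j f * pderiv i g)) := by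
    simp only [br, D_apply]; ring
  rw [e] at h ⊢
  have h1 := left_ne_zero_of_mul h
  have h2 := right_ne_zero_of_mul h
  rw [dg_mul h1 h2]
  have : 0 < dg (X i : Pol k) := by
    refine lt_of_lt_of_le ?_ (le_dg (n := Finsupp.single i 1) (by simp [coeff_X]))
    refine lt_of_le_of_ne (wt_nonneg _) fun e => ?_
    have := wt_eq_zero.1 e.symm
    simp at this
  linarith [dg_nonneg (X j * (pderiv i f * pderiv j g - pderiv j f * pderiv i g))]

theorem Ind.W_pos {f g : Pol k} (h : Ind f g) : 0 < W f g := by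
  obtain ⟨i, j, h⟩ := h
  exact (br_dg_pos h).trans_le (dg_br_le_W i j f g)

theorem Ind.exists_W {f g : Pol k} (h : Ind f g) : ∃ i j, br i j f g ≠ 0 ∧ dg (br i j f g) = W f g := by
  obtain ⟨i, j, e⟩ := TameStab.exists_W f g
  exact ⟨i, j, ne_zero_of_dg_pos (by rw [e]; exact h.W_pos), e⟩

theorem Ind.dg_pos {f g : Pol k} (h : Ind f g) : 0 < dg f := by
  refine lt_of_le_of_ne (dg_nonneg f) fun e => ?_
  obtain ⟨c, rfl⟩ := dg_eq_zero.1 e.symm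
  obtain ⟨i, j, h⟩ := h
  exact h (by simp [br, D_apply])

theorem W_of_br_mul {f g f' g' p : Pol k} (h : ∀ i j, br i j f' g' = p * br i j f g)
    (hp : p ≠ 0) (hI : Ind f g) : W f' g' = dg p + W f g := by
  apply le_antisymm
  · refine W_le fun i j => ?_
    rw [h]
    exact (dg_mul_le _ _).trans (add_le_add_right (dg_br_le_W _ _ _ _) _)
  · obtain ⟨i, j, hne, e⟩ := hI.exists_W
    rw [← e, ← dg_mul hp hne, ← h]
    exact dg_br_le_W _ _ _ _

theorem br_add_right (i j : Fin 3) (f g h : Pol k) : br i j f (g + h) = br i j f g + br i j f h := by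
  simp only [br, map_add]; ring

theorem W_add_le (f g h : Pol k) : W f (g + h) ≤ max (W f g) (W f h) := by
  refine W_le fun i j => ?_
  rw [br_add_right]
  exact (dg_add_le _ _).trans (max_le_max (dg_br_le_W _ _ _ _) (dg_br_le_W _ _ _ _))

theorem W_sub_le (f g h : Pol k) : W f (g - h) ≤ max (W f g) (W f h) := by
  refine W_le fun i j => ?_
  have : br i j f (g - h) = br i j f g - br i j f h := by simp only [br, map_sub]; ring
  rw [this]
  exact (dg_sub_le _ _).trans (max_le_max (dg_br_le_W _ _ _ _) (dg_br_le_W _ _ _ _))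

theorem W_add_eq {f g h : Pol k} (hlt : W f h < W f g) : W f (g + h) = W f g := by
  apply le_antisymm
  · exact (W_add_le f g h).trans (max_le le_rfl hlt.le)
  · have := W_sub_le f (g + h) h
    rw [add_sub_cancel_right] at this
    rcases le_max_iff.1 this with h' | h'
    · exact h'
    · exact absurd hlt (not_lt.2 h')

/-- The Jacobian determinant with respect to the logarithmic derivatives. -/
noncomputable def J (f g h : Pol k) : Pol k :=
  D 0 f * br 1 2 g h - D 1 f * br 0 2 g h + D 2 f * br 0 1 g h

theorem J_swap12 (f g h : Pol k) : J f g h = -J g f h := by simp only [J, br]; ring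
theorem J_swap23 (f g h : Pol k) : J f g h = -J f h g := by simp only [J, br]; ring

theorem J_ne12 {f g h : Pol k} (hJ : J f g h ≠ 0) : J g f h ≠ 0 := by
  rw [J_swap12]; exact neg_ne_zero.2 hJ
theorem J_ne23 {f g h : Pol k} (hJ : J f g h ≠ 0) : J f h g ≠ 0 := by
  rw [J_swap23]; exact neg_ne_zero.2 hJ

theorem dg_J_le (f g h : Pol k) : dg (J f g h) ≤ dg f + W g h := by
  have key : ∀ l i j, dg (D l f * br i j g h) ≤ dg f + W g h := fun l i j =>
    (dg_mul_le _ _).trans (add_le_add (dg_D_le _ _) (dg_br_le_W _ _ _ _))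
  exact (dg_add_le _ _).trans (max_le ((dg_sub_le _ _).trans (max_le (key _ _ _) (key _ _ _)))
    (key _ _ _))

theorem Ind_of_J {f g h : Pol k} (hJ : J f g h ≠ 0) : Ind g h := by
  by_contra hI
  simp only [Ind, not_exists, not_not] at hI
  exact hJ (by simp [J, hI])

theorem Ind12 {f g h : Pol k} (hJ : J f g h ≠ 0) : Ind f g := Ind_of_J (J_ne12 (J_ne23 hJ))
theorem Ind13 {f g h : Pol k} (hJ : J f g h ≠ 0) : Ind f h := Ind_of_J (J_ne12 hJ)

theorem J_dg_pos {f g h : Pol k} (hJ : J f g h ≠ 0) : 0 < dg (J f g h) := by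
  have hX : 0 < dg (X 2 : Pol k) := by
    refine lt_of_lt_of_le ?_ (le_dg (n := Finsupp.single 2 1) (by simp [coeff_X]))
    simp [wt]
  have e : J f g h = X 2 * (X 0 * X 1 * (pderiv 0 f * (pderiv 1 g * pderiv 2 h - pderiv 2 g * pderiv 1 h)
    - pderiv 1 f * (pderiv 0 g * pderiv 2 h - pderiv 2 g * pderiv 0 h)
    + pderiv 2 f * (pderiv 0 g * pderiv 1 h - pderiv 1 g * pderiv 0 h))) := by
    simp only [J, br, D_apply]; ring
  have h2 := hJ
  rw [e] at h2
  rw [e, dg_mul (left_ne_zero_of_mul h2) (right_ne_zero_of_mul h2)]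
  exact add_pos_of_pos_of_nonneg hX (dg_nonneg _)

theorem TM [CharZero k] {f g h : Pol k} (hJ : J f g h ≠ 0) :
    dg f + W g h ≤ max (dg g + W f h) (dg h + W f g) := by
  obtain ⟨i, j, hne, e⟩ := (Ind_of_J hJ).exists_W
  have hE := E_ne_zero (Ind12 hJ).dg_pos
  rw [← e, ← hE.2, ← dg_mul hE.1 hne]
  have hid : ∃ s : k, E f * br i j g h = E g * br i j f h - E h * br i j f g + C s * J f g h := by
    fin_cases i <;> fin_cases j <;> first
      | (refine ⟨0, ?_⟩; simp [br, mul_comm]; done)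
      | (refine ⟨1, ?_⟩; simp [E, J, br]; ring1)
      | (refine ⟨-1, ?_⟩; simp [E, J, br]; ring1)
  obtain ⟨s, hs⟩ := hid
  have hEle : ∀ u : Pol k, dg (E u) ≤ dg u := fun u => by
    refine (dg_add_le _ _).trans (max_le ((dg_add_le _ _).trans (max_le ?_ ?_)) ?_) <;>
      exact dg_D_le _ _
  rw [hs]
  refine (dg_add_le _ _).trans (max_le ((dg_sub_le _ _).trans (max_le_max ?_ ?_)) ?_)
  · exact (dg_mul_le _ _).trans (add_le_add (hEle _) (dg_br_le_W _ _ _ _))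
  · exact (dg_mul_le _ _).trans (add_le_add (hEle _) (dg_br_le_W _ _ _ _))
  · refine le_max_of_le_left ((dg_C_mul_le _ _).trans ?_)
    rw [J_swap12, dg_neg]
    exact dg_J_le _ _ _

end TameStab

namespace TameStab
variable {k : Type} [Field k]

/-- Substitution of two polynomials in a bivariate polynomial. -/
noncomputable def ev (f g : Pol k) : MvPolynomial (Fin 2) k →ₐ[k] Pol k := aeval ![f, g]

@[simp] theorem ev_C (f g : Pol k) (c : k) : ev f g (C c) = C c := by
  simp [ev]
@[simp] theorem ev_X0 (f g : Pol k) : ev f g (X 0) = f := by simp [ev]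
@[simp] theorem ev_X1 (f g : Pol k) : ev f g (X 1) = g := by simp [ev]

theorem ev_monomial (f g : Pol k) (n : Fin 2 →₀ ℕ) (c : k) :
    ev f g (monomial n c) = C c * (f ^ n 0 * g ^ n 1) := by
  rw [ev, aeval_monomial, Finsupp.prod_fintype _ _ (by simp)]
  simp [Fin.prod_univ_two]

theorem D_ev (i : Fin 3) (f g : Pol k) (φ : MvPolynomial (Fin 2) k) :
    D i (ev f g φ) = ev f g (pderiv 0 φ) * D i f + ev f g (pderiv 1 φ) * D i g := by
  induction φ using MvPolynomial.induction_on with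
  | C a => simp [D_apply]
  | add p q hp hq => simp only [map_add, hp, hq]; ring
  | mul_X p j hp =>
    rw [map_mul, Derivation.leibniz, hp, Derivation.leibniz, Derivation.leibniz]
    fin_cases j <;> simp [pderiv_X] <;> ring

theorem br_ev (i j : Fin 3) (f g : Pol k) (φ : MvPolynomial (Fin 2) k) :
    br i j f (ev f g φ) = ev f g (pderiv 1 φ) * br i j f g := by
  simp only [br, D_ev]; ring

theorem J_ev (f g h : Pol k) (φ : MvPolynomial (Fin 2) k) :
    J f (ev f g φ) h = ev f g (pderiv 1 φ) * J f g h := by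
  simp only [J, br, D_ev]; ring

theorem J_add_ev (f g h : Pol k) (φ : MvPolynomial (Fin 2) k) :
    J f g (h + ev f g φ) = J f g h := by
  simp only [J, br, D_ev, map_add]; ring

theorem exists_dg_pos_of_coeff {f g : Pol k} {φ : MvPolynomial (Fin 2) k}
    (h : 0 < dg (ev f g φ)) :
    ∃ n, coeff n φ ≠ 0 ∧ dg (ev f g φ) ≤ n 0 * dg f + n 1 * dg g := by
  by_contra hcon
  push Not at hcon
  have hsum : ev f g φ = ∑ n ∈ φ.support, ev f g (monomial n (coeff n φ)) := by
    conv_lhs => rw [φ.as_sum]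
    rw [map_sum]
  have : ∃ c, c < dg (ev f g φ) ∧ 0 ≤ c ∧ ∀ n ∈ φ.support, n 0 * dg f + n 1 * dg g ≤ c := by
    refine ⟨(insert 0 φ.support).sup' (Finset.insert_nonempty _ _) fun n => n 0 * dg f + n 1 * dg g,
      ?_, ?_, ?_⟩
    · rw [Finset.sup'_lt_iff]
      intro n hn
      rcases Finset.mem_insert.1 hn with rfl | hn
      · simpa using h
      · exact hcon n (mem_support_iff.1 hn)
    · have := Finset.le_sup' (fun n : Fin 2 →₀ ℕ => n 0 * dg f + n 1 * dg g)
        (Finset.mem_insert_self 0 φ.support)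
      simp only [Finsupp.coe_zero, Pi.zero_apply, Nat.cast_zero, zero_mul, add_zero] at this
      exact this
    · intro n hn
      exact Finset.le_sup' (fun n : Fin 2 →₀ ℕ => n 0 * dg f + n 1 * dg g)
        (Finset.mem_insert_of_mem hn)
  obtain ⟨c, hc, hc0, hle⟩ := this
  refine absurd hc (not_lt.2 ?_)
  rw [hsum]
  refine dg_sum_le _ _ hc0 fun n hn => le_trans ?_ (hle n hn)
  rw [ev_monomial]
  refine (dg_C_mul_le _ _).trans ((dg_mul_le _ _).trans ?_)
  rw [dg_pow, dg_pow]

theorem dg_ev_monomial {f g : Pol k} (hf : f ≠ 0) (hg : g ≠ 0) (n : Fin 2 →₀ ℕ) {c : k}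
    (hc : c ≠ 0) : dg (ev f g (monomial n c)) = n 0 * dg f + n 1 * dg g := by
  rw [ev_monomial, dg_C_mul hc, dg_mul (pow_ne_zero _ hf) (pow_ne_zero _ hg), dg_pow, dg_pow]

section CharZero
variable [CharZero k]

theorem eq_C_of_pderiv {φ : MvPolynomial (Fin 2) k} (h0 : pderiv 0 φ = 0) (h1 : pderiv 1 φ = 0) :
    φ = C (coeff 0 φ) := by
  ext n
  rw [coeff_C]
  split_ifs with hn
  · rw [hn]
  · by_contra hne
    apply hn
    ext i
    have : coeff n (X i * pderiv i φ) = 0 := by fin_cases i <;> simp [h0, h1]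
    rw [coeff_X_mul_pderiv] at this
    rcases mul_eq_zero.1 this with h | h
    · simpa using (Nat.cast_eq_zero.1 h).symm
    · exact absurd h hne

theorem Ind.ev_eq_zero {f g : Pol k} (hI : Ind f g) {φ : MvPolynomial (Fin 2) k}
    (h : ev f g φ = 0) : φ = 0 := by
  obtain ⟨i, j, hne⟩ := hI
  have key : ∀ N : ℕ, ∀ φ : MvPolynomial (Fin 2) k, (∀ n, coeff n φ ≠ 0 → n 0 + n 1 ≤ N) →
      ev f g φ = 0 → φ = 0 := by
    intro N
    induction N with
    | zero =>
      intro φ hφ h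
      have : φ = C (coeff 0 φ) := by
        ext n
        rw [coeff_C]
        split_ifs with hn
        · rw [hn]
        · by_contra hc
          apply hn
          ext i
          have := hφ n hc
          fin_cases i <;> simp <;> omega
      rw [this] at h ⊢
      simpa using h
    | succ N ih =>
      intro φ hφ h
      have hp : ∀ l : Fin 2, ev f g (pderiv l φ) = 0 → pderiv l φ = 0 := by
        intro l hl
        refine ih _ (fun n hn => ?_) hl
        rw [coeff_pderiv] at hn
        have := hφ _ (left_ne_zero_of_mul hn)
        fin_cases l <;> simp at this <;> omega
      have h1 : pderiv 1 φ = 0 := by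
        apply hp
        have := br_ev i j f g φ
        rw [h] at this
        simp only [br, map_zero, mul_zero, sub_zero] at this
        exact (mul_eq_zero.1 this.symm).resolve_right hne
      have h0 : pderiv 0 φ = 0 := by
        apply hp
        have e : br i j (ev f g φ) g = ev f g (pderiv 0 φ) * br i j f g := by
          simp only [br, D_ev]; ring
        rw [h] at e
        simp only [br, map_zero, zero_mul, sub_zero] at e
        exact (mul_eq_zero.1 e.symm).resolve_right hne
      have := eq_C_of_pderiv h0 h1
      rw [this] at h ⊢
      simpa using h
  exact key _ φ (fun n hn => by
    have := le_totalDegree (mem_support_iff.2 hn)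
    rwa [Finsupp.sum_fintype _ _ (by simp), Fin.sum_univ_two] at this) h

theorem W_ev {f g : Pol k} (hI : Ind f g) {φ : MvPolynomial (Fin 2) k} (h : pderiv 1 φ ≠ 0) :
    W f (ev f g φ) = dg (ev f g (pderiv 1 φ)) + W f g :=
  W_of_br_mul (fun i j => br_ev i j f g φ) (fun h0 => h (hI.ev_eq_zero h0)) hI

theorem SL {f g : Pol k} (hI : Ind f g) {φ : MvPolynomial (Fin 2) k} (h : pderiv 1 φ ≠ 0) :
    dg (ev f g (pderiv 1 φ)) + W f g ≤ dg f + dg (ev f g φ) := by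
  rw [← W_ev hI h]; exact W_le_add _ _

/-- The set of exponents of `φ` that attain the formal degree `v`. -/
noncomputable def tops (a b v : ℝ) (φ : MvPolynomial (Fin 2) k) : Finset (Fin 2 →₀ ℕ) :=
  φ.support.filter fun n => n 0 * a + n 1 * b = v

omit [CharZero k] in
theorem mem_tops {a b v : ℝ} {φ : MvPolynomial (Fin 2) k} {n} :
    n ∈ tops a b v φ ↔ coeff n φ ≠ 0 ∧ n 0 * a + n 1 * b = v := by
  simp [tops]

theorem parachute_core {f g : Pol k} (hI : Ind f g) (s : ℕ) : ∀ (v : ℝ)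
    (φ : MvPolynomial (Fin 2) k), (∀ n, coeff n φ ≠ 0 → n 0 * dg f + n 1 * dg g ≤ v) →
    (tops (dg f) (dg g) v φ).card = s + 1 →
    v - s * (dg f + dg g - W f g) ≤ dg (ev f g φ) := by
  have hf := hI.dg_pos
  have hg := hI.symm.dg_pos
  induction s with
  | zero =>
    intro v φ hle hcard
    obtain ⟨n, hn⟩ := Finset.card_eq_one.1 hcard
    have hnm : n ∈ tops (dg f) (dg g) v φ := by rw [hn]; simp
    obtain ⟨hc, hv⟩ := mem_tops.1 hnm
    simp only [Nat.cast_zero, zero_mul, sub_zero]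
    rcases le_or_gt v 0 with h0 | h0
    · exact h0.trans (dg_nonneg _)
    have hm := dg_ev_monomial (ne_zero_of_dg_pos hf) (ne_zero_of_dg_pos hg) n hc
    have hrest : dg (ev f g (φ - monomial n (coeff n φ))) < v := by
      rcases (dg_nonneg (ev f g (φ - monomial n (coeff n φ)))).eq_or_lt with h | h
      · rwa [← h]
      · obtain ⟨m, hmc, hmle⟩ := exists_dg_pos_of_coeff h
        rw [coeff_sub, coeff_monomial] at hmc
        split_ifs at hmc with hnm
        · subst hnm; simp at hmc
        · rw [sub_zero] at hmc
          refine hmle.trans_lt (lt_of_le_of_ne (hle m hmc) fun e => hnm ?_)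
          have : m ∈ tops (dg f) (dg g) v φ := mem_tops.2 ⟨hmc, e⟩
          rw [hn, Finset.mem_singleton] at this
          exact this.symm
    have e : ev f g φ = ev f g (monomial n (coeff n φ)) + ev f g (φ - monomial n (coeff n φ)) := by
      rw [← map_add]; congr 1; ring
    rw [e, dg_add_eq (by rw [hm, hv]; exact hrest), hm, hv]
  | succ s ih =>
    intro v φ hle hcard
    obtain ⟨n, hnt⟩ : (tops (dg f) (dg g) v φ).Nonempty := by
      rw [← Finset.card_pos]; omega
    set ψ := X 1 * pderiv 1 φ - C (n 1 : k) * φ with hψ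
    have hcoeff : ∀ m, coeff m ψ = ((m 1 : k) - n 1) * coeff m φ := by
      intro m; rw [hψ, coeff_sub, coeff_X_mul_pderiv, coeff_C_mul]; ring
    have htops : tops (dg f) (dg g) v ψ = (tops (dg f) (dg g) v φ).erase n := by
      ext m
      rw [Finset.mem_erase, mem_tops, mem_tops, hcoeff]
      constructor
      · rintro ⟨h1, h2⟩
        refine ⟨?_, right_ne_zero_of_mul h1, h2⟩
        rintro rfl
        simp at h1
      · rintro ⟨hne, h1, h2⟩
        refine ⟨mul_ne_zero (fun h0 => hne ?_) h1, h2⟩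
        have e1 : m 1 = n 1 := by exact_mod_cast sub_eq_zero.1 h0
        have hv := (mem_tops.1 hnt).2
        have e0 : m 0 = n 0 := by
          have : (m 0 : ℝ) * dg f = n 0 * dg f := by rw [e1] at h2; linarith
          exact_mod_cast mul_right_cancel₀ hf.ne' this
        ext i; fin_cases i <;> simp [e0, e1]
    have h1 := ih v ψ (fun m hm => hle m (by rw [hcoeff] at hm; exact right_ne_zero_of_mul hm))
      (by rw [htops, Finset.card_erase_of_mem hnt, hcard]; rfl)
    have hW := W_le_add f g
    have h2 : dg (ev f g ψ) ≤ dg (ev f g φ) + (dg f + dg g - W f g) := by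
      have e : ev f g ψ = g * ev f g (pderiv 1 φ) - C (n 1 : k) * ev f g φ := by
        rw [hψ, map_sub, map_mul, map_mul, ev_X1, ev_C]
      rw [e]
      refine (dg_sub_le _ _).trans (max_le ?_ ?_)
      · by_cases h0 : pderiv 1 φ = 0
        · rw [h0]; simp only [map_zero, mul_zero, dg_zero]
          linarith [dg_nonneg (ev f g φ)]
        · have := SL hI h0
          have := dg_mul_le g (ev f g (pderiv 1 φ))
          linarith
      · exact (dg_C_mul_le _ _).trans (by linarith)
    push_cast
    linarith

theorem le_of_congr_card {S : Finset ℕ} {q s : ℕ} (hq : 0 < q) (hS : S.card = s + 1)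
    (h : ∀ x ∈ S, ∀ y ∈ S, x ≡ y [MOD q]) : ∃ x ∈ S, s * q ≤ x := by
  by_contra hcon
  push Not at hcon
  have hinj : Set.InjOn (fun x => x / q) (S : Set ℕ) := by
    intro x hx y hy hxy
    have := h x hx y hy
    rw [← Nat.div_add_mod x q, ← Nat.div_add_mod y q, show x / q = y / q from hxy, this]
  have hsub : S.image (fun x => x / q) ⊆ Finset.range s := by
    intro y hy
    obtain ⟨x, hx, rfl⟩ := Finset.mem_image.1 hy
    exact Finset.mem_range.2 ((Nat.div_lt_iff_lt_mul hq).2 (hcon x hx))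
  have := Finset.card_le_card hsub
  rw [Finset.card_image_of_injOn hinj, Finset.card_range] at this
  omega

/-- No monomial of `φ` has formal degree above the degree of `φ(f, g)`. -/
def NoDrop (f g : Pol k) (φ : MvPolynomial (Fin 2) k) : Prop :=
  ∀ n, coeff n φ ≠ 0 → n 0 * dg f + n 1 * dg g ≤ dg (ev f g φ)

omit [CharZero k] in
theorem NoDrop.exists_eq {f g : Pol k} {φ : MvPolynomial (Fin 2) k} (h : NoDrop f g φ)
    (hpos : 0 < dg (ev f g φ)) :
    ∃ n, coeff n φ ≠ 0 ∧ n 0 * dg f + n 1 * dg g = dg (ev f g φ) := by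
  obtain ⟨n, hn, hle⟩ := exists_dg_pos_of_coeff hpos
  exact ⟨n, hn, le_antisymm (h n hn) hle⟩

/-- Neither of two numbers is a multiple of the other. -/
def NonRes (a b : ℝ) : Prop := (∀ m : ℕ, a ≠ m * b) ∧ ∀ m : ℕ, b ≠ m * a

theorem NonRes.symm {a b : ℝ} (h : NonRes a b) : NonRes b a := ⟨h.2, h.1⟩

theorem parachute {f g : Pol k} (hI : Ind f g) (hres : NonRes (dg f) (dg g))
    (φ : MvPolynomial (Fin 2) k) : NoDrop f g φ ∨
    ∃ (p q : ℕ) (ε : ℝ), 0 < ε ∧ Nat.Coprime p q ∧ 2 ≤ p ∧ 2 ≤ q ∧ dg f = q * ε ∧ dg g = p * ε ∧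
      (p * q - p - q) * ε + W f g ≤ dg (ev f g φ) ∧
      (dg (ev f g φ) < p * q * ε → p * q * ε - dg g ≤ dg (ev f g (pderiv 1 φ))) := by
  by_cases hND : NoDrop f g φ
  · exact Or.inl hND
  right
  have hf := hI.dg_pos
  have hg := hI.symm.dg_pos
  simp only [NoDrop, not_forall, not_le] at hND
  obtain ⟨n₀, hn₀, hlt₀⟩ := hND
  obtain ⟨n, hn, hmax⟩ := Finset.exists_max_image φ.support
    (fun n => (n 0 : ℝ) * dg f + n 1 * dg g) ⟨n₀, mem_support_iff.2 hn₀⟩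
  set v := (n 0 : ℝ) * dg f + n 1 * dg g with hv
  have hle : ∀ m, coeff m φ ≠ 0 → (m 0 : ℝ) * dg f + m 1 * dg g ≤ v :=
    fun m hm => hmax m (mem_support_iff.2 hm)
  have hnt : n ∈ tops (dg f) (dg g) v φ := mem_tops.2 ⟨mem_support_iff.1 hn, rfl⟩
  have hvlt : dg (ev f g φ) < v := hlt₀.trans_le (hle _ hn₀)
  obtain ⟨s, hs⟩ : ∃ s, (tops (dg f) (dg g) v φ).card = s + 1 :=
    ⟨(tops (dg f) (dg g) v φ).card - 1, by
      have : 0 < (tops (dg f) (dg g) v φ).card := Finset.card_pos.2 ⟨n, hnt⟩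
      omega⟩
  have hcore := parachute_core hI s v φ hle hs
  have hs1 : 1 ≤ s := by
    by_contra h0
    have : s = 0 := by omega
    subst this
    simp at hcore
    linarith
  obtain ⟨m, hmt, hmn⟩ : ∃ m ∈ tops (dg f) (dg g) v φ, m ≠ n := by
    by_contra hcon
    push Not at hcon
    have : tops (dg f) (dg g) v φ ⊆ {n} := fun m hm => Finset.mem_singleton.2 (hcon m hm)
    have := Finset.card_le_card this
    simp at this
    omega
  -- the two degrees are commensurable
  have hdist : ∀ x ∈ tops (dg f) (dg g) v φ, ∀ y ∈ tops (dg f) (dg g) v φ,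
      x 1 = y 1 → x = y := by
    intro x hx y hy e1
    have hx := (mem_tops.1 hx).2
    have hy := (mem_tops.1 hy).2
    have e0 : x 0 = y 0 := by
      have : (x 0 : ℝ) * dg f = y 0 * dg f := by rw [e1] at hx; linarith
      exact_mod_cast mul_right_cancel₀ hf.ne' this
    ext i; fin_cases i <;> simp [e0, e1]
  obtain ⟨p, q, ε, hε, hcop, hqf, hpg⟩ : ∃ (p q : ℕ) (ε : ℝ), 0 < ε ∧ Nat.Coprime p q ∧
      dg f = q * ε ∧ dg g = p * ε := by
    have hne1 : m 1 ≠ n 1 := fun h => hmn (hdist m hmt n hnt h)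
    have hmv := (mem_tops.1 hmt).2
    have heq : ((m 0 : ℝ) - n 0) * dg f = (n 1 - m 1) * dg g := by rw [hv] at hmv; linarith
    obtain ⟨A, B, hA, hB, hAB⟩ : ∃ A B : ℕ, 0 < A ∧ 0 < B ∧ (A : ℝ) * dg f = B * dg g := by
      rcases lt_or_gt_of_ne hne1 with h | h
      · have : n 0 < m 0 := by
          have h1 : (0:ℝ) < (n 1 - m 1) * dg g := by
            apply mul_pos _ hg; have : (m 1 : ℝ) < n 1 := by exact_mod_cast h
            linarith
          rw [← heq] at h1
          have := pos_of_mul_pos_left h1 hf.le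
          have : (n 0 : ℝ) < m 0 := by linarith
          exact_mod_cast this
        exact ⟨m 0 - n 0, n 1 - m 1, by omega, by omega, by
          rw [Nat.cast_sub this.le, Nat.cast_sub h.le]; exact heq⟩
      · have : m 0 < n 0 := by
          have h1 : (n 1 - m 1) * dg g < 0 := by
            apply mul_neg_of_neg_of_pos _ hg; have : (n 1 : ℝ) < m 1 := by exact_mod_cast h
            linarith
          rw [← heq] at h1
          by_contra hc
          have : (n 0 : ℝ) ≤ m 0 := by exact_mod_cast (not_lt.1 hc)
          have := mul_nonneg (sub_nonneg.2 this) hf.le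
          linarith
        exact ⟨n 0 - m 0, m 1 - n 1, by omega, by omega, by
          rw [Nat.cast_sub this.le, Nat.cast_sub h.le]; linarith⟩
    set d := Nat.gcd A B with hd
    have hd0 : 0 < d := Nat.gcd_pos_of_pos_left _ hA
    have hA' : (A : ℝ) = (A / d : ℕ) * d := by
      exact_mod_cast (Nat.div_mul_cancel (Nat.gcd_dvd_left A B)).symm
    have hB' : (B : ℝ) = (B / d : ℕ) * d := by
      exact_mod_cast (Nat.div_mul_cancel (Nat.gcd_dvd_right A B)).symm
    have hBd : 0 < B / d := Nat.div_pos (Nat.le_of_dvd hB (Nat.gcd_dvd_right A B)) hd0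
    have hBdR : (0:ℝ) < (B / d : ℕ) := by exact_mod_cast hBd
    have hdR : (0:ℝ) < d := by exact_mod_cast hd0
    refine ⟨A / d, B / d, dg f / (B / d : ℕ), div_pos hf hBdR, Nat.coprime_div_gcd_div_gcd hd0, ?_, ?_⟩
    · field_simp
    · rw [hA', hB'] at hAB
      have : ((A / d : ℕ) : ℝ) * dg f = (B / d : ℕ) * dg g := by
        have : (d : ℝ) * ((A / d : ℕ) * dg f) = d * ((B / d : ℕ) * dg g) := by linarith
        exact mul_left_cancel₀ hdR.ne' this
      field_simp
      linarith
  have hq2 : 2 ≤ q := by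
    by_contra h
    have : q = 0 ∨ q = 1 := by omega
    rcases this with rfl | rfl
    · simp at hqf; linarith
    · exact hres.2 p (by rw [hpg, hqf]; simp)
  have hp2 : 2 ≤ p := by
    by_contra h
    have : p = 0 ∨ p = 1 := by omega
    rcases this with rfl | rfl
    · simp at hpg; linarith
    · exact hres.1 q (by rw [hpg, hqf]; simp)
  have hvbig : s * (p * q * ε) ≤ v := by
    obtain ⟨x, hx, hxs⟩ := le_of_congr_card (S := (tops (dg f) (dg g) v φ).image fun n => n 1)
      (q := q) (s := s) (by omega) (by
        rw [Finset.card_image_of_injOn (fun x hx y hy h => hdist x hx y hy h), hs]) (by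
        intro x hx y hy
        obtain ⟨x', hx', rfl⟩ := Finset.mem_image.1 hx
        obtain ⟨y', hy', rfl⟩ := Finset.mem_image.1 hy
        have h1 := (mem_tops.1 hx').2
        have h2 := (mem_tops.1 hy').2
        have h3 : x' 0 * q + x' 1 * p = y' 0 * q + y' 1 * p := by
          have : ((x' 0 : ℝ) * q + x' 1 * p) * ε = (y' 0 * q + y' 1 * p) * ε := by
            rw [hqf, hpg] at h1 h2; linarith
          exact_mod_cast mul_right_cancel₀ hε.ne' this
        have h4 : p * x' 1 ≡ p * y' 1 [MOD q] := by
          have h5 : x' 0 * q + x' 1 * p ≡ y' 0 * q + y' 1 * p [MOD q] := by rw [h3]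
          have e1 : x' 0 * q + x' 1 * p ≡ x' 1 * p [MOD q] := by simp [Nat.ModEq]
          have e2 : y' 0 * q + y' 1 * p ≡ y' 1 * p [MOD q] := by simp [Nat.ModEq]
          rw [mul_comm p, mul_comm p]
          exact e1.symm.trans (h5.trans e2)
        exact Nat.ModEq.cancel_left_of_coprime (by
          rw [Nat.gcd_comm]; exact hcop) h4)
    obtain ⟨x', hx', rfl⟩ := Finset.mem_image.1 hx
    have h1 := (mem_tops.1 hx').2
    rw [← h1, hpg]
    have : (s * q : ℝ) ≤ x' 1 := by exact_mod_cast hxs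
    have h2 : (s * q : ℝ) * (p * ε) ≤ x' 1 * (p * ε) := mul_le_mul_of_nonneg_right this (by positivity)
    have h3 : 0 ≤ (x' 0 : ℝ) * dg f := by positivity
    linarith
  have hW := W_le_add f g
  have hpq : (1:ℝ) ≤ p * q - p - q + 1 := by
    have h1 : (2:ℝ) ≤ p := by exact_mod_cast hp2
    have h2 : (2:ℝ) ≤ q := by exact_mod_cast hq2
    nlinarith
  have hs1R : (1:ℝ) ≤ s := by exact_mod_cast hs1
  refine ⟨p, q, ε, hε, hcop, hp2, hq2, hqf, hpg, ?_, fun hlt => ?_⟩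
  · have e : p * q * ε - (dg f + dg g - W f g) = (p * q - p - q) * ε + W f g := by
      rw [hqf, hpg]; ring
    have h0 : 0 ≤ p * q * ε - (dg f + dg g - W f g) := by
      rw [e]
      have := W_nonneg f g
      have := mul_nonneg (show (0:ℝ) ≤ p * q - p - q by linarith) hε.le
      linarith
    rw [← e]
    nlinarith
  · set ψ := X 1 * pderiv 1 φ - C (n 1 : k) * φ with hψ
    have hcoeff : ∀ m, coeff m ψ = ((m 1 : k) - n 1) * coeff m φ := by
      intro m; rw [hψ, coeff_sub, coeff_X_mul_pderiv, coeff_C_mul]; ring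
    have htops : tops (dg f) (dg g) v ψ = (tops (dg f) (dg g) v φ).erase n := by
      ext m
      rw [Finset.mem_erase, mem_tops, mem_tops, hcoeff]
      constructor
      · rintro ⟨h1, h2⟩
        refine ⟨?_, right_ne_zero_of_mul h1, h2⟩
        rintro rfl
        simp at h1
      · rintro ⟨hne, h1, h2⟩
        refine ⟨mul_ne_zero (fun h0 => hne ?_) h1, h2⟩
        have e1 : m 1 = n 1 := by exact_mod_cast sub_eq_zero.1 h0
        exact hdist m (mem_tops.2 ⟨h1, h2⟩) n hnt e1
    have h1 := parachute_core hI (s - 1) v ψ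
      (fun m hm => hle m (by rw [hcoeff] at hm; exact right_ne_zero_of_mul hm))
      (by rw [htops, Finset.card_erase_of_mem hnt, hs]; omega)
    rw [Nat.cast_sub hs1, Nat.cast_one] at h1
    have h0 : 0 ≤ p * q * ε - (dg f + dg g - W f g) := by
      have e : p * q * ε - (dg f + dg g - W f g) = (p * q - p - q) * ε + W f g := by
        rw [hqf, hpg]; ring
      rw [e]
      have := W_nonneg f g
      have := mul_nonneg (show (0:ℝ) ≤ p * q - p - q by linarith) hε.le
      linarith
    have h2 : p * q * ε ≤ dg (ev f g ψ) := by nlinarith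
    have e : ev f g ψ = g * ev f g (pderiv 1 φ) - C (n 1 : k) * ev f g φ := by
      rw [hψ, map_sub, map_mul, map_mul, ev_X1, ev_C]
    rw [e] at h2
    have h3 := dg_sub_le (g * ev f g (pderiv 1 φ)) (C (n 1 : k) * ev f g φ)
    have h4 := dg_mul_le g (ev f g (pderiv 1 φ))
    have h5 := dg_C_mul_le (n 1 : k) (ev f g φ)
    rcases le_max_iff.1 (h2.trans h3) with h | h <;> linarith

end CharZero
end TameStab

namespace TameStab
variable {k : Type} [Field k]

section CharZero
variable [CharZero k]

theorem noDrop_of_le_W {f g : Pol k} (hI : Ind f g) (hres : NonRes (dg f) (dg g))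
    {φ : MvPolynomial (Fin 2) k} (h : dg (ev f g φ) ≤ W f g) : NoDrop f g φ := by
  rcases parachute hI hres φ with h1 | ⟨p, q, ε, hε, hcop, hp, hq, -, -, hge, -⟩
  · exact h1
  · exfalso
    have h1 : (2:ℝ) ≤ p := by exact_mod_cast hp
    have h2 : (2:ℝ) ≤ q := by exact_mod_cast hq
    have hne : p ≠ q := by
      rintro rfl
      have := (Nat.coprime_self p).1 hcop
      omega
    have h3 : (1:ℝ) ≤ p * q - p - q := by
      have : p + q + 1 ≤ p * q := by
        rcases lt_or_gt_of_ne hne with h | h <;> nlinarith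
      have : (p + q + 1 : ℝ) ≤ p * q := by exact_mod_cast this
      linarith
    nlinarith

/-- No polynomial in `f, g` can lower the degree of `c`. -/
theorem irreducible_of_W {f g c : Pol k} (hI : Ind f g) (hres : NonRes (dg f) (dg g))
    (hc : dg c ≤ W f g) (hmem : ∀ n m : ℕ, dg c ≠ n * dg f + m * dg g)
    (φ : MvPolynomial (Fin 2) k) : dg c ≤ dg (c + ev f g φ) := by
  by_contra hlt
  push Not at hlt
  have e : dg (ev f g φ) = dg c := by
    have : ev f g φ = (c + ev f g φ) - c := by ring
    rw [this, dg_sub_comm, dg_sub_eq hlt]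
  have hnd := noDrop_of_le_W hI hres (φ := φ) (by rw [e]; exact hc)
  obtain ⟨n, -, hn⟩ := hnd.exists_eq (by rw [e]; exact (dg_nonneg _).trans_lt hlt)
  exact hmem _ _ (by rw [hn, e])

theorem drop_lt_max {f g : Pol k} (hI : Ind f g) (hres : NonRes (dg f) (dg g))
    {φ : MvPolynomial (Fin 2) k} (h : dg (ev f g φ) < max (dg f) (dg g)) : NoDrop f g φ ∨
    ∃ (p : ℕ) (ε : ℝ), 0 < ε ∧ Odd p ∧ 3 ≤ p ∧
      (dg f = 2 * ε ∧ dg g = p * ε ∨ dg f = p * ε ∧ dg g = 2 * ε) ∧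
      (p - 2) * ε + W f g ≤ dg (ev f g φ) ∧
      2 * p * ε - dg g ≤ dg (ev f g (pderiv 1 φ)) := by
  rcases parachute hI hres φ with h1 | ⟨p, q, ε, hε, hcop, hp, hq, hf, hg, hge, hd⟩
  · exact Or.inl h1
  right
  have hW := hI.W_pos
  have h1 : (2:ℝ) ≤ p := by exact_mod_cast hp
  have h2 : (2:ℝ) ≤ q := by exact_mod_cast hq
  have key : ∀ a b : ℕ, Nat.Coprime a b → 2 ≤ b → b < a →
      ((a:ℝ) * b - a - b) * ε < a * ε → b = 2 ∧ Odd a ∧ 3 ≤ a := by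
    intro a b hab hb hba hlt
    have h3 : (a:ℝ) * b - a - b < a := lt_of_mul_lt_mul_right hlt hε.le
    have h4 : a * b < 2 * a + b := by
      have : (a:ℝ) * b < 2 * a + b := by linarith
      exact_mod_cast this
    have hb2 : b = 2 := by
      by_contra hne
      have : 3 ≤ b := by omega
      nlinarith
    subst hb2
    refine ⟨rfl, ?_, by omega⟩
    rw [← Nat.not_even_iff_odd, even_iff_two_dvd]
    intro h2
    have := Nat.dvd_gcd h2 (dvd_refl 2)
    rw [hab] at this
    omega
  have hne : p ≠ q := by
    rintro rfl
    have := (Nat.coprime_self p).1 hcop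
    omega
  rcases lt_or_gt_of_ne hne with hpq | hpq
  · have hpqR : (p:ℝ) < q := by exact_mod_cast hpq
    have hmax : max (dg f) (dg g) = q * ε := by
      rw [hf, hg]; exact max_eq_left (mul_le_mul_of_nonneg_right hpqR.le hε.le)
    rw [hmax] at h
    obtain ⟨rfl, ho, h3⟩ := key q p hcop.symm hp hpq (by
      have e : ((q:ℝ) * p - q - p) = p * q - p - q := by ring
      rw [e]; linarith)
    refine ⟨q, ε, hε, ho, h3, Or.inr ⟨hf, by simpa using hg⟩, ?_, ?_⟩
    · have e : (((2:ℕ):ℝ) * q - (2:ℕ) - q) = q - 2 := by push_cast; ring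
      rw [e] at hge; exact hge
    · have := hd (by push_cast; nlinarith)
      push_cast at this; exact this
  · have hpqR : (q:ℝ) < p := by exact_mod_cast hpq
    have hmax : max (dg f) (dg g) = p * ε := by
      rw [hf, hg]; exact max_eq_right (mul_le_mul_of_nonneg_right hpqR.le hε.le)
    rw [hmax] at h
    obtain ⟨rfl, ho, h3⟩ := key p q hcop hq hpq (by linarith)
    refine ⟨p, ε, hε, ho, h3, Or.inl ⟨by simpa using hf, hg⟩, ?_, ?_⟩
    · have e : ((p:ℝ) * (2:ℕ) - p - (2:ℕ)) = p - 2 := by push_cast; ring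
      rw [e] at hge; exact hge
    · have := hd (by push_cast; nlinarith)
      push_cast at this
      have e : (p:ℝ) * 2 * ε = 2 * p * ε := by ring
      rwa [e] at this

omit [CharZero k] in
/-- A bivariate polynomial without second variable. -/
theorem exists_univariate {φ : MvPolynomial (Fin 2) k} (h : ∀ n, coeff n φ ≠ 0 → n 1 = 0) :
    ∃ P : Polynomial k, ∀ f g : Pol k, ev f g φ = Polynomial.aeval f P := by
  refine ⟨∑ n ∈ φ.support, Polynomial.monomial (n 0) (coeff n φ), fun f g => ?_⟩
  conv_lhs => rw [φ.as_sum]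
  rw [map_sum, map_sum]
  refine Finset.sum_congr rfl fun n hn => ?_
  rw [ev_monomial, h n (mem_support_iff.1 hn), Polynomial.aeval_monomial, pow_zero, mul_one]
  rfl

theorem n1_eq_zero_of_pderiv {φ : MvPolynomial (Fin 2) k} (h : pderiv 1 φ = 0) (n)
    (hn : coeff n φ ≠ 0) : n 1 = 0 := by
  have : coeff n (X 1 * pderiv 1 φ) = 0 := by simp [h]
  rw [coeff_X_mul_pderiv] at this
  exact_mod_cast (mul_eq_zero.1 this).resolve_right hn

end CharZero

theorem dg_aeval_le {f : Pol k} (P : Polynomial k) :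
    dg (Polynomial.aeval f P) ≤ P.natDegree * dg f := by
  rw [Polynomial.aeval_eq_sum_range]
  refine dg_sum_le _ _ (mul_nonneg (Nat.cast_nonneg _) (dg_nonneg _)) fun i hi => ?_
  rw [MvPolynomial.smul_eq_C_mul]
  refine (dg_C_mul_le _ _).trans ?_
  rw [dg_pow]
  have : (i:ℝ) ≤ P.natDegree := by exact_mod_cast Nat.lt_succ_iff.1 (Finset.mem_range.1 hi)
  exact mul_le_mul_of_nonneg_right this (dg_nonneg _)

theorem dg_aeval {f : Pol k} (hf : 0 < dg f) (P : Polynomial k) :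
    dg (Polynomial.aeval f P) = P.natDegree * dg f := by
  by_cases h0 : P.natDegree = 0
  · rw [Polynomial.eq_C_of_natDegree_eq_zero h0]
    simp
    exact dg_C (P.coeff 0)
  have e : P = P.eraseLead + Polynomial.monomial P.natDegree P.leadingCoeff :=
    P.eraseLead_add_monomial_natDegree_leadingCoeff.symm
  have hlc : P.leadingCoeff ≠ 0 := by
    rw [Ne, Polynomial.leadingCoeff_eq_zero]; rintro rfl; simp at h0
  have h1 : dg (Polynomial.aeval f (Polynomial.monomial P.natDegree P.leadingCoeff)) =
      P.natDegree * dg f := by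
    rw [Polynomial.aeval_monomial, MvPolynomial.algebraMap_eq, dg_C_mul hlc, dg_pow]
  have h2 : dg (Polynomial.aeval f P.eraseLead) < P.natDegree * dg f := by
    refine (dg_aeval_le _).trans_lt (mul_lt_mul_of_pos_right ?_ hf)
    have := P.eraseLead_natDegree_le
    have : P.eraseLead.natDegree < P.natDegree := by omega
    exact_mod_cast this
  conv_lhs => rw [e]
  rw [map_add, dg_add_eq' (by rw [h1]; exact h2), h1]

/-- The linear span of `1, f, g`. -/
noncomputable def L (f g : Pol k) : Submodule k (Pol k) := Submodule.span k {1, f, g}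

/-- The linear span of `1, f, g, h`. -/
noncomputable def V (f g h : Pol k) : Submodule k (Pol k) := Submodule.span k {1, f, g, h}

/-- The subalgebra generated by `f, g`. -/
noncomputable def A (f g : Pol k) : Subalgebra k (Pol k) := (ev f g).range

theorem mem_A {f g p : Pol k} : p ∈ A f g ↔ ∃ φ, ev f g φ = p := AlgHom.mem_range _

theorem mem_L {f g p : Pol k} : p ∈ L f g ↔ ∃ a b c : k, p = C a * f + C b * g + C c := by
  rw [L, Submodule.mem_span_insert]
  simp only [Submodule.mem_span_pair]
  constructor
  · rintro ⟨c, _, ⟨a, b, rfl⟩, rfl⟩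
    exact ⟨a, b, c, by simp only [smul_eq_C_mul, mul_one]; ring⟩
  · rintro ⟨a, b, c, rfl⟩
    exact ⟨c, _, ⟨a, b, rfl⟩, by simp only [smul_eq_C_mul, mul_one]; ring⟩

theorem mem_V {f g h p : Pol k} :
    p ∈ V f g h ↔ ∃ a b c d : k, p = C a * f + C b * g + C c * h + C d := by
  rw [V, Submodule.mem_span_insert]
  simp only [Submodule.mem_span_triple]
  constructor
  · rintro ⟨d, _, ⟨a, b, c, rfl⟩, rfl⟩
    exact ⟨a, b, c, d, by simp only [smul_eq_C_mul, mul_one]; ring⟩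
  · rintro ⟨a, b, c, d, rfl⟩
    exact ⟨d, _, ⟨a, b, c, rfl⟩, by simp only [smul_eq_C_mul, mul_one]; ring⟩

theorem left_mem_L (f g : Pol k) : f ∈ L f g := mem_L.2 ⟨1, 0, 0, by simp⟩
theorem right_mem_L (f g : Pol k) : g ∈ L f g := mem_L.2 ⟨0, 1, 0, by simp⟩
theorem C_mem_L (f g : Pol k) (c : k) : C c ∈ L f g := mem_L.2 ⟨0, 0, c, by simp⟩
theorem C_mul_mem {S : Submodule k (Pol k)} {f : Pol k} (c : k) (h : f ∈ S) : C c * f ∈ S := by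
  rw [← smul_eq_C_mul]; exact S.smul_mem c h

theorem fst_mem_V (f g h : Pol k) : f ∈ V f g h := mem_V.2 ⟨1, 0, 0, 0, by simp⟩
theorem snd_mem_V (f g h : Pol k) : g ∈ V f g h := mem_V.2 ⟨0, 1, 0, 0, by simp⟩
theorem thd_mem_V (f g h : Pol k) : h ∈ V f g h := mem_V.2 ⟨0, 0, 1, 0, by simp⟩
theorem C_mem_V (f g h : Pol k) (c : k) : C c ∈ V f g h := mem_V.2 ⟨0, 0, 0, c, by simp⟩

theorem L_le {f g : Pol k} {S : Submodule k (Pol k)} (hc : ∀ c, C c ∈ S) (hf : f ∈ S)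
    (hg : g ∈ S) : L f g ≤ S := by
  intro p hp
  obtain ⟨a, b, c, rfl⟩ := mem_L.1 hp
  exact S.add_mem (S.add_mem (C_mul_mem _ hf) (C_mul_mem _ hg)) (hc c)

theorem V_le {f g h : Pol k} {S : Submodule k (Pol k)} (hc : ∀ c, C c ∈ S) (hf : f ∈ S)
    (hg : g ∈ S) (hh : h ∈ S) : V f g h ≤ S := by
  intro p hp
  obtain ⟨a, b, c, d, rfl⟩ := mem_V.1 hp
  exact S.add_mem (S.add_mem (S.add_mem (C_mul_mem _ hf) (C_mul_mem _ hg)) (C_mul_mem _ hh)) (hc d)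

theorem V_swap12 (f g h : Pol k) : V f g h = V g f h := by
  rw [V, V, Set.insert_comm f g]

theorem V_swap23 (f g h : Pol k) : V f g h = V f h g := by
  rw [V, V, Set.pair_comm g h]

theorem L_swap (f g : Pol k) : L f g = L g f := by
  rw [L, L, Set.pair_comm f g]

theorem L_le_V (f g h : Pol k) : L f g ≤ V f g h :=
  L_le (C_mem_V f g h) (fst_mem_V f g h) (snd_mem_V f g h)

theorem V_congr_L {f g f' g' h : Pol k} (hL : L f g = L f' g') : V f g h = V f' g' h := by
  apply le_antisymm
  · refine V_le (C_mem_V _ _ _) ?_ ?_ (thd_mem_V _ _ _)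
    · exact L_le_V _ _ _ (hL ▸ left_mem_L f g)
    · exact L_le_V _ _ _ (hL ▸ right_mem_L f g)
  · refine V_le (C_mem_V _ _ _) ?_ ?_ (thd_mem_V _ _ _)
    · exact L_le_V _ _ _ (hL ▸ left_mem_L f' g')
    · exact L_le_V _ _ _ (hL ▸ right_mem_L f' g')

theorem V_congr3 {f g h h' : Pol k} {κ : k} (hκ : κ ≠ 0) (hh : h' - C κ * h ∈ L f g) :
    V f g h' = V f g h := by
  obtain ⟨a, b, c, e⟩ := mem_L.1 hh
  have e1 : h' = C a * f + C b * g + C κ * h + C c := by linear_combination e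
  apply le_antisymm
  · exact V_le (C_mem_V _ _ _) (fst_mem_V _ _ _) (snd_mem_V _ _ _) (mem_V.2 ⟨a, b, κ, c, e1⟩)
  · refine V_le (C_mem_V _ _ _) (fst_mem_V _ _ _) (snd_mem_V _ _ _)
      (mem_V.2 ⟨-κ⁻¹ * a, -κ⁻¹ * b, κ⁻¹, -κ⁻¹ * c, ?_⟩)
    have hk : (C κ⁻¹ : Pol k) * C κ = 1 := by rw [← C_mul, inv_mul_cancel₀ hκ, C_1]
    rw [e1]
    simp only [C_mul, C_neg]
    linear_combination (-h) * hk

theorem V_congr3' {f g h h' : Pol k} (hh : h' - h ∈ L f g) : V f g h' = V f g h :=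
  V_congr3 one_ne_zero (by simpa using hh)

theorem L_congr2 {f g g' : Pol k} {κ : k} (hκ : κ ≠ 0) {a b : k}
    (e : g' = C κ * g + C a * f + C b) : L f g' = L f g := by
  apply le_antisymm
  · exact L_le (C_mem_L _ _) (left_mem_L _ _) (mem_L.2 ⟨a, κ, b, by rw [e]; ring⟩)
  · refine L_le (C_mem_L _ _) (left_mem_L _ _) (mem_L.2 ⟨-κ⁻¹ * a, κ⁻¹, -κ⁻¹ * b, ?_⟩)
    have hk : (C κ⁻¹ : Pol k) * C κ = 1 := by rw [← C_mul, inv_mul_cancel₀ hκ, C_1]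
    rw [e]
    simp only [C_mul, C_neg]
    linear_combination (-g) * hk

theorem left_mem_A (f g : Pol k) : f ∈ A f g := mem_A.2 ⟨X 0, by simp⟩
theorem right_mem_A (f g : Pol k) : g ∈ A f g := mem_A.2 ⟨X 1, by simp⟩
theorem C_mem_A (f g : Pol k) (c : k) : C c ∈ A f g := mem_A.2 ⟨C c, by simp⟩

theorem A_le {f g : Pol k} {S : Subalgebra k (Pol k)} (hf : f ∈ S) (hg : g ∈ S) : A f g ≤ S := by
  intro p hp
  obtain ⟨φ, rfl⟩ := mem_A.1 hp
  clear hp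
  induction φ using MvPolynomial.induction_on with
  | C a => rw [ev_C]; exact S.algebraMap_mem a
  | add p q hp hq => rw [map_add]; exact S.add_mem hp hq
  | mul_X p j hp =>
    rw [map_mul]
    refine S.mul_mem hp ?_
    fin_cases j
    · simpa using hf
    · simpa using hg

theorem A_swap (f g : Pol k) : A f g = A g f :=
  le_antisymm (A_le (right_mem_A _ _) (left_mem_A _ _)) (A_le (right_mem_A _ _) (left_mem_A _ _))

theorem L_le_A (f g : Pol k) : L f g ≤ Subalgebra.toSubmodule (A f g) :=
  L_le (C_mem_A f g) (left_mem_A f g) (right_mem_A f g)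

theorem A_congr_L {f g f' g' : Pol k} (hL : L f g = L f' g') : A f g = A f' g' := by
  apply le_antisymm
  · exact A_le (L_le_A _ _ (hL ▸ left_mem_L f g)) (L_le_A _ _ (hL ▸ right_mem_L f g))
  · exact A_le (L_le_A _ _ (hL ▸ left_mem_L f' g')) (L_le_A _ _ (hL ▸ right_mem_L f' g'))

theorem aeval_mem {S : Subalgebra k (Pol k)} {f : Pol k} (hf : f ∈ S) (P : Polynomial k) :
    Polynomial.aeval f P ∈ S := by
  rw [Polynomial.aeval_eq_sum_range]
  exact S.sum_mem fun i _ => S.smul_mem (S.pow_mem hf i) _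

theorem C_mul_mem_A {S : Subalgebra k (Pol k)} {f : Pol k} (c : k) (h : f ∈ S) : C c * f ∈ S := by
  rw [← smul_eq_C_mul]; exact S.smul_mem h c

theorem J_congr {f g h h' : Pol k} (hh : h' - h ∈ A f g) : J f g h' = J f g h := by
  obtain ⟨φ, e⟩ := mem_A.1 hh
  have : h' = h + ev f g φ := by rw [e]; ring
  rw [this, J_add_ev]

/-- The Jacobian of a triple in terms of the coordinates with respect to another triple. -/
theorem J_comb {x y z a b c : Pol k} {a1 a2 a3 a4 b1 b2 b3 b4 c1 c2 c3 c4 : k}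
    (ha : a = C a1 * x + C a2 * y + C a3 * z + C a4)
    (hb : b = C b1 * x + C b2 * y + C b3 * z + C b4)
    (hc : c = C c1 * x + C c2 * y + C c3 * z + C c4) :
    J a b c = C (a1 * (b2 * c3 - b3 * c2) - a2 * (b1 * c3 - b3 * c1) + a3 * (b1 * c2 - b2 * c1)) *
      J x y z := by
  have hD : ∀ (i : Fin 3) (p q r s : k), D i (C p * x + C q * y + C r * z + C s) =
      C p * D i x + C q * D i y + C r * D i z := by
    intro i p q r s
    simp [D_apply]; ring
  subst ha hb hc
  simp only [J, br, hD, C_add, C_sub, C_mul]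
  ring

theorem J_ne_of_V {x y z a b c : Pol k} (hV : V a b c = V x y z) (hJ : J a b c ≠ 0) :
    J x y z ≠ 0 := by
  obtain ⟨a1, a2, a3, a4, ha⟩ := mem_V.1 (hV ▸ fst_mem_V a b c)
  obtain ⟨b1, b2, b3, b4, hb⟩ := mem_V.1 (hV ▸ snd_mem_V a b c)
  obtain ⟨c1, c2, c3, c4, hc⟩ := mem_V.1 (hV ▸ thd_mem_V a b c)
  rw [J_comb ha hb hc] at hJ
  exact right_ne_zero_of_mul hJ

/-- Pairwise distinct degrees. -/
def Dist (f g h : Pol k) : Prop := dg f ≠ dg g ∧ dg f ≠ dg h ∧ dg g ≠ dg h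

theorem Dist.swap12 {f g h : Pol k} (H : Dist f g h) : Dist g f h := ⟨H.1.symm, H.2.2, H.2.1⟩

open Classical in
theorem dg_C_mul_add_C_mul {f g : Pol k} (h : dg f ≠ dg g) (a b : k) :
    dg (C a * f + C b * g) = max (if a = 0 then 0 else dg f) (if b = 0 then 0 else dg g) := by
  by_cases ha : a = 0
  · subst ha
    by_cases hb : b = 0
    · subst hb; simp [dg_zero]
    · simp [hb, dg_C_mul hb, dg_nonneg]
  · by_cases hb : b = 0
    · subst hb; simp [ha, dg_C_mul ha, dg_nonneg]
    · simp only [ha, hb, if_false]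
      rcases lt_or_gt_of_ne h with h | h
      · rw [dg_add_eq' (by rwa [dg_C_mul ha, dg_C_mul hb]), dg_C_mul hb, max_eq_right h.le]
      · rw [dg_add_eq (by rwa [dg_C_mul ha, dg_C_mul hb]), dg_C_mul ha, max_eq_left h.le]

theorem dg_add_C (f : Pol k) (c : k) : dg (f + C c) = dg f := by
  rcases (dg_nonneg f).eq_or_lt with h | h
  · obtain ⟨d, rfl⟩ := dg_eq_zero.1 h.symm
    rw [← C_add, dg_C, dg_C]
  · exact dg_add_eq (by rwa [dg_C])

open Classical in
theorem le_dg_comb {x y z : Pol k} (hd : Dist x y z) (a b c d : k) :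
    (a ≠ 0 → dg x ≤ dg (C a * x + C b * y + C c * z + C d)) ∧
    (b ≠ 0 → dg y ≤ dg (C a * x + C b * y + C c * z + C d)) ∧
    (c ≠ 0 → dg z ≤ dg (C a * x + C b * y + C c * z + C d)) := by
  rw [dg_add_C]
  have hxy := dg_C_mul_add_C_mul hd.1 a b
  have key : dg (C a * x + C b * y + C c * z) = max (max (if a = 0 then 0 else dg x)
      (if b = 0 then 0 else dg y)) (if c = 0 then 0 else dg z) := by
    rw [← hxy]
    by_cases hc : c = 0
    · subst hc; simp [dg_nonneg]
    · simp only [hc, if_false]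
      have hne : dg (C a * x + C b * y) ≠ dg z ∨ dg (C a * x + C b * y) = dg z ∧ dg z = 0 := by
        rw [hxy]
        by_cases ha : a = 0 <;> by_cases hb : b = 0 <;> simp only [ha, hb, if_true, if_false]
        · rcases eq_or_ne (dg z) 0 with h | h
          · right; simp [h]
          · left; simpa using h.symm
        · left; rw [max_eq_right (dg_nonneg y)]; exact hd.2.2
        · left; rw [max_eq_left (dg_nonneg x)]; exact hd.2.1
        · left
          rcases le_total (dg x) (dg y) with h | h
          · rw [max_eq_right h]; exact hd.2.2
          · rw [max_eq_left h]; exact hd.2.1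
      rcases hne with h | ⟨h1, h2⟩
      · have := dg_C_mul_add_C_mul h 1 c
        simpa [hc] using this
      · rw [h1, h2, max_self]
        rw [h2] at h1
        obtain ⟨e, he⟩ := dg_eq_zero.1 h1
        obtain ⟨e', rfl⟩ := dg_eq_zero.1 h2
        rw [he, ← C_mul, ← C_add, dg_C]
  rw [key]
  refine ⟨fun h => ?_, fun h => ?_, fun h => ?_⟩ <;> simp [h]

theorem sum_le_of_V {x y z a b c : Pol k} (hV : V a b c = V x y z) (hJ : J a b c ≠ 0)
    (hd : Dist x y z) : dg x + dg y + dg z ≤ dg a + dg b + dg c := by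
  obtain ⟨a1, a2, a3, a4, ha⟩ := mem_V.1 (hV ▸ fst_mem_V a b c)
  obtain ⟨b1, b2, b3, b4, hb⟩ := mem_V.1 (hV ▸ snd_mem_V a b c)
  obtain ⟨c1, c2, c3, c4, hc⟩ := mem_V.1 (hV ▸ thd_mem_V a b c)
  have hdet := left_ne_zero_of_mul (J_comb ha hb hc ▸ hJ)
  obtain ⟨xa, ya, za⟩ := le_dg_comb hd a1 a2 a3 a4
  obtain ⟨xb, yb, zb⟩ := le_dg_comb hd b1 b2 b3 b4
  obtain ⟨xc, yc, zc⟩ := le_dg_comb hd c1 c2 c3 c4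
  rw [← ha] at xa ya za
  rw [← hb] at xb yb zb
  rw [← hc] at xc yc zc
  by_contra hlt
  push Not at hlt
  have z1 : a1 * b2 * c3 = 0 := by
    by_contra h
    simp only [mul_eq_zero, not_or] at h
    linarith [xa h.1.1, yb h.1.2, zc h.2]
  have z2 : a1 * b3 * c2 = 0 := by
    by_contra h
    simp only [mul_eq_zero, not_or] at h
    linarith [xa h.1.1, zb h.1.2, yc h.2]
  have z3 : a2 * b1 * c3 = 0 := by
    by_contra h
    simp only [mul_eq_zero, not_or] at h
    linarith [ya h.1.1, xb h.1.2, zc h.2]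
  have z4 : a2 * b3 * c1 = 0 := by
    by_contra h
    simp only [mul_eq_zero, not_or] at h
    linarith [ya h.1.1, zb h.1.2, xc h.2]
  have z5 : a3 * b1 * c2 = 0 := by
    by_contra h
    simp only [mul_eq_zero, not_or] at h
    linarith [za h.1.1, xb h.1.2, yc h.2]
  have z6 : a3 * b2 * c1 = 0 := by
    by_contra h
    simp only [mul_eq_zero, not_or] at h
    linarith [za h.1.1, yb h.1.2, xc h.2]
  apply hdet
  have : a1 * (b2 * c3 - b3 * c2) - a2 * (b1 * c3 - b3 * c1) + a3 * (b1 * c2 - b2 * c1) = 0 := by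
    linear_combination z1 - z2 - z3 + z4 + z5 - z6
  rw [this, C_0]

end TameStab

namespace TameStab
variable {k : Type} [Field k]

/-- The degree conditions of an exceptional reduction. -/
def KData (x y z z1 : Pol k) (a : k) (δ : ℝ) : Prop :=
  dg x = 2 * δ ∧ dg y = 3 * δ ∧ δ < dg z ∧ dg z ≤ 3 / 2 * δ ∧ 3 * δ + W x y ≤ W x z ∧
    z1 - z ∈ A x y ∧ dg z1 < dg z ∧ a ≠ 0

/-- The spaces of coordinates that reduce to the standard one. -/
inductive Good : Submodule k (Pol k) → Prop
  | base : Good (V (X 0) (X 1) (X 2))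
  | red {f g h h' : Pol k} : Dist f g h → h' - h ∈ A f g → dg h' < dg h → Good (V f g h') →
      Good (V f g h)
  | exc {x y z z1 : Pol k} {a : k} {δ : ℝ} : KData x y z z1 a δ → Good (V x y z1) →
      Good (V x (y + C a * z ^ 2) z)

theorem J_X : J (X 0 : Pol k) (X 1) (X 2) = X 0 * X 1 * X 2 := by
  simp [J, br, D_apply, pderiv_X]
  ring

theorem J_mul_sq (x y z : Pol k) (a : k) : J x (y + C a * z ^ 2) z = J x y z := by
  simp only [J, br, map_add, Derivation.leibniz, Derivation.leibniz_pow, smul_eq_mul,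
    nsmul_eq_mul]
  have hC : ∀ i, D i (C a : Pol k) = 0 := fun i => by simp
  simp only [hC]
  ring

theorem Good.J_ne' {S : Submodule k (Pol k)} (hS : Good S) :
    ∃ a b c, S = V a b c ∧ J a b c ≠ 0 := by
  induction hS with
  | base => exact ⟨_, _, _, rfl, by rw [J_X]; simp [X_ne_zero]⟩
  | @red f g h h' hd hA hlt hG ih =>
    obtain ⟨a, b, c, e, hJ⟩ := ih
    exact ⟨f, g, h, rfl, by rw [← J_congr hA]; exact J_ne_of_V e.symm hJ⟩
  | @exc x y z z1 a δ hK hG ih =>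
    obtain ⟨p, q, r, e, hJ⟩ := ih
    refine ⟨_, _, _, rfl, ?_⟩
    rw [J_mul_sq, ← J_congr hK.2.2.2.2.2.1]
    exact J_ne_of_V e.symm hJ

theorem Good.J_ne {a b c : Pol k} (h : Good (V a b c)) : J a b c ≠ 0 := by
  obtain ⟨a', b', c', e, hJ⟩ := h.J_ne'
  exact J_ne_of_V e.symm hJ

theorem V_rot (f g h : Pol k) : V f g h = V g h f := by rw [V_swap12, V_swap23]
theorem V_swap13 (f g h : Pol k) : V f g h = V h g f := by rw [V_swap12, V_swap23, V_swap12]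

theorem V_congr2' {f g g' h : Pol k} (hh : g' - g ∈ L f h) : V f g' h = V f g h := by
  rw [V_swap23, V_swap23 f g]; exact V_congr3' hh

theorem V_congr1' {f f' g h : Pol k} (hh : f' - f ∈ L g h) : V f' g h = V f g h := by
  rw [V_rot, V_rot f]; exact V_congr3' hh

theorem not_mem_A {f g h : Pol k} (hJ : J f g h ≠ 0) : h ∉ A f g := by
  intro hm
  apply hJ
  have : (0 : Pol k) - h ∈ A f g := by rw [zero_sub]; exact (A f g).neg_mem hm
  rw [← J_congr this]
  simp [J, br]

theorem not_mem_L {f g h : Pol k} (hJ : J f g h ≠ 0) : h ∉ L f g :=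
  fun hm => not_mem_A hJ (L_le_A f g hm)

/-- `a + s c` has the degree of `a`. -/
theorem dg_shift {a c : Pol k} {s : k} (h : s = 0 ∨ dg c < dg a) : dg (a + C s * c) = dg a := by
  rcases h with rfl | h
  · simp
  · exact dg_add_eq ((dg_C_mul_le _ _).trans_lt h)

/-- The plane spanned by `f, g` is in echelon form with pivot `c`. -/
def LLc (f g h a b c : Pol k) : Prop :=
  ∃ s t : k, (s = 0 ∨ dg c < dg a) ∧ (t = 0 ∨ dg c < dg b) ∧
    L f g = L (a + C s * c) (b + C t * c) ∧ ∃ κ : k, κ ≠ 0 ∧ c - C κ * h ∈ L f g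

theorem LLc_of {f g h a b c : Pol k} (hV : V a b c = V f g h) (hJ : J f g h ≠ 0)
    {a1 a2 a3 a4 b1 b2 b3 b4 c1 c2 c3 c4 : k}
    (ha : a = C a1 * f + C a2 * g + C a3 * h + C a4)
    (hb : b = C b1 * f + C b2 * g + C b3 * h + C b4)
    (hc : c = C c1 * f + C c2 * g + C c3 * h + C c4) (h3 : c3 ≠ 0)
    (hac : a3 = 0 ∨ dg c < dg a) (hbc : b3 = 0 ∨ dg c < dg b) : LLc f g h a b c := by
  have hk : (C c3⁻¹ : Pol k) * C c3 = 1 := by rw [← C_mul, inv_mul_cancel₀ h3, C_1]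
  have ma : a + C (-(c3⁻¹ * a3)) * c ∈ L f g := by
    refine mem_L.2 ⟨a1 - c3⁻¹ * a3 * c1, a2 - c3⁻¹ * a3 * c2, a4 - c3⁻¹ * a3 * c4, ?_⟩
    simp only [C_mul, C_neg, C_sub]
    rw [ha, hc]
    linear_combination (-C a3 * h) * hk
  have mb : b + C (-(c3⁻¹ * b3)) * c ∈ L f g := by
    refine mem_L.2 ⟨b1 - c3⁻¹ * b3 * c1, b2 - c3⁻¹ * b3 * c2, b4 - c3⁻¹ * b3 * c4, ?_⟩
    simp only [C_mul, C_neg, C_sub]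
    rw [hb, hc]
    linear_combination (-C b3 * h) * hk
  have mc : c - C c3 * h ∈ L f g := mem_L.2 ⟨c1, c2, c4, by rw [hc]; ring⟩
  have nc : c ∉ L f g := by
    intro hmc
    apply not_mem_L hJ
    have := C_mul_mem c3⁻¹ ((L f g).sub_mem hmc mc)
    have e : C c3⁻¹ * (c - (c - C c3 * h)) = h := by linear_combination h * hk
    rwa [e] at this
  have key : ∀ p ∈ V a b c, p ∈ L f g → p ∈ L (a + C (-(c3⁻¹ * a3)) * c) (b + C (-(c3⁻¹ * b3)) * c) := by
    intro p hp hpL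
    obtain ⟨p1, p2, p3, p4, e⟩ := mem_V.1 hp
    set s := -(c3⁻¹ * a3)
    set t := -(c3⁻¹ * b3)
    have e2 : C (p3 - p1 * s - p2 * t) * c = p - C p1 * (a + C s * c) - C p2 * (b + C t * c) - C p4 := by
      rw [e]; simp only [C_sub, C_mul]; ring
    have m2 : C (p3 - p1 * s - p2 * t) * c ∈ L f g := by
      rw [e2]
      exact (L f g).sub_mem ((L f g).sub_mem ((L f g).sub_mem hpL (C_mul_mem _ ma)) (C_mul_mem _ mb))
        (C_mem_L _ _ _)
    have z : p3 - p1 * s - p2 * t = 0 := by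
      by_contra hne
      apply nc
      have := C_mul_mem (p3 - p1 * s - p2 * t)⁻¹ m2
      rwa [← mul_assoc, ← C_mul, inv_mul_cancel₀ hne, C_1, one_mul] at this
    refine mem_L.2 ⟨p1, p2, p4, ?_⟩
    rw [z, C_0, zero_mul] at e2
    linear_combination -e2
  refine ⟨-(c3⁻¹ * a3), -(c3⁻¹ * b3), ?_, ?_, le_antisymm ?_ ?_, c3, h3, mc⟩
  · exact hac.imp_left fun h => by simp [h]
  · exact hbc.imp_left fun h => by simp [h]
  · exact fun p hp => key p (hV ▸ L_le_V _ _ _ hp) hp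
  · exact L_le (C_mem_L _ _) ma mb

theorem exists_LLc {f g h x y z : Pol k} (hV : V x y z = V f g h) (hJ : J f g h ≠ 0)
    (hd : Dist x y z) : LLc f g h x y z ∨ LLc f g h x z y ∨ LLc f g h y z x := by
  obtain ⟨x1, x2, x3, x4, hx⟩ := mem_V.1 (hV ▸ fst_mem_V x y z)
  obtain ⟨y1, y2, y3, y4, hy⟩ := mem_V.1 (hV ▸ snd_mem_V x y z)
  obtain ⟨z1, z2, z3, z4, hz⟩ := mem_V.1 (hV ▸ thd_mem_V x y z)
  have hne : ¬ (x3 = 0 ∧ y3 = 0 ∧ z3 = 0) := by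
    rintro ⟨rfl, rfl, rfl⟩
    apply not_mem_L hJ
    have : V x y z ≤ L f g := V_le (C_mem_L _ _) (mem_L.2 ⟨x1, x2, x4, by rw [hx]; simp⟩)
      (mem_L.2 ⟨y1, y2, y4, by rw [hy]; simp⟩) (mem_L.2 ⟨z1, z2, z4, by rw [hz]; simp⟩)
    exact this (hV ▸ thd_mem_V f g h)
  have hV2 : V x z y = V f g h := by rw [← hV, V_swap23]
  have hV3 : V y z x = V f g h := by rw [← hV, ← V_rot]
  have A1 := LLc_of hV hJ hx hy hz
  have A2 := LLc_of hV2 hJ hx hz hy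
  have A3 := LLc_of hV3 hJ hy hz hx
  obtain ⟨h1, h2, h3⟩ := hd
  by_cases a1 : x3 = 0 <;> by_cases a2 : y3 = 0 <;> by_cases a3 : z3 = 0 <;>
    simp only [a1, a2, a3, true_or, false_or, forall_true_left, ne_eq, not_true,
      not_false_iff, and_false, and_true] at A1 A2 A3 hne ⊢
  · exact Or.inl A1
  · exact Or.inr (Or.inl A2)
  · rcases lt_or_gt_of_ne h3 with h | h
    · exact Or.inr (Or.inl (A2 h))
    · exact Or.inl (A1 h)
  · exact Or.inr (Or.inr A3)
  · rcases lt_or_gt_of_ne h2 with h | h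
    · exact Or.inr (Or.inr (A3 h))
    · exact Or.inl (A1 h)
  · rcases lt_or_gt_of_ne h1 with h | h
    · exact Or.inr (Or.inr (A3 h))
    · exact Or.inr (Or.inl (A2 h))
  · rcases lt_or_gt_of_ne h1 with h | h
    · rcases lt_or_gt_of_ne h2 with h' | h'
      · exact Or.inr (Or.inr (A3 h h'))
      · exact Or.inl (A1 h' (h'.trans h))
    · rcases lt_or_gt_of_ne h3 with h' | h'
      · exact Or.inr (Or.inl (A2 h h'))
      · exact Or.inl (A1 (h'.trans h) h')

theorem exists_min_shift {a b c : Pol k} (hJ : J a b c ≠ 0) :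
    ∃ c', c' - c ∈ L a b ∧ dg a ≠ dg c' ∧ dg b ≠ dg c' := by
  obtain ⟨p, hp, hmin⟩ := exists_min (S := {p | p - c ∈ L a b}) ⟨c, by simp⟩
  rw [Set.mem_ofPred_eq] at hp
  have ha := (Ind12 hJ).dg_pos
  have hb := (Ind_of_J hJ).dg_pos
  have key : ∀ q ∈ L a b, 0 < dg q → dg q ≠ dg p := by
    intro q hq hpos e
    obtain ⟨κ, -, hlt⟩ := exists_cancel e.symm hpos
    refine absurd (hmin (p - C κ * q) ?_) (not_le.2 hlt)
    rw [Set.mem_ofPred_eq]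
    have : p - C κ * q - c = (p - c) - C κ * q := by ring
    rw [this]
    exact (L a b).sub_mem hp (C_mul_mem _ hq)
  exact ⟨p, hp, key a (left_mem_L _ _) ha, key b (right_mem_L _ _) hb⟩

theorem Good.up {a b c c' : Pol k} (hG : Good (V a b c)) (hab : dg a ≠ dg b)
    (hA : c' - c ∈ A a b)
    (h : ∀ c'', c'' - c ∈ A a b → dg c'' ≤ dg c → Good (V a b c'')) : Good (V a b c') := by
  have hJ : J a b c' ≠ 0 := by rw [J_congr hA]; exact hG.J_ne
  obtain ⟨c'', hL, h1, h2⟩ := exists_min_shift hJ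
  have hm : c'' - c ∈ A a b := by
    have : c'' - c = (c'' - c') + (c' - c) := by ring
    rw [this]; exact (A a b).add_mem (L_le_A _ _ hL) hA
  rw [← V_congr3' hL]
  rcases le_or_gt (dg c'') (dg c) with hle | hlt
  · exact h _ hm hle
  · refine Good.red ⟨hab, h1, h2⟩ ?_ hlt hG
    rw [← neg_sub]; exact (A a b).neg_mem hm

/-- The line through `a, b` (and its shifts by the third element `c`) stays in `Good`. -/
def LineOK (a b c : Pol k) : Prop :=
  ∀ (s t : k) (c' : Pol k), (s = 0 ∨ dg c < dg a) → (t = 0 ∨ dg c < dg b) →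
    c' - c ∈ A (a + C s * c) (b + C t * c) → dg c' ≤ dg c →
    Good (V (a + C s * c) (b + C t * c) c')

theorem LLc.good {f g h h' a b c : Pol k} (H : LLc f g h a b c) (hab : dg a ≠ dg b)
    (hG : Good (V f g h)) (hA : h' - h ∈ A f g) (hL : LineOK a b c) : Good (V f g h') := by
  obtain ⟨s, t, hs, ht, e, κ, hκ, hm⟩ := H
  have e1 : V (a + C s * c) (b + C t * c) c = V f g h := by
    rw [← V_congr_L e]; exact V_congr3 hκ hm
  have e2 : V (a + C s * c) (b + C t * c) (c + C κ * (h' - h)) = V f g h' := by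
    rw [← V_congr_L e]
    refine V_congr3 hκ ?_
    have : c + C κ * (h' - h) - C κ * h' = c - C κ * h := by ring
    rwa [this]
  rw [← e2]
  refine Good.up (e1 ▸ hG) (by rwa [dg_shift hs, dg_shift ht]) ?_ fun c'' h1 h2 => hL s t c'' hs ht h1 h2
  rw [← A_congr_L e, add_sub_cancel_left]
  exact C_mul_mem_A _ hA

theorem step_reduce {f g h h' x y z : Pol k} (hV : V x y z = V f g h) (hd : Dist x y z)
    (hG : Good (V f g h)) (hA : h' - h ∈ A f g) (h1 : LineOK x y z) (h2 : LineOK x z y)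
    (h3 : LineOK y z x) : Good (V f g h') := by
  rcases exists_LLc hV hG.J_ne hd with H | H | H
  · exact H.good hd.1 hG hA h1
  · exact H.good hd.2.1 hG hA h2
  · exact H.good hd.2.2 hG hA h3

/-- `c` can be reduced along a line in echelon form. -/
def RF (a b c : Pol k) : Prop :=
  ∃ (s t : k) (c1 : Pol k), (s = 0 ∨ dg c < dg a) ∧ (t = 0 ∨ dg c < dg b) ∧
    c1 - c ∈ A (a + C s * c) (b + C t * c) ∧ dg c1 < dg c ∧
    Good (V (a + C s * c) (b + C t * c) c1)

theorem LLc.RF {f g h h' a b c : Pol k} (H : LLc f g h a b c) (hd : Dist f g h)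
    (hA : h' - h ∈ A f g) (hlt : dg h' < dg h) (hG : Good (V f g h')) : RF a b c := by
  obtain ⟨s, t, hs, ht, e, κ, hκ, hm⟩ := H
  refine ⟨s, t, C κ * h', hs, ht, ?_, ?_, ?_⟩
  · rw [← A_congr_L e]
    have : C κ * h' - c = C κ * (h' - h) - (c - C κ * h) := by ring
    rw [this]
    exact (A f g).sub_mem (C_mul_mem_A _ hA) (L_le_A _ _ hm)
  · rw [dg_C_mul hκ]
    refine hlt.trans_le ?_
    obtain ⟨p, q, r, e'⟩ := mem_L.1 hm
    have : c = C p * f + C q * g + C κ * h + C r := by linear_combination e'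
    rw [this]
    exact (le_dg_comb hd p q κ r).2.2 hκ
  · rw [← V_congr_L e]
    rwa [V_congr3 hκ (h := h') (by simp)]

theorem Good.inv {a b c : Pol k} (hG : Good (V a b c)) (hd : Dist a b c) :
    V a b c = V (X 0) (X 1) (X 2) ∨ RF a b c ∨ RF a c b ∨ RF b c a ∨
    ∃ (x y z z1 : Pol k) (e : k) (δ : ℝ), KData x y z z1 e δ ∧ Good (V x y z1) ∧
      V a b c = V x (y + C e * z ^ 2) z := by
  generalize hS : V a b c = S at hG
  cases hG with
  | base => exact Or.inl rfl
  | @red f g h h' hd' hA hlt hG =>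
    right
    have hJ : J f g h ≠ 0 := by rw [← J_congr hA]; exact hG.J_ne
    rcases exists_LLc hS hJ hd with H | H | H
    · exact Or.inl (H.RF hd' hA hlt hG)
    · exact Or.inr (Or.inl (H.RF hd' hA hlt hG))
    · exact Or.inr (Or.inr (Or.inl (H.RF hd' hA hlt hG)))
  | @exc x y z z1 e δ hK hG =>
    exact Or.inr (Or.inr (Or.inr (Or.inr ⟨x, y, z, z1, e, δ, hK, hG, rfl⟩)))

theorem sorted_coords {x y z a b c : Pol k} (hV : V a b c = V x y z) (hJ : J a b c ≠ 0)
    (h1 : dg x < dg y) (h2 : dg y < dg z) (h3 : dg a < dg b) (h4 : dg b < dg c) :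
    (∃ α α' : k, α ≠ 0 ∧ a = C α * x + C α') ∧
    (∃ β β' β'' : k, β ≠ 0 ∧ b = C β * y + C β' * x + C β'') ∧
    (∃ γ γ' γ'' γ''' : k, γ ≠ 0 ∧ c = C γ * z + C γ' * y + C γ'' * x + C γ''') := by
  have hd : Dist x y z := ⟨h1.ne, (h1.trans h2).ne, h2.ne⟩
  obtain ⟨a1, a2, a3, a4, ha⟩ := mem_V.1 (hV ▸ fst_mem_V a b c)
  obtain ⟨b1, b2, b3, b4, hb⟩ := mem_V.1 (hV ▸ snd_mem_V a b c)
  obtain ⟨c1, c2, c3, c4, hc⟩ := mem_V.1 (hV ▸ thd_mem_V a b c)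
  have hdet := left_ne_zero_of_mul (J_comb ha hb hc ▸ hJ)
  have up3 : ∀ p q r s : k, dg (C p * x + C q * y + C r * z + C s) ≤ dg z := by
    intro p q r s
    rw [dg_add_C]
    refine (dg_add_le _ _).trans (max_le ((dg_add_le _ _).trans (max_le ?_ ?_)) (dg_C_mul_le _ _))
    · exact (dg_C_mul_le _ _).trans (h1.trans h2).le
    · exact (dg_C_mul_le _ _).trans h2.le
  have up2 : ∀ p q s : k, dg (C p * x + C q * y + C 0 * z + C s) ≤ dg y := by
    intro p q s
    rw [dg_add_C, C_0, zero_mul, add_zero]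
    refine (dg_add_le _ _).trans (max_le ?_ (dg_C_mul_le _ _))
    exact (dg_C_mul_le _ _).trans h1.le
  have cz : dg c ≤ dg z := by rw [hc]; exact up3 _ _ _ _
  have b0 : b3 = 0 := by
    by_contra h
    have := (le_dg_comb hd b1 b2 b3 b4).2.2 h
    rw [← hb] at this; linarith
  have a0 : a3 = 0 := by
    by_contra h
    have := (le_dg_comb hd a1 a2 a3 a4).2.2 h
    rw [← ha] at this; linarith
  have a0' : a2 = 0 := by
    by_contra h
    have := (le_dg_comb hd a1 a2 a3 a4).2.1 h
    rw [← ha] at this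
    have h5 : dg b ≤ dg y := by rw [hb, b0]; exact up2 _ _ _
    linarith
  subst b0 a0 a0'
  have hne : a1 * b2 * c3 ≠ 0 := by
    intro h
    apply hdet
    rw [← C_0]; congr 1
    linear_combination h
  simp only [ne_eq, mul_eq_zero, not_or] at hne
  refine ⟨⟨a1, a4, hne.1.1, by rw [ha]; simp⟩, ⟨b2, b1, b4, hne.1.2, by rw [hb]; simp; ring⟩,
    ⟨c3, c2, c1, c4, hne.2, by rw [hc]; ring⟩⟩

end TameStab

namespace TameStab
variable {k : Type} [Field k]

theorem W_C_mul {c : k} (hc : c ≠ 0) (f g : Pol k) : W f (C c * g) = W f g := by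
  have : ∀ i j, br i j f (C c * g) = C c * br i j f g := fun i j => by
    simp [br]; ring
  unfold W
  congr 1; ext p
  rw [this, dg_C_mul hc]

theorem W_C_mul_le (c : k) (f g : Pol k) : W f (C c * g) ≤ W f g := by
  by_cases hc : c = 0
  · subst hc
    refine W_le fun i j => ?_
    have : br i j f (C 0 * g) = 0 := by simp [br]
    rw [this, dg_zero]; exact W_nonneg _ _
  · rw [W_C_mul hc]

theorem W_add_of_br {f g h : Pol k} (hb : ∀ i j, br i j f h = 0) : W f (g + h) = W f g := by
  unfold W
  congr 1; ext p
  rw [br_add_right, hb, add_zero]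

theorem W_add_C (f g : Pol k) (c : k) : W f (g + C c) = W f g :=
  W_add_of_br fun i j => by simp [br]

theorem W_add_self (f g : Pol k) (c : k) : W f (g + C c * f) = W f g :=
  W_add_of_br fun i j => by simp [br]; ring

theorem W_add_sq (f g : Pol k) (c : k) : W f (g + C c * f ^ 2) = W f g :=
  W_add_of_br fun i j => by simp [br, Derivation.leibniz_pow]; ring

theorem W_self (f : Pol k) : W f f = 0 := by
  refine le_antisymm (W_le fun i j => ?_) (W_nonneg _ _)
  have : br i j f f = 0 := by simp [br]; ring
  rw [this, dg_zero]

/-- A linear change of the second argument with dominant first term. -/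
theorem W_lin {f g h : Pol k} {a b : k} (ha : a ≠ 0) (hlt : W f h < W f g) :
    W f (C a * g + C b * h) = W f g := by
  rw [W_add_eq, W_C_mul ha]
  rw [W_C_mul ha]; exact (W_C_mul_le _ _ _).trans_lt hlt

section CharZero
variable [CharZero k]

theorem W_sq {f g : Pol k} (hI : Ind f g) : W f (g ^ 2) = dg g + W f g := by
  have h0 := ne_zero_of_dg_pos hI.symm.dg_pos
  have : ∀ i j, br i j f (g ^ 2) = (C 2 * g) * br i j f g := fun i j => by
    have : (C 2 : Pol k) = 2 := map_ofNat C 2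
    simp [br, Derivation.leibniz_pow, this]; ring
  have h2 : (2 : k) ≠ 0 := two_ne_zero
  rw [W_of_br_mul this (mul_ne_zero (by simp) h0) hI, dg_C_mul h2]

theorem TM_eq {f g h : Pol k} (hJ : J f g h ≠ 0) (hlt : dg h + W f g < dg g + W f h) :
    dg f + W g h = dg g + W f h := by
  apply le_antisymm
  · exact (TM hJ).trans (max_le le_rfl hlt.le)
  · have := TM (J_ne12 hJ)
    rw [W_comm g f] at this
    rcases le_max_iff.1 this with h1 | h1
    · exact h1
    · linarith

/-- Numerical consequences of an exceptional reduction. -/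
theorem KData.spec {x y z z1 : Pol k} {a : k} {δ : ℝ} (hK : KData x y z z1 a δ)
    (hJ : J x y z ≠ 0) : 0 < δ ∧ W y z = δ + W x z ∧ W x (y + C a * z ^ 2) = dg z + W x z ∧
    W z (y + C a * z ^ 2) = δ + W x z ∧ dg z + δ + W x y ≤ dg (y + C a * z ^ 2) ∧
    dg (y + C a * z ^ 2) ≤ 3 * δ ∧ 2 * δ < dg (y + C a * z ^ 2) ∧ 0 < W x y := by
  obtain ⟨hx, hy, h1, h2, hW, -, -, ha⟩ := hK
  have hD := (Ind12 hJ).W_pos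
  have hδ : 0 < δ := by linarith [dg_nonneg z]
  have e1 : W y z = δ + W x z := by
    have := TM_eq hJ (by linarith)
    linarith
  have e2 : W x (y + C a * z ^ 2) = dg z + W x z := by
    rw [add_comm, W_add_eq, W_C_mul ha, W_sq (Ind13 hJ)]
    rw [W_C_mul ha, W_sq (Ind13 hJ)]
    linarith
  have e3 : W z (y + C a * z ^ 2) = δ + W x z := by rw [W_add_sq, W_comm, e1]
  have h4 : dg z + δ + W x y ≤ dg (y + C a * z ^ 2) := by
    have := W_le_add x (y + C a * z ^ 2)
    linarith
  refine ⟨hδ, e1, e2, e3, h4, ?_, by linarith, hD⟩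
  refine (dg_add_le _ _).trans (max_le hy.le ((dg_C_mul_le _ _).trans ?_))
  rw [dg_pow]; push_cast; linarith

/-- The brackets in a sorted basis of an exceptional space. -/
theorem KData.sorted {x y z z1 : Pol k} {e : k} {δ : ℝ} (hK : KData x y z z1 e δ)
    (hJ : J x y z ≠ 0) {a b c : Pol k} (hV : V a b c = V x (y + C e * z ^ 2) z)
    (hab : dg a < dg b) (hbc : dg b < dg c) :
    dg a = dg z ∧ dg b = 2 * δ ∧ W a b = W x z ∧ W a c = δ + W x z ∧ W b c = dg z + W x z := by
  obtain ⟨hδ, e1, e2, e3, h4, h5, h6, hD⟩ := hK.spec hJ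
  obtain ⟨hx, hy, h1, h2, hW, -, -, -⟩ := hK
  set y1 := y + C e * z ^ 2
  have hJ1 : J a b c ≠ 0 := J_ne_of_V hV.symm (by rw [J_mul_sq]; exact hJ)
  obtain ⟨⟨α, α', hα, rfl⟩, ⟨β, β', β'', hβ, rfl⟩, γ, γ', γ'', γ''', hγ, rfl⟩ :=
    sorted_coords (hV.trans (by rw [V_swap13, V_swap23])) hJ1 (x := z) (y := x) (z := y1)
      (by linarith) (by linarith) hab hbc
  have hz0 : 0 < dg z := by linarith
  have w1 : ∀ p, W (C α * z + C α') p = W z p := fun p => by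
    rw [W_comm, W_add_C, W_C_mul hα, W_comm]
  have w2 : W z (C β * x + C β' * z + C β'') = W x z := by
    rw [W_add_C, W_add_self, W_C_mul hβ, W_comm]
  have hzx : W z x = W x z := W_comm _ _
  have hxx := W_self x
  have hzz := W_self z
  have w3 : ∀ p, W z p < W x p → W (C β * x + C β' * z + C β'') p = W x p := fun p hp => by
    rw [W_comm, W_add_C, W_lin hβ, W_comm]
    rw [W_comm p z, W_comm p x]; exact hp
  have w4 : W (C β * x + C β' * z + C β'') y1 = dg z + W x z := by rw [w3 _ (by linarith), e2]
  have hΩ : 0 < W x z := (Ind13 hJ).W_pos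
  refine ⟨?_, ?_, ?_, ?_, ?_⟩
  · rw [dg_add_C, dg_C_mul hα]
  · rw [dg_add_C, dg_add_eq, dg_C_mul hβ, hx]
    rw [dg_C_mul hβ]; exact (dg_C_mul_le _ _).trans_lt (by linarith)
  · rw [w1, w2]
  · rw [w1, W_add_C, W_add_self, W_lin hγ (by linarith), e3]
  · have b1 : W (C β * x + C β' * z + C β'') x ≤ W x z := by
      rw [W_comm, W_add_C]
      refine (W_add_le _ _ _).trans (max_le ?_ ?_)
      · exact (W_C_mul_le _ _ _).trans (by rw [hxx]; exact hΩ.le)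
      · exact W_C_mul_le _ _ _
    have b2 : W (C β * x + C β' * z + C β'') z ≤ W x z := by
      rw [W_comm, W_add_C]
      refine (W_add_le _ _ _).trans (max_le ?_ ?_)
      · exact (W_C_mul_le _ _ _).trans (by rw [hzx])
      · exact (W_C_mul_le _ _ _).trans (by rw [hzz]; exact hΩ.le)
    have b3 : W (C β * x + C β' * z + C β'') (C γ * y1 + C γ' * x) = dg z + W x z := by
      rw [W_lin hγ (by linarith), w4]
    rw [W_add_C, W_add_eq, b3]
    rw [b3]
    exact (W_C_mul_le _ _ _).trans_lt (by linarith)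

end CharZero

theorem dg_X0 : dg (X 0 : Pol k) = √2 := by
  apply le_antisymm
  · refine dg_le (by positivity) fun n hn => ?_
    rw [coeff_X] at hn
    split_ifs at hn with h
    · subst h; simp [wt]
    · exact absurd rfl hn
  · have := le_dg (f := (X 0 : Pol k)) (n := Finsupp.single 0 1) (by simp)
    simpa [wt] using this

theorem dg_X1 : dg (X 1 : Pol k) = √3 := by
  apply le_antisymm
  · refine dg_le (by positivity) fun n hn => ?_
    rw [coeff_X] at hn
    split_ifs at hn with h
    · subst h; simp [wt]
    · exact absurd rfl hn
  · have := le_dg (f := (X 1 : Pol k)) (n := Finsupp.single 1 1) (by simp)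
    simpa [wt] using this

theorem dg_X2 : dg (X 2 : Pol k) = 1 := by
  apply le_antisymm
  · refine dg_le (by positivity) fun n hn => ?_
    rw [coeff_X] at hn
    split_ifs at hn with h
    · subst h; simp [wt]
    · exact absurd rfl hn
  · have := le_dg (f := (X 2 : Pol k)) (n := Finsupp.single 2 1) (by simp)
    simpa [wt] using this

theorem one_lt_sqrt2 : (1:ℝ) < √2 := by
  rw [Real.lt_sqrt] <;> norm_num
theorem sqrt2_lt_sqrt3 : √2 < √3 := Real.sqrt_lt_sqrt (by norm_num) (by norm_num)
theorem sqrt3_lt_two : √3 < 2 := by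
  rw [Real.sqrt_lt'] <;> norm_num

/-- Degrees of two elements of the standard space are incommensurable. -/
theorem base_incommensurable {a b : Pol k} (ha : a ∈ V (X 0 : Pol k) (X 1) (X 2))
    (hb : b ∈ V (X 0 : Pol k) (X 1) (X 2)) (h0 : 0 < dg a) (h0' : 0 < dg b) (hne : dg a ≠ dg b)
    (m n : ℕ) (hm : 0 < m) : (m:ℝ) * dg a ≠ n * dg b := by
  have key : ∀ p ∈ V (X 0 : Pol k) (X 1) (X 2), 0 < dg p → dg p = √2 ∨ dg p = √3 ∨ dg p = 1 := by
    intro p hp hpos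
    obtain ⟨q, r, s, t, rfl⟩ := mem_V.1 hp
    rw [dg_add_C] at hpos ⊢
    have h1 := one_lt_sqrt2
    have h2 := sqrt2_lt_sqrt3
    by_cases hr : r = 0
    · by_cases hq : q = 0
      · by_cases hs : s = 0
        · subst hr hq hs; simp [dg_zero] at hpos
        · right; right
          rw [hr, hq]; simp [dg_C_mul hs, dg_X2]
      · left
        rw [hr, C_0, zero_mul, add_zero, dg_add_eq, dg_C_mul hq, dg_X0]
        rw [dg_C_mul hq, dg_X0]
        exact (dg_C_mul_le _ _).trans_lt (by rw [dg_X2]; exact h1)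
    · right; left
      rw [add_assoc, add_comm, add_assoc, dg_add_eq, dg_C_mul hr, dg_X1]
      rw [dg_C_mul hr, dg_X1]
      refine (dg_add_le _ _).trans_lt (max_lt ?_ ?_)
      · exact (dg_C_mul_le _ _).trans_lt (by rw [dg_X2]; linarith)
      · exact (dg_C_mul_le _ _).trans_lt (by rw [dg_X0]; linarith)
  intro he
  have wt3 : ∀ (d : ℝ), d = √2 ∨ d = √3 ∨ d = 1 → ∃ i : Fin 3, d = wt (Finsupp.single i 1) := by
    rintro d (rfl | rfl | rfl)
    · exact ⟨0, by simp [wt]⟩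
    · exact ⟨1, by simp [wt]⟩
    · exact ⟨2, by simp [wt]⟩
  obtain ⟨i, hi⟩ := wt3 _ (key a ha h0)
  obtain ⟨j, hj⟩ := wt3 _ (key b hb h0')
  have hs : ∀ (n : ℕ) (i : Fin 3), (n:ℝ) * wt (Finsupp.single i 1) = wt (Finsupp.single i n) := by
    intro n i
    fin_cases i <;> simp [wt]
  rw [hi, hj, hs, hs] at he
  have := wt_injective he
  have hij : i ≠ j := by rintro rfl; exact hne (hi.trans hj.symm)
  have := DFunLike.congr_fun this i
  simp [hij.symm] at this
  omega

/-- The line through `x, y` contains a reduction of `z` in `Good`. -/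
def RL (x y z : Pol k) : Prop := ∃ z0, z0 - z ∈ A x y ∧ dg z0 < dg z ∧ Good (V x y z0)

theorem RL.swap {x y z : Pol k} (h : RL x y z) : RL y x z := by
  obtain ⟨z0, h1, h2, h3⟩ := h
  exact ⟨z0, by rwa [A_swap], h2, by rwa [V_swap12]⟩

theorem RL.J_ne {x y z : Pol k} (h : RL x y z) : J x y z ≠ 0 := by
  obtain ⟨z0, h1, h2, h3⟩ := h
  rw [← J_congr h1]; exact h3.J_ne

theorem RL.good {x y z : Pol k} (h : RL x y z) (hd : Dist x y z) : Good (V x y z) := by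
  obtain ⟨z0, h1, h2, h3⟩ := h
  exact Good.red hd h1 h2 h3

/-- The inductive hypothesis: lines through spaces with a basis of small total degree. -/
def Sd (k : Type) [Field k] (d : ℝ) : Prop :=
  ∀ f g h h' : Pol k, dg f + dg g + dg h < d → Good (V f g h) → h' - h ∈ A f g → Good (V f g h')

theorem Sd.mv2 {d : ℝ} (H : Sd k d) {f g h g' : Pol k} (hd : dg f + dg g + dg h < d)
    (hG : Good (V f g h)) (hA : g' - g ∈ A f h) : Good (V f g' h) := by
  rw [V_swap23] at hG ⊢
  exact H _ _ _ _ (by linarith) hG hA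

theorem Sd.mv1 {d : ℝ} (H : Sd k d) {f g h f' : Pol k} (hd : dg f + dg g + dg h < d)
    (hG : Good (V f g h)) (hA : f' - f ∈ A g h) : Good (V f' g h) := by
  rw [V_rot] at hG ⊢
  exact H _ _ _ _ (by linarith) hG hA

end TameStab

namespace TameStab
variable {k : Type} [Field k]

theorem nat_eq_of_mul {δ : ℝ} (hδ : 0 < δ) (a b : ℕ) (h : (a : ℝ) * δ = b * δ) : a = b := by
  exact_mod_cast mul_right_cancel₀ hδ.ne' h

theorem nonRes_of {a b : ℝ} (ha : 0 < a) (h1 : a ≠ b) (h2 : a < 2 * b) (h3 : ∀ m : ℕ, b ≠ m * a) :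
    NonRes a b := by
  refine ⟨fun m e => ?_, h3⟩
  rcases m with _ | _ | m
  · simp at e; linarith
  · simp at e; exact h1 e
  · push_cast at e
    have : (0:ℝ) ≤ m := Nat.cast_nonneg m
    nlinarith

/-- `c` has minimal degree modulo `A a b`. -/
def MinC (a b c : Pol k) : Prop := ∀ p, p - c ∈ A a b → dg c ≤ dg p

theorem exists_minC (a b c : Pol k) : ∃ c', c' - c ∈ A a b ∧ MinC a b c' := by
  obtain ⟨p, hp, hmin⟩ := exists_min (S := {p | p - c ∈ A a b}) ⟨c, by simp [(A a b).zero_mem]⟩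
  rw [Set.mem_ofPred_eq] at hp
  refine ⟨p, hp, fun q hq => hmin q ?_⟩
  rw [Set.mem_ofPred_eq]
  have : q - c = (q - p) + (p - c) := by ring
  rw [this]; exact (A a b).add_mem hq hp

theorem MinC.ne_comb {a b c : Pol k} (h : MinC a b c) (hJ : J a b c ≠ 0) (n m : ℕ) :
    dg c ≠ n * dg a + m * dg b := by
  intro e
  have ha := ne_zero_of_dg_pos (Ind12 hJ).dg_pos
  have hb := ne_zero_of_dg_pos (Ind_of_J hJ).dg_pos
  have hc := (Ind_of_J hJ).symm.dg_pos
  have e' : dg c = dg (a ^ n * b ^ m) := by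
    rw [dg_mul (pow_ne_zero _ ha) (pow_ne_zero _ hb), dg_pow, dg_pow, e]
  obtain ⟨κ, -, hlt⟩ := exists_cancel e' (e' ▸ hc)
  refine absurd (h _ ?_) (not_le.2 hlt)
  have : c - C κ * (a ^ n * b ^ m) - c = -(C κ * (a ^ n * b ^ m)) := by ring
  rw [this]
  exact (A a b).neg_mem (C_mul_mem_A _ ((A a b).mul_mem ((A a b).pow_mem (left_mem_A _ _) _)
    ((A a b).pow_mem (right_mem_A _ _) _)))

theorem MinC.swap {a b c : Pol k} (h : MinC a b c) : MinC b a c := fun p hp => h p (by rwa [A_swap])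

/-- Lower bound for the bracket of a sheared pair. -/
theorem W_shear {x z w : Pol k} {s t : k} (ht : t ≠ 0) (h1 : W x z < W x w) (h2 : W w z < W x w) :
    W x w ≤ W (x + C s * w) (z + C t * w) := by
  have e : W (x + C s * w) w = W x w := by rw [W_comm, W_add_self, W_comm]
  have e2 : W (x + C s * w) z < W x w := by
    rw [W_comm]
    refine (W_add_le _ _ _).trans_lt (max_lt (by rwa [W_comm]) ?_)
    exact (W_C_mul_le _ _ _).trans_lt (by rwa [W_comm])
  rw [add_comm z, W_add_eq, W_C_mul ht, e]
  rw [W_C_mul ht, e]; exact e2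

theorem ev_quad {φ : MvPolynomial (Fin 2) k}
    (h : ∀ n, coeff n φ ≠ 0 → (n 0 = 1 ∧ n 1 = 0) ∨ (n 0 = 0 ∧ n 1 ≤ 2)) :
    ∃ a b c e : k, ∀ f g : Pol k, ev f g φ = C a * g ^ 2 + C b * g + C c * f + C e := by
  classical
  let S : Finset (Fin 2 →₀ ℕ) := {Finsupp.single 1 2, Finsupp.single 1 1, Finsupp.single 0 1, 0}
  have hS : φ.support ⊆ S := by
    intro n hn
    have hext : ∀ m : Fin 2 →₀ ℕ, n 0 = m 0 → n 1 = m 1 → n = m := fun m h0 h1 => by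
      ext i; fin_cases i
      · exact h0
      · exact h1
    simp only [S, Finset.mem_insert, Finset.mem_singleton]
    rcases h n (mem_support_iff.1 hn) with ⟨h0, h1⟩ | ⟨h0, h1⟩
    · right; right; left; exact hext _ (by simp [h0]) (by simp [h1])
    · interval_cases n 1
      · right; right; right; exact hext _ (by simp [h0]) (by simp)
      · right; left; exact hext _ (by simp [h0]) (by simp)
      · left; exact hext _ (by simp [h0]) (by simp)
  have n1 : (Finsupp.single 1 2 : Fin 2 →₀ ℕ) ≠ Finsupp.single 1 1 := fun e => by
    simpa using DFunLike.congr_fun e 1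
  have n2 : (Finsupp.single 1 2 : Fin 2 →₀ ℕ) ≠ Finsupp.single 0 1 := fun e => by
    simpa using DFunLike.congr_fun e 1
  have n3 : (Finsupp.single 1 1 : Fin 2 →₀ ℕ) ≠ Finsupp.single 0 1 := fun e => by
    simpa using DFunLike.congr_fun e 1
  refine ⟨coeff (Finsupp.single 1 2) φ, coeff (Finsupp.single 1 1) φ, coeff (Finsupp.single 0 1) φ,
    coeff 0 φ, fun f g => ?_⟩
  conv_lhs => rw [φ.as_sum]
  rw [map_sum, Finset.sum_subset hS (fun n _ hn => by rw [notMem_support_iff.1 hn]; simp)]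
  simp only [S]
  rw [Finset.sum_insert (by simp [n1, n2]), Finset.sum_insert (by simp [n3]),
    Finset.sum_insert (by simp), Finset.sum_singleton]
  simp only [ev_monomial]
  simp
  ring

section CharZero
variable [CharZero k]

theorem no_reduction {a b c c1 : Pol k} (hI : Ind a b) (hA : c1 - c ∈ A a b) (hlt : dg c1 < dg c)
    (hres : NonRes (dg a) (dg b)) (hW : dg c ≤ W a b) (hm : ∀ n m : ℕ, dg c ≠ n * dg a + m * dg b) :
    False := by
  obtain ⟨φ, e⟩ := mem_A.1 hA
  have := irreducible_of_W hI hres hW hm φ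
  rw [e, add_sub_cancel] at this
  linarith

/-- A reduction in echelon form is excluded by bracket lower bounds. -/
theorem RF.false {a b c : Pol k} (H : RF a b c) (hres : NonRes (dg a) (dg b))
    (hm : ∀ n m : ℕ, dg c ≠ n * dg a + m * dg b)
    (hW : ∀ s t : k, (s = 0 ∨ dg c < dg a) → (t = 0 ∨ dg c < dg b) →
      (s = 0 ∧ t = 0 ∧ MinC a b c) ∨ dg c ≤ W (a + C s * c) (b + C t * c)) : False := by
  obtain ⟨s, t, c1, hs, ht, hA, hlt, hG⟩ := H
  rcases hW s t hs ht with ⟨rfl, rfl, hM⟩ | hW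
  · simp only [C_0, zero_mul, add_zero] at hA
    exact absurd (hM c1 hA) (not_le.2 hlt)
  · refine no_reduction (Ind12 hG.J_ne) hA hlt ?_ hW ?_
    · rwa [dg_shift hs, dg_shift ht]
    · rwa [dg_shift hs, dg_shift ht]

theorem lin_rigid {x y z X Y : Pol k} {β s c γ p q r e : k} (hI : Ind x z) (hβ : β ≠ 0) (hγ : γ ≠ 0)
    (hX : X = C β * x + C s * z + C c) (hY : Y = C γ * y + C p * z ^ 2 + C q * z + C r * x + C e)
    (h1 : W x z < W y z) (h2 : W y z < dg z + W x z) (h3 : W x y < W x z) (h : W X Y < W x z) :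
    p = 0 ∧ s = 0 ∧ q = 0 := by
  have hzx : W z x = W x z := W_comm _ _
  have hzy : W z y = W y z := W_comm _ _
  have wz : W X z = W x z := by rw [W_comm, hX, W_add_C, W_add_self, W_C_mul hβ, hzx]
  have le : ∀ u, W X u ≤ max (W x u) (W z u) := fun u => by
    rw [W_comm, hX, W_add_C]
    refine (W_add_le _ _ _).trans (max_le_max ?_ ?_)
    · exact (W_C_mul_le _ _ _).trans_eq (W_comm _ _)
    · exact (W_C_mul_le _ _ _).trans_eq (W_comm _ _)
  have hpos := hI.W_pos
  have wx : W X x ≤ W x z := (le x).trans (max_le (by rw [W_self]; exact hpos.le) hzx.le)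
  have hIX : Ind X z := by
    obtain ⟨i, j, hij⟩ := hI
    refine ⟨i, j, ?_⟩
    have : br i j X z = C β * br i j x z := by rw [hX]; simp [br]; ring
    rw [this]
    exact mul_ne_zero (by simpa using hβ) hij
  have wzz : W X (z ^ 2) = dg z + W x z := by rw [W_sq hIX, wz]
  have wy : W X y ≤ W y z := (le y).trans (max_le (h3.trans h1).le hzy.le)
  have wlin : W X (C q * z + C r * x) ≤ W x z :=
    (W_add_le _ _ _).trans (max_le ((W_C_mul_le _ _ _).trans wz.le) ((W_C_mul_le _ _ _).trans wx))
  have hp : p = 0 := by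
    by_contra hp
    have : Y = C p * z ^ 2 + (C γ * y + (C q * z + C r * x)) + C e := by rw [hY]; ring
    have h5 : W X (C γ * y + (C q * z + C r * x)) < W X (C p * z ^ 2) := by
      rw [W_C_mul hp, wzz]
      exact (W_add_le _ _ _).trans_lt (max_lt ((W_C_mul_le _ _ _).trans_lt (by linarith))
        (by linarith))
    rw [this, W_add_C, W_add_eq h5, W_C_mul hp, wzz] at h
    linarith
  subst hp
  have hs : s = 0 := by
    by_contra hs
    have e1 : W X y = W y z := by
      have e0 : W y x < W y z := by rw [W_comm y x]; linarith
      rw [W_comm, hX, W_add_C, add_comm, W_lin hs e0]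
    have h4 : W X (C q * z + C r * x) < W X (C γ * y) := by
      rw [W_C_mul hγ, e1]; linarith
    have : Y = C γ * y + (C q * z + C r * x) + C e := by rw [hY]; simp; ring
    rw [this, W_add_C, W_add_eq h4, W_C_mul hγ, e1] at h
    linarith
  subst hs
  refine ⟨rfl, rfl, ?_⟩
  by_contra hq
  have wX : ∀ u, W X u = W x u := fun u => by
    rw [W_comm, hX]; simp only [C_0, zero_mul, add_zero]
    rw [W_add_C, W_C_mul hβ, W_comm]
  have : Y = C q * z + C γ * y + C r * x + C e := by rw [hY]; simp; ring
  rw [wX, this, W_add_C, W_add_self, W_lin hq h3] at h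
  linarith

end CharZero
end TameStab

namespace TameStab
variable {k : Type} [Field k]

theorem W_pair {a b c : Pol k} {s t : k} (h1 : W c b < W a b) (h2 : W a c < W a b) :
    W a b ≤ W (a + C s * c) (b + C t * c) := by
  have e : W a (b + C t * c) = W a b := W_add_eq ((W_C_mul_le _ _ _).trans_lt h2)
  have e2 : W c (b + C t * c) = W c b := W_add_self _ _ _
  rw [W_comm (a + _), W_add_eq, W_comm _ a, e]
  rw [W_comm _ a, e]
  refine (W_C_mul_le _ _ _).trans_lt ?_
  rwa [W_comm, e2]

theorem L_congr_pair {x y X Y : Pol k} {β c γ r e : k} (hβ : β ≠ 0) (hγ : γ ≠ 0)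
    (hX : X = C β * x + C c) (hY : Y = C γ * y + C r * x + C e) : L X Y = L x y := by
  rw [L_swap, L_congr2 (f := Y) (g := x) hβ (a := 0) (b := c) (by rw [hX]; simp), L_swap,
    L_congr2 hγ hY]

section CharZero
variable [CharZero k]

omit [CharZero k] in
theorem MinC.le_of {a b c c' c0 : Pol k} (h : MinC a b c') (h1 : c' - c ∈ A a b)
    (h2 : c0 - c ∈ A a b) : dg c' ≤ dg c0 := by
  refine h _ ?_
  rw [← sub_sub_sub_cancel_right c0 c' c]
  exact (A a b).sub_mem h2 h1

omit [CharZero k] in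
theorem dg_sub_of_lt {f g : Pol k} (h : dg f < dg g) : dg (f - g) = dg g := by
  rw [dg_sub_comm]; exact dg_sub_eq h

omit [CharZero k] in
theorem KData.J_ne {x y z z1 : Pol k} {e : k} {δ : ℝ} (hK : KData x y z z1 e δ)
    (hG : Good (V x y z1)) : J x y z ≠ 0 := by
  rw [← J_congr hK.2.2.2.2.2.1]; exact hG.J_ne

theorem RL_of_quadratic {d δ : ℝ} (H : Sd k d) {x y z : Pol k} (hd : dg x + dg y + dg z ≤ d)
    (hx : dg x = 2 * δ) (hy : dg y = 3 * δ) (hz : dg z = 3 / 2 * δ) (hD : 3 / 2 * δ < W x z)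
    (hΔ : W x y < W x z) (hR : RL x z y) : RL x y z := by
  have hJ := hR.J_ne
  have hJ' : J x y z ≠ 0 := by rw [J_swap23]; exact neg_ne_zero.2 hJ
  have hI := Ind12 hJ
  have hδ : 0 < δ := by linarith [hI.dg_pos]
  obtain ⟨y0, hA0, hlt0, hG0⟩ := hR
  obtain ⟨y1, hA1, hM⟩ := exists_minC x z y
  have hle := hM.le_of hA1 hA0
  have hG1 : Good (V x z y1) := by
    refine H x z y0 y1 (by linarith) hG0 ?_
    rw [← sub_sub_sub_cancel_right y1 y0 y]
    exact (A x z).sub_mem hA1 hA0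
  have hJ1 := hG1.J_ne
  obtain ⟨ψ, hψ⟩ := mem_A.1 hA1
  have hdψ : dg (ev x z ψ) = 3 * δ := by rw [hψ, dg_sub_of_lt (by linarith), hy]
  have hres : NonRes (dg x) (dg z) := by
    rw [hx, hz]
    refine nonRes_of (by linarith) (by linarith) (by linarith) fun m e => ?_
    have := nat_eq_of_mul hδ 3 (4 * m) (by push_cast; linarith)
    omega
  rcases parachute hI hres ψ with hN | ⟨p, q, ε, hε, -, hp2, hq2, e1, e2, h1, -⟩
  swap
  · have e3 : 4 * p = 3 * q := nat_eq_of_mul hε _ _ (by push_cast; linarith)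
    have e4 : (3:ℝ) ≤ p := by exact_mod_cast (by omega : 3 ≤ p)
    have e5 : ((p:ℝ) * q - p - q) * ε = p * (q * ε) - p * ε - q * ε := by ring
    rw [e5, ← e1, ← e2] at h1
    nlinarith
  obtain ⟨a, b, c, e, hE⟩ := ev_quad (φ := ψ) fun n hn => by
    have := hN n hn
    rw [hdψ, hx, hz] at this
    have h2 : ((4 * n 0 + 3 * n 1 : ℕ) : ℝ) * δ ≤ ((6 : ℕ) : ℝ) * δ := by push_cast; linarith
    have := Nat.cast_le.1 (le_of_mul_le_mul_right h2 hδ)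
    omega
  have ha : a ≠ 0 := by
    rintro rfl
    have : dg (ev x z ψ) ≤ 2 * δ := by
      rw [hE, dg_add_C, C_0, zero_mul, zero_add]
      refine (dg_add_le _ _).trans (max_le ((dg_C_mul_le _ _).trans ?_) ((dg_C_mul_le _ _).trans ?_))
      · linarith
      · linarith
    linarith
  have hy1 : y1 = y + (C a * z ^ 2 + C b * z + C c * x + C e) := by rw [← hE, hψ]; ring
  have w1 : W x y1 = 3 / 2 * δ + W x z := by
    have : y1 = C a * z ^ 2 + (y + C b * z) + C c * x + C e := by rw [hy1]; ring
    have h2 : W x (C a * z ^ 2) = 3 / 2 * δ + W x z := by rw [W_C_mul ha, W_sq hI, hz]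
    rw [this, W_add_C, W_add_self, W_add_eq, h2]
    rw [h2]
    refine (W_add_le _ _ _).trans_lt (max_lt (by linarith) ((W_C_mul_le _ _ _).trans_lt ?_))
    linarith
  have w2 : W y z = δ + W x z := by
    have := TM_eq hJ' (by rw [hy, hz]; linarith)
    linarith
  have wzx : W z x = W x z := W_comm _ _
  have w3 : W z y1 = δ + W x z := by
    have : y1 = C 1 * y + C c * x + C a * z ^ 2 + C b * z + C e := by rw [hy1]; simp; ring
    rw [this, W_add_C, W_add_self, W_add_sq, W_lin one_ne_zero, W_comm, w2]
    rw [W_comm z y]; linarith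
  have wy1z : W y1 z = δ + W x z := by rw [W_comm, w3]
  have wy1x : W y1 x = 3 / 2 * δ + W x z := by rw [W_comm, w1]
  have lo : δ < dg y1 := by have := W_le_add x y1; linarith
  have hi : dg y1 < 3 * δ := by linarith
  have hcomb := hM.ne_comb hJ1
  rw [hx, hz] at hcomb
  have ne1 : dg y1 ≠ 2 * δ := by simpa using hcomb 1 0
  have ne2 : dg y1 ≠ 3 / 2 * δ := by simpa using hcomb 0 1
  have hres2 : NonRes (dg x) (dg y1) := by
    rw [hx]
    exact nonRes_of (by linarith) ne1.symm (by linarith) fun m => by simpa using hcomb m 0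
  have hres3 : NonRes (dg z) (dg y1) := by
    rw [hz]
    exact nonRes_of (by linarith) ne2.symm (by linarith) fun m => by simpa using hcomb 0 m
  have hdist : Dist x z y1 := ⟨by rw [hx, hz]; linarith, by rw [hx]; exact ne1.symm,
    by rw [hz]; exact ne2.symm⟩
  rcases hG1.inv hdist with hB | hF | hF | hF | ⟨X, Y, Z, Z1, f, δ', hK, hG, hV⟩
  · refine absurd ?_ (base_incommensurable (hB ▸ fst_mem_V x z y1) (hB ▸ snd_mem_V x z y1)
      hI.dg_pos hI.symm.dg_pos hdist.1 3 4 (by norm_num))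
    rw [hx, hz]; push_cast; ring
  · refine (hF.false hres (by rw [hx, hz]; exact hcomb) fun s t hs ht => ?_).elim
    by_cases t0 : t = 0
    · subst t0
      by_cases s0 : s = 0
      · subst s0; exact Or.inl ⟨rfl, rfl, hM⟩
      · right
        have h3 := hs.resolve_left s0
        have : x + C s * y1 = C s * y1 + C 1 * x := by simp; ring
        rw [C_0, zero_mul, add_zero, W_comm, this, W_lin s0 (by linarith)]
        linarith
    · right
      have := W_shear (s := s) (x := x) (z := z) (w := y1) t0 (by linarith) (by linarith)
      linarith
  · refine (hF.false hres2 (fun n m h3 => ?_) fun s t hs ht => Or.inr ?_).elim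
    · rw [hx, hz] at h3
      rcases n with _ | n
      · rcases m with _ | _ | m
        · simp at h3; linarith
        · simp at h3; exact ne2 h3.symm
        · push_cast at h3
          nlinarith [(Nat.cast_nonneg m : (0:ℝ) ≤ m)]
      · push_cast at h3
        nlinarith [(Nat.cast_nonneg m : (0:ℝ) ≤ m), (Nat.cast_nonneg n : (0:ℝ) ≤ n)]
    · have := W_pair (s := s) (t := t) (a := x) (b := y1) (c := z) (by linarith) (by linarith)
      linarith
  · refine (hF.false hres3 (fun n m h3 => ?_) fun s t hs ht => Or.inr ?_).elim
    · rw [hx, hz] at h3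
      rcases n with _ | _ | n
      · rcases m with _ | _ | m
        · simp at h3; linarith
        · simp at h3; exact ne1 h3.symm
        · push_cast at h3
          nlinarith [(Nat.cast_nonneg m : (0:ℝ) ≤ m)]
      · rcases m with _ | m
        · push_cast at h3; linarith
        · push_cast at h3
          nlinarith [(Nat.cast_nonneg m : (0:ℝ) ≤ m)]
      · push_cast at h3
        nlinarith [(Nat.cast_nonneg m : (0:ℝ) ≤ m), (Nat.cast_nonneg n : (0:ℝ) ≤ n)]
    · have s0 := hs.resolve_right (by linarith)
      subst s0
      have : y1 + C t * x = C 1 * y1 + C t * x := by simp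
      rw [C_0, zero_mul, add_zero, this, W_lin one_ne_zero (by linarith)]
      linarith
  · have hJK := hK.J_ne hG
    obtain ⟨hδ', -, sX1, -, -, -, sY, -⟩ := hK.spec hJK
    rcases lt_or_gt_of_ne ne2 with h2 | h2
    · have := hK.sorted hJK (a := y1) (b := z) (c := x) (by rw [← hV, V_swap13])
        (by linarith) (by linarith)
      have := hK.2.2.1
      linarith
    rcases lt_or_gt_of_ne ne1 with h3 | h3
    · have := hK.sorted hJK (a := z) (b := y1) (c := x) (by rw [← hV, ← V_rot])
        (by linarith) (by linarith)
      linarith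
    obtain ⟨d1, d2, k1, k2, k3⟩ := hK.sorted hJK (a := z) (b := x) (c := y1)
      (by rw [← hV, V_swap12]) (by linarith) (by linarith)
    have hδ'' : δ' = δ := by linarith
    subst hδ''
    obtain ⟨⟨α, α', hα, eZ⟩, ⟨β, β', β'', hβ, eX⟩, ⟨γ, γ', γ'', γ''', hγ, eY⟩⟩ :=
      sorted_coords (x := z) (y := x) (z := y1) (a := Z) (b := X) (c := Y + C f * Z ^ 2)
        (by rw [V_rot Z, V_swap12 z, hV])
        (by
          have : V Z X (Y + C f * Z ^ 2) = V z x y1 := by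
            rw [V_rot Z, V_swap12 z, hV]
          exact J_ne_of_V this.symm (by rw [J_swap12]; exact neg_ne_zero.2 hJ1))
        (by linarith) (by linarith) (by linarith [hK.1]) (by linarith [hK.1])
    have eY' : Y = C γ * y + C (γ * a - f * α ^ 2) * z ^ 2 + C (γ * b + γ'' - 2 * f * α * α') * z +
        C (γ * c + γ') * x + C (γ * e + γ''' - f * α' ^ 2) := by
      have : Y = (Y + C f * Z ^ 2) - C f * Z ^ 2 := by ring
      rw [this, eY, eZ, hy1]
      have h2 : (C 2 : Pol k) = 2 := map_ofNat C 2
      simp only [C_add, C_sub, C_mul, C_pow, h2]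
      ring
    obtain ⟨p0, s0, q0⟩ := lin_rigid hI hβ hγ eX eY' (by linarith) (by linarith) hΔ
      (by have := hK.2.2.2.2.1; linarith)
    rw [p0, q0, C_0, zero_mul, zero_mul, add_zero, add_zero] at eY'
    rw [s0, C_0, zero_mul, add_zero] at eX
    have eL := L_congr_pair hβ hγ eX eY'
    have hk : (C α⁻¹ : Pol k) * C α = 1 := by rw [← C_mul, inv_mul_cancel₀ hα, C_1]
    refine ⟨C α⁻¹ * Z1, ?_, ?_, ?_⟩
    · have : C α⁻¹ * Z1 - z = C α⁻¹ * (Z1 - Z) + C (α⁻¹ * α') := by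
        rw [eZ, C_mul]; linear_combination z * hk
      rw [this, ← A_congr_L eL]
      exact (A X Y).add_mem (C_mul_mem_A _ hK.2.2.2.2.2.1) (C_mem_A _ _ _)
    · rw [dg_C_mul (inv_ne_zero hα), d1]; exact hK.2.2.2.2.2.2.1
    · rw [V_congr3 (inv_ne_zero hα) (h := Z1) (by simp), ← V_congr_L eL]
      exact hG

end CharZero
end TameStab

namespace TameStab
variable {k : Type} [Field k]

theorem W_add_of_aeval (b a : Pol k) (P : Polynomial k) :
    W b (a + Polynomial.aeval b P) = W b a := by
  refine W_add_of_br fun i j => ?_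
  have hu : ∀ i, D i (Polynomial.aeval b P) =
      Polynomial.aeval b (Polynomial.derivative P) * D i b := fun i => by
    rw [Derivation.map_aeval, smul_eq_mul]
  simp only [br, hu]; ring

theorem A_add_aeval (a b : Pol k) (P : Polynomial k) : A (a + Polynomial.aeval b P) b = A a b := by
  refine le_antisymm (A_le ((A a b).add_mem (left_mem_A _ _) (aeval_mem (right_mem_A _ _) P))
    (right_mem_A _ _)) (A_le ?_ (right_mem_A _ _))
  have : a = (a + Polynomial.aeval b P) - Polynomial.aeval b P := by ring
  have h := (A (a + Polynomial.aeval b P) b).sub_mem (left_mem_A _ _)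
    (aeval_mem (right_mem_A _ _) P)
  rwa [← this] at h

/-- A representative of `a` modulo `k[b]` of minimal degree. -/
theorem exists_min_aeval (a : Pol k) {b : Pol k} (hb : 0 < dg b) :
    ∃ P : Polynomial k, (∀ m : ℕ, 0 < m → dg (a + Polynomial.aeval b P) ≠ m * dg b) ∧
      ∀ Q : Polynomial k, dg (a + Polynomial.aeval b P) ≤ dg (a + Polynomial.aeval b Q) := by
  obtain ⟨p, hp, hmin⟩ := exists_min (S := Set.range fun P : Polynomial k => a + Polynomial.aeval b P)
    (Set.range_nonempty _)
  obtain ⟨P, rfl⟩ := hp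
  refine ⟨P, fun m hm e => ?_, fun Q => hmin _ ⟨Q, rfl⟩⟩
  have e' : dg (a + Polynomial.aeval b P) = dg (b ^ m) := by rw [dg_pow, e]
  obtain ⟨κ, -, hlt⟩ := exists_cancel e' (by
    rw [dg_pow]; exact mul_pos (by exact_mod_cast hm) hb)
  refine absurd (hmin _ ⟨P - Polynomial.C κ * Polynomial.X ^ m, rfl⟩) (not_le.2 ?_)
  refine lt_of_eq_of_lt ?_ hlt
  simp only [map_sub, map_mul, map_pow, Polynomial.aeval_X, Polynomial.aeval_C, algebraMap_eq]
  congr 1; ring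

section CharZero
variable [CharZero k]

theorem no_reduction_of_add_lt {a b c c1 : Pol k} (hI : Ind a b) (hA : c1 - c ∈ A a b)
    (hlt : dg c1 < dg c) (h1 : dg c + dg b < W a b) (h2 : dg b + dg b < W a b)
    (hm : ∀ m : ℕ, dg c ≠ m * dg b) : False := by
  obtain ⟨P, hP, -⟩ := exists_min_aeval a hI.symm.dg_pos
  set a' := a + Polynomial.aeval b P with ha'
  have hW : W a' b = W a b := by rw [W_comm, ha', W_add_of_aeval, W_comm]
  have hI' : Ind a' b := by
    by_contra h
    have : W a' b = 0 := by
      refine le_antisymm (W_le fun i j => ?_) (W_nonneg _ _)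
      have : br i j a' b = 0 := by
        by_contra h3
        exact h ⟨i, j, h3⟩
      rw [this, dg_zero]
    rw [hW] at this; linarith [hI.W_pos]
  have hle : W a b ≤ dg a' + dg b := hW ▸ W_le_add _ _
  have hb := hI.symm.dg_pos
  refine no_reduction hI' (c1 := c1) (c := c) (by rwa [ha', A_add_aeval]) hlt ⟨fun m e => ?_, fun m e => ?_⟩ ?_
    fun n m e => ?_
  · rcases Nat.eq_zero_or_pos m with rfl | hm'
    · simp at e; linarith
    · exact hP m hm' e
  · rcases m with _ | m
    · simp at e; linarith
    · push_cast at e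
      nlinarith [(Nat.cast_nonneg m : (0:ℝ) ≤ m)]
  · rw [hW]; linarith
  · rcases n with _ | n
    · exact hm m (by simpa using e)
    · push_cast at e
      nlinarith [mul_nonneg (Nat.cast_nonneg n : (0:ℝ) ≤ n) (by linarith : 0 ≤ dg a'),
        mul_nonneg (Nat.cast_nonneg m : (0:ℝ) ≤ m) hb.le]

set_option maxHeartbeats 1000000 in
/-- The shape of a reduction below the top degree along a nonresonant line. -/
theorem line_data {d : ℝ} (H : Sd k d) {x y z : Pol k} (hd : dg x + dg y + dg z ≤ d)
    (hR : RL x y z) (hxy : dg x < dg y) (hres : NonRes (dg x) (dg y)) (hD : Dist x y z)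
    (hzy : dg z < dg y) (hz : ∀ n : ℕ, dg z ≠ n * dg x) :
    ∃ (p : ℕ) (ε : ℝ), 0 < ε ∧ Odd p ∧ 3 ≤ p ∧ dg x = 2 * ε ∧ dg y = p * ε ∧
      p * ε - 2 * ε + W x y ≤ dg z ∧ p * ε + W x y ≤ W x z ∧
      W y z = p * ε - 2 * ε + W x z := by
  have hJ := hR.J_ne
  have hI := Ind12 hJ
  obtain ⟨zz, hAz, hltz, hGz⟩ := hR
  obtain ⟨z0, hA0, hM⟩ := exists_minC x y z
  have hle := hM.le_of hA0 hAz
  have hG0 : Good (V x y z0) := by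
    refine H x y zz z0 (by linarith) hGz ?_
    rw [← sub_sub_sub_cancel_right z0 zz z]
    exact (A x y).sub_mem hA0 hAz
  have hJ0 := hG0.J_ne
  obtain ⟨ψ, hψ⟩ := mem_A.1 hA0
  have hdψ : dg (ev x y ψ) = dg z := by rw [hψ, dg_sub_of_lt (by linarith)]
  have hx0 := hI.dg_pos
  have hy0 := hI.symm.dg_pos
  rcases drop_lt_max hI hres (φ := ψ) (by rw [hdψ]; exact lt_max_of_lt_right hzy) with
    hN | ⟨p, ε, hε, hodd, hp3, hxy', h1, h2⟩
  · obtain ⟨n, -, hn⟩ := hN.exists_eq (by rw [hdψ]; exact (Ind_of_J hJ).symm.dg_pos)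
    rw [hdψ] at hn
    rcases h : n 1 with _ | m
    · rw [h] at hn; exact (hz (n 0) (by simpa using hn.symm)).elim
    · rw [h] at hn
      push_cast at hn
      nlinarith [mul_nonneg (Nat.cast_nonneg (n 0) : (0:ℝ) ≤ n 0) hx0.le,
        mul_nonneg (Nat.cast_nonneg m : (0:ℝ) ≤ m) hy0.le]
  have hp3' : 3 * ε ≤ p * ε := by
    have : (3:ℝ) ≤ p := by exact_mod_cast hp3
    nlinarith
  obtain ⟨hx, hy⟩ : dg x = 2 * ε ∧ dg y = p * ε := by
    rcases hxy' with h | ⟨e1, e2⟩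
    · exact h
    · linarith
  rw [sub_mul, hdψ] at h1
  rw [mul_assoc, hy] at h2
  obtain ⟨P, hPdef⟩ : ∃ P : ℝ, P = p * ε := ⟨_, rfl⟩
  rw [← hPdef] at hp3' hy h1 h2 hxy'
  have hclaim : P + W x y ≤ W x z := by
    by_contra! hlt
    have hψ1 : pderiv 1 ψ ≠ 0 := by
      intro h; rw [h, map_zero, dg_zero] at h2; linarith
    have w1 : P + W x y ≤ W x z0 := by
      have h3 := W_ev hI hψ1
      have : z0 = ev x y ψ + z := by rw [hψ]; ring
      rw [this, W_add_eq (by linarith)]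
      linarith
    have hΔ := hI.W_pos
    have w2 : W y z0 = P - 2 * ε + W x z0 := by
      have := TM_eq hJ0 (by rw [hy]; linarith)
      linarith
    have lo : P - 2 * ε + W x y ≤ dg z0 := by have := W_le_add x z0; linarith
    have hcomb := hM.ne_comb hJ0
    have ne1 : dg z0 ≠ 2 * ε := by rw [← hx]; simpa using hcomb 1 0
    have ne2 : dg z0 ≠ P := by rw [← hy]; simpa using hcomb 0 1
    have c1 : W z0 x = W x z0 := W_comm _ _
    have c2 : W z0 y = W y z0 := W_comm _ _
    have c3 : W y x = W x y := W_comm _ _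
    have hdist : Dist x y z0 := ⟨hD.1, by rw [hx]; exact ne1.symm, by rw [hy]; exact ne2.symm⟩
    have hexc : ∀ n m : ℕ, dg y = n * dg x + m * dg z0 → p = 3 ∧ dg z0 = 3 / 2 * ε := by
      intro n m e
      rw [hx, hy] at e
      have en : (0:ℝ) ≤ n * ε := by positivity
      have hp5 : p = 3 ∨ 5 * ε ≤ P := by
        rcases hodd with ⟨r, hr⟩
        rcases Nat.lt_or_ge p 5 with h | h
        · left; omega
        · right
          have : (5:ℝ) ≤ p := by exact_mod_cast h
          rw [hPdef]; nlinarith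
      rcases m with _ | _ | _ | m
      · have : p = 2 * n := nat_eq_of_mul hε _ _ (by push_cast; rw [← hPdef, e]; push_cast; ring)
        rcases hodd with ⟨r, hr⟩
        omega
      · rcases n with _ | n
        · push_cast at e; exact absurd (by linarith) ne2
        · push_cast at e
          nlinarith [mul_nonneg (Nat.cast_nonneg n : (0:ℝ) ≤ n) hε.le]
      · rcases hp5 with h | h
        · refine ⟨h, ?_⟩
          have hP3 : P = 3 * ε := by rw [hPdef, h]; push_cast; ring
          rcases n with _ | n
          · push_cast at e; linarith
          · push_cast at e
            nlinarith [mul_nonneg (Nat.cast_nonneg n : (0:ℝ) ≤ n) hε.le]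
        · push_cast at e; linarith
      · push_cast at e
        nlinarith [mul_nonneg (Nat.cast_nonneg m : (0:ℝ) ≤ m) (by linarith : 0 ≤ dg z0)]
    have hresx : NonRes (dg x) (dg z0) := by
      rw [hx]
      exact nonRes_of (by linarith) ne1.symm (by linarith) fun m => by rw [← hx]; simpa using hcomb m 0
    rcases hG0.inv hdist with hB | hF | hF | hF | ⟨X, Y, Z, Z1, f, δ', hK, hG, hV⟩
    · refine absurd ?_ (base_incommensurable (hB ▸ fst_mem_V x y z0) (hB ▸ snd_mem_V x y z0)
        hx0 hy0 hdist.1 p 2 (by omega))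
      rw [hx, hy, hPdef]; push_cast; ring
    · refine (hF.false hres hcomb fun s t hs ht => ?_).elim
      by_cases s0 : s = 0
      · subst s0
        by_cases t0 : t = 0
        · subst t0; exact Or.inl ⟨rfl, rfl, hM⟩
        · right
          have : y + C t * z0 = C t * z0 + C 1 * y := by simp; ring
          rw [C_0, zero_mul, add_zero, this, W_lin t0 (by linarith)]
          linarith
      · right
        have e1 : W z0 (y + C t * z0) = W z0 y := W_add_self _ _ _
        have e2 : W x (y + C t * z0) ≤ W x z0 := by
          refine (W_add_le _ _ _).trans (max_le (by linarith) (W_C_mul_le _ _ _))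
        have : x + C s * z0 = C s * z0 + C 1 * x := by simp; ring
        rw [W_comm, this, W_lin s0, W_comm, e1]
        · linarith
        · rw [W_comm _ x, W_comm _ z0, e1]; linarith
    · by_cases hex : p = 3 ∧ dg z0 = 3 / 2 * ε
      · have hP3 : P = 3 * ε := by rw [hPdef, hex.1]; push_cast; ring
        obtain ⟨s, t, y1, hs, ht, hA, hlt, hG⟩ := hF
        have s0 := hs.resolve_right (by linarith)
        have t0 := ht.resolve_right (by linarith)
        subst s0 t0
        simp only [C_0, zero_mul, add_zero] at hA hG
        obtain ⟨z1, m1, m2, -⟩ := RL_of_quadratic H (x := x) (y := y) (z := z0) (δ := ε)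
          (by linarith) hx (by linarith) hex.2 (by linarith) (by linarith) ⟨y1, hA, hlt, hG⟩
        exact absurd (hM z1 m1) (not_le.2 m2)
      · refine (hF.false hresx (fun n m e => hex (hexc n m e)) fun s t hs ht => Or.inr ?_).elim
        have s0 := hs.resolve_right (by linarith)
        have t0 := ht.resolve_right (by linarith)
        subst s0 t0
        simp only [C_0, zero_mul, add_zero]
        linarith
    · have hWp : ∀ s t : k, W y z0 ≤ W (y + C s * x) (z0 + C t * x) := fun s t =>
        W_pair (by linarith) (by linarith)
      by_cases hex : p = 3 ∧ dg z0 = 3 / 2 * ε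
      · have hP3 : P = 3 * ε := by rw [hPdef, hex.1]; push_cast; ring
        obtain ⟨s, t, x1, hs, ht, hA, hlt, hG⟩ := hF
        have t0 := ht.resolve_right (by linarith)
        subst t0
        have := hWp s 0
        simp only [C_0, zero_mul, add_zero] at hA hG this
        refine no_reduction_of_add_lt (Ind12 hG.J_ne) hA hlt ?_ ?_ ?_
        · linarith
        · linarith
        · intro m e
          rw [hx, hex.2] at e
          have := nat_eq_of_mul hε 4 (3 * m) (by push_cast; linarith)
          omega
      · refine (hF.false ⟨fun m e => hex (hexc 0 m (by simpa using e)),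
          fun m => by simpa using hcomb 0 m⟩ (fun n m e => ?_) fun s t hs ht => Or.inr ?_).elim
        · rw [hx, hy] at e
          rcases n with _ | n
          · rcases m with _ | _ | m
            · simp at e; linarith
            · push_cast at e; exact ne1 (by linarith)
            · push_cast at e
              nlinarith [mul_nonneg (Nat.cast_nonneg m : (0:ℝ) ≤ m) (by linarith : 0 ≤ dg z0)]
          · push_cast at e
            nlinarith [mul_nonneg (Nat.cast_nonneg m : (0:ℝ) ≤ m) (by linarith : 0 ≤ dg z0),
              mul_nonneg (Nat.cast_nonneg n : (0:ℝ) ≤ n) (by linarith : 0 ≤ P)]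
        · have := hWp s t
          linarith
    · have hJK := hK.J_ne hG
      obtain ⟨hδ', -⟩ := hK.spec hJK
      have hζ := hK.2.2.1
      rcases lt_or_gt_of_ne ne1 with h3 | h3
      · have := hK.sorted hJK (a := z0) (b := x) (c := y) (by rw [← hV, V_rot])
          (by linarith) (by linarith)
        linarith
      · have := hK.sorted hJK (a := x) (b := z0) (c := y) (by rw [← hV, V_swap23])
          (by linarith) (by linarith)
        linarith
  refine ⟨p, ε, hε, hodd, hp3, hx, by rw [hy, hPdef], ?_, ?_, ?_⟩
  · rw [← hPdef]; linarith
  · rw [← hPdef]; exact hclaim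
  · rw [← hPdef]
    have := TM_eq hJ (by linarith)
    linarith

end CharZero
end TameStab

namespace TameStab
variable {k : Type} [Field k]

theorem A_add_aeval_right (u z : Pol k) (P : Polynomial k) :
    A u (z + Polynomial.aeval u P) = A u z := by
  rw [A_swap, A_add_aeval, A_swap]

theorem aeval_mem_left (u v : Pol k) (P : Polynomial k) : Polynomial.aeval u P ∈ A u v :=
  aeval_mem (left_mem_A _ _) P

theorem exists_cancel_pow {a b : Pol k} {r : ℕ} (h : dg a = r * dg b) (ha : 0 < dg a) :
    ∃ P : Polynomial k, dg (a + Polynomial.aeval b P) < dg a := by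
  have e : dg a = dg (b ^ r) := by rw [dg_pow, h]
  obtain ⟨κ, -, hlt⟩ := exists_cancel e (e ▸ ha)
  refine ⟨-(Polynomial.C κ * Polynomial.X ^ r), lt_of_eq_of_lt ?_ hlt⟩
  simp only [map_neg, map_mul, map_pow, Polynomial.aeval_X, Polynomial.aeval_C, algebraMap_eq]
  congr 1; ring

theorem aeval_of_natDegree_le_one {P : Polynomial k} (h : P.natDegree ≤ 1) :
    ∃ a b : k, ∀ u : Pol k, Polynomial.aeval u P = C a * u + C b := by
  obtain ⟨a, b, rfl⟩ := Polynomial.exists_eq_X_add_C_of_natDegree_le_one h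
  exact ⟨a, b, fun u => by simp [algebraMap_eq]⟩

theorem ev_lin {φ : MvPolynomial (Fin 2) k}
    (h : ∀ n, coeff n φ ≠ 0 → n 1 = 0 ∨ (n 0 = 0 ∧ n 1 = 1)) :
    ∃ (P : Polynomial k) (β : k), ∀ f g : Pol k, ev f g φ = Polynomial.aeval f P + C β * g := by
  classical
  obtain ⟨P, hP⟩ := exists_univariate (φ := φ - monomial (Finsupp.single 1 1)
    (coeff (Finsupp.single 1 1) φ)) fun n hn => by
      rw [coeff_sub, coeff_monomial] at hn
      by_cases e : (Finsupp.single 1 1 : Fin 2 →₀ ℕ) = n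
      · subst e; simp at hn
      · rw [if_neg e, sub_zero] at hn
        rcases h n hn with h | ⟨h0, h1⟩
        · exact h
        · refine absurd ?_ e
          ext i; fin_cases i <;> simp [h0, h1]
  refine ⟨P, coeff (Finsupp.single 1 1) φ, fun f g => ?_⟩
  have := hP f g
  rw [map_sub, sub_eq_iff_eq_add] at this
  rw [this, ev_monomial]
  simp

section Moves
variable {d : ℝ} {u v z v' z' : Pol k}

theorem RL.good_add (H : Sd k d) (hd : dg u + dg v + dg z ≤ d) (hR : RL u v z)
    (P : Polynomial k) : Good (V u v (z + Polynomial.aeval u P)) := by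
  obtain ⟨z0, hA, hlt, hG⟩ := hR
  refine H u v z0 _ (by linarith) hG ?_
  rw [show z + Polynomial.aeval u P - z0 = Polynomial.aeval u P - (z0 - z) by ring]
  exact (A u v).sub_mem (aeval_mem_left _ _ _) hA

theorem RL.good_of_sub (H : Sd k d) (hd : dg u + dg v + dg z ≤ d) (hR : RL u v z)
    (hz' : z' - z ∈ A u v) : Good (V u v z') := by
  obtain ⟨z0, hA, hlt, hG⟩ := hR
  refine H u v z0 _ (by linarith) hG ?_
  rw [← sub_sub_sub_cancel_right z' z0 z]
  exact (A u v).sub_mem hz' hA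

/-- `z` can be lowered modulo `k[u]`. -/
theorem RL.good_of_lower_thd (H : Sd k d) (hd : dg u + dg v + dg z ≤ d) (hR : RL u v z)
    {P : Polynomial k} (hlt : dg (z + Polynomial.aeval u P) < dg z) (hA : v' - v ∈ A u z)
    (hv : dg v' ≤ dg v) : Good (V u v' z) := by
  have h1 := hR.good_add H hd P
  have h2 := H.mv2 (by linarith) h1 (g' := v') (by rwa [A_add_aeval_right])
  refine H u v' _ z (by linarith) h2 ?_
  rw [sub_add_cancel_left]
  exact (A u v').neg_mem (aeval_mem_left _ _ _)

theorem RL.good_add_snd (H : Sd k d) (hd : dg u + dg v + dg z ≤ d) (hR : RL u v z)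
    {P : Polynomial k} (hle : dg (v + Polynomial.aeval u P) ≤ dg v) (hz' : z' - z ∈ A u v) :
    Good (V u (v + Polynomial.aeval u P) z') := by
  obtain ⟨z0, hA, hlt, hG⟩ := hR
  have h1 := H.mv2 (by linarith) hG (g' := v + Polynomial.aeval u P)
    (by rw [add_sub_cancel_left]; exact aeval_mem_left _ _ _)
  refine H _ _ _ _ (by linarith) h1 ?_
  rw [A_add_aeval_right, ← sub_sub_sub_cancel_right z' z0 z]
  exact (A u v).sub_mem hz' hA

/-- `v` can be lowered modulo `k[u]`. -/
theorem RL.good_of_lower_snd (H : Sd k d) (hd : dg u + dg v + dg z ≤ d) (hR : RL u v z)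
    {P : Polynomial k} (hlt : dg (v + Polynomial.aeval u P) < dg v) (hA : v' - v ∈ A u z) :
    Good (V u v' z) := by
  have h1 := hR.good_add_snd H hd hlt.le (z' := z) (by rw [sub_self]; exact zero_mem _)
  refine H.mv2 (by linarith) h1 ?_
  rw [show v' - (v + Polynomial.aeval u P) = v' - v - Polynomial.aeval u P by ring]
  exact (A u z).sub_mem hA (aeval_mem_left _ _ _)

theorem RL.good_of_eq_aeval (H : Sd k d) (hd : dg u + dg v + dg z ≤ d) (hR : RL u v z)
    {P : Polynomial k} (hP : v' - v = Polynomial.aeval u P) (hv : dg v' ≤ dg v) :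
    Good (V u v' z) := by
  rw [show v' = v + Polynomial.aeval u P by rw [← hP]; ring] at hv ⊢
  exact hR.good_add_snd H hd hv (by rw [sub_self]; exact zero_mem _)

theorem RL.good_pair_of_lower_thd (H : Sd k d) (hd : dg u + dg v + dg z ≤ d) (hR : RL u v z)
    {P : Polynomial k} (hlt : dg (z + Polynomial.aeval u P) < dg z)
    (hzv : dg z < dg v) (hz' : z' - z ∈ A u (v + z)) : Good (V u (v + z) z') := by
  have h1 := hR.good_add H hd P
  have h2 := H.mv2 (by linarith) h1 (g' := v + z) (by
    rw [add_sub_cancel_left, A_add_aeval_right]; exact right_mem_A _ _)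
  refine H _ _ _ _ (by rw [dg_add_eq hzv]; linarith) h2 ?_
  rw [show z' - (z + Polynomial.aeval u P) = z' - z - Polynomial.aeval u P by ring]
  exact (A u _).sub_mem hz' (aeval_mem_left _ _ _)

theorem RL.good_pair_of_lower_snd (H : Sd k d) (hd : dg u + dg v + dg z ≤ d) (hR : RL u v z)
    {P : Polynomial k} (hlt : dg (v + Polynomial.aeval u P) < dg v)
    (hzv : dg z < dg v) (hz : dg z' ≤ dg z) (hz' : z' - z ∈ A u (v + z)) :
    Good (V u (v + z) z') := by
  have h1 := hR.good_add_snd H hd hlt.le (z' := z) (by rw [sub_self]; exact zero_mem _)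
  have e1 : V u (v + Polynomial.aeval u P) z = V u (v + z + Polynomial.aeval u P) z := by
    refine (V_congr2' ?_).symm
    rw [show v + z + Polynomial.aeval u P - (v + Polynomial.aeval u P) = z by ring]
    exact right_mem_L _ _
  rw [e1] at h1
  have hw : dg (v + z + Polynomial.aeval u P) < dg v := by
    rw [show v + z + Polynomial.aeval u P = (v + Polynomial.aeval u P) + z by ring]
    exact (dg_add_le _ _).trans_lt (max_lt hlt hzv)
  have h2 := H _ _ _ z' (by linarith) h1 (by rwa [A_add_aeval_right])
  refine H.mv2 (by linarith) h2 ?_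
  rw [sub_add_cancel_left]
  exact (A u _).neg_mem (aeval_mem_left _ _ _)

theorem RL.good_pair_of_eq_aeval (H : Sd k d) (hd : dg u + dg v + dg z ≤ d) (hR : RL u v z)
    {P : Polynomial k} (hP : z' - z = Polynomial.aeval u P) (hPv : dg (Polynomial.aeval u P) ≤ dg v) :
    Good (V u (v + z) z') := by
  have h1 := hR.good_add_snd H hd (P := -P) (z' := z')
    ((dg_add_le _ _).trans (max_le le_rfl (by rw [map_neg, dg_neg]; exact hPv)))
    (by rw [hP]; exact aeval_mem_left _ _ _)
  have e : V u (v + z) z' = V u (v + Polynomial.aeval u (-P)) z' := by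
    refine V_congr2' ?_
    rw [show v + z - (v + Polynomial.aeval u (-P)) = z' by
      rw [map_neg, ← hP]; ring]
    exact right_mem_L _ _
  rwa [e]

theorem RL.rotate_of_eq_mul (H : Sd k d) (hd : dg u + dg v + dg z ≤ d) (hR : RL u v z)
    {r : ℕ} (hu : 0 < dg u) (hr : dg u = r * dg v) : RL v z u := by
  obtain ⟨P, hP⟩ := exists_cancel_pow hr hu
  obtain ⟨z0, hA, hlt, hG⟩ := hR
  have h1 := H.mv1 (by linarith) hG (f' := u + Polynomial.aeval v P)
    (by rw [add_sub_cancel_left]; exact aeval_mem_left _ _ _)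
  have h2 := H _ _ _ z (by linarith) h1
    (by rw [A_add_aeval, ← neg_sub]; exact (A u v).neg_mem hA)
  exact ⟨_, by rw [add_sub_cancel_left]; exact aeval_mem_left _ _ _, hP, by rwa [← V_rot]⟩

end Moves

section CharZero
variable [CharZero k]

theorem exists_aeval_of_SL {f g q : Pol k} (hI : Ind f g) (hq : q ∈ A f g)
    (h : dg f + dg q < W f g) : ∃ P : Polynomial k, q = Polynomial.aeval f P := by
  obtain ⟨φ, rfl⟩ := mem_A.1 hq
  have h0 : pderiv 1 φ = 0 := by
    by_contra h0
    have := SL hI h0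
    linarith [dg_nonneg (ev f g (pderiv 1 φ))]
  obtain ⟨P, hP⟩ := exists_univariate (n1_eq_zero_of_pderiv h0)
  exact ⟨P, hP f g⟩

omit [CharZero k] in
theorem NoDrop.exists_aeval {f g : Pol k} {φ : MvPolynomial (Fin 2) k} (h : NoDrop f g φ)
    (hf : 0 ≤ dg f) (hlt : dg (ev f g φ) < dg g) :
    ∃ P : Polynomial k, ev f g φ = Polynomial.aeval f P := by
  obtain ⟨P, hP⟩ := exists_univariate (φ := φ) fun n hn => by
    have := h n hn
    by_contra h1
    have h1' : (1:ℝ) ≤ n 1 := by exact_mod_cast Nat.one_le_iff_ne_zero.2 h1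
    nlinarith [mul_nonneg (Nat.cast_nonneg (n 0) : (0:ℝ) ≤ n 0) hf, dg_nonneg g]
  exact ⟨P, hP f g⟩

theorem exists_aeval_of_W {f g q : Pol k} (hI : Ind f g) (hres : NonRes (dg f) (dg g))
    (hq : q ∈ A f g) (hW : dg q ≤ W f g) (hlt : dg q < dg g) :
    ∃ P : Polynomial k, q = Polynomial.aeval f P := by
  obtain ⟨φ, rfl⟩ := mem_A.1 hq
  exact (noDrop_of_le_W hI hres hW).exists_aeval hI.dg_pos.le hlt

omit [CharZero k] in
theorem Ind_of_W_pos {f g : Pol k} (h : 0 < W f g) : Ind f g := by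
  by_contra h1
  refine h.not_ge (W_le fun i j => ?_)
  have : br i j f g = 0 := by
    by_contra h3
    exact h1 ⟨i, j, h3⟩
  rw [this, dg_zero]

omit [CharZero k] in
theorem eq_C_of_dg_aeval_lt {f : Pol k} {P : Polynomial k} (h : dg (Polynomial.aeval f P) < dg f) :
    ∃ c : k, Polynomial.aeval f P = C c := by
  have hf : 0 < dg f := (dg_nonneg _).trans_lt h
  rw [dg_aeval hf] at h
  have : P.natDegree = 0 := by
    by_contra h1
    have h1' : (1:ℝ) ≤ P.natDegree := by exact_mod_cast Nat.one_le_iff_ne_zero.2 h1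
    nlinarith
  rw [Polynomial.eq_C_of_natDegree_eq_zero this]
  exact ⟨_, by rw [Polynomial.aeval_C, algebraMap_eq]⟩

/-- Lines meeting the third direction. -/
theorem RL.good_pair {d : ℝ} {u v z z' : Pol k} (H : Sd k d) (hd : dg u + dg v + dg z ≤ d)
    (hR : RL u v z) (hD : Dist u v z) (hzv : dg z < dg v) (hz' : z' - z ∈ A u (v + z))
    (hz : dg z' ≤ dg z) : Good (V u (v + z) z') := by
  have hJ := hR.J_ne
  have hI := Ind12 hJ
  have hu0 := hI.dg_pos
  have hv0 := hI.symm.dg_pos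
  have hz0 := (Ind13 hJ).symm.dg_pos
  have hvz : dg (v + z) = dg v := dg_add_eq hzv
  have hq : dg (z' - z) ≤ dg z := (dg_sub_le _ _).trans (max_le hz le_rfl)
  by_cases h1 : ∃ n : ℕ, dg v = n * dg u
  · obtain ⟨n, hn⟩ := h1
    obtain ⟨P, hP⟩ := exists_cancel_pow hn hv0
    exact hR.good_pair_of_lower_snd H hd hP hzv hz hz'
  by_cases h2 : ∃ n : ℕ, dg u = n * dg v
  · obtain ⟨n, hn⟩ := h2
    obtain ⟨z1, hA1, hlt1, hG1⟩ := hR.rotate_of_eq_mul H hd hu0 hn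
    have hL : L v z = L (v + z) z := by
      rw [L_swap, L_swap (v + z), L_congr2 (f := z) (g := v) (g' := v + z) one_ne_zero (a := 1)
        (b := 0) (by simp)]
    have hR' : RL (v + z) z u := ⟨z1, by rwa [← A_congr_L hL], hlt1, by rwa [← V_congr_L hL]⟩
    obtain ⟨P, hP⟩ := exists_cancel_pow (a := u) (b := v + z) (r := n) (by rw [hvz, hn]) hu0
    have := hR'.good_of_lower_thd H (by rw [hvz]; linarith) hP (v' := z') (by rwa [A_swap]) hz
    rwa [← V_rot] at this
  push Not at h1 h2
  have hres : NonRes (dg u) (dg v) := ⟨h2, h1⟩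
  by_cases h3 : ∃ n : ℕ, dg z = n * dg u
  · obtain ⟨n, hn⟩ := h3
    obtain ⟨P, hP⟩ := exists_cancel_pow hn hz0
    exact hR.good_pair_of_lower_thd H hd hP hzv hz'
  push Not at h3
  rcases lt_or_gt_of_ne hD.1 with huv | huv
  · obtain ⟨p, ε, hε, -, hp3, hx, hy, l1, l2, l3⟩ := line_data H hd hR huv hres hD hzv h3
    have hp : (0:ℝ) < p * ε := by rw [← hy]; exact hv0
    have hW : W u (v + z) = W u z := by rw [add_comm]; exact W_add_eq (by linarith)
    have hΔ := hI.W_pos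
    obtain ⟨P, hP⟩ := exists_aeval_of_W (Ind_of_W_pos (by rw [hW]; linarith)) (by rwa [hvz]) hz'
      (by rw [hW]; linarith) (by rw [hvz]; linarith)
    exact hR.good_pair_of_eq_aeval H hd hP (by rw [← hP]; linarith)
  · obtain ⟨p, ε, hε, -, hp3, hx, hy, l1, l2, l3⟩ := line_data H (by linarith) hR.swap huv
      hres.symm hD.swap12 (hzv.trans huv) fun n e => by
        rcases n with _ | n
        · simp at e; linarith
        · push_cast at e
          nlinarith [(Nat.cast_nonneg n : (0:ℝ) ≤ n)]
    have hp : 3 * ε ≤ p * ε := by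
      have : (3:ℝ) ≤ p := by exact_mod_cast hp3
      nlinarith
    have hΔ := hI.symm.W_pos
    have hW : W u (v + z) = W u z := by
      rw [add_comm]; exact W_add_eq (by rw [W_comm u v]; linarith)
    obtain ⟨Q, hQ⟩ := exists_aeval_of_SL (f := v + z) (g := u)
      (Ind_of_W_pos (by rw [W_comm, hW]; linarith)) (by rwa [A_swap])
      (by rw [W_comm, hW, hvz]; linarith)
    obtain ⟨c, hc⟩ := eq_C_of_dg_aeval_lt (f := v + z) (P := Q) (by rw [← hQ, hvz]; linarith)
    have e1 : V u (v + z) z' = V u (v + z) z := by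
      refine V_congr3' ?_
      rw [hQ, hc]; exact C_mem_L _ _ _
    have e2 : V u (v + z) z = V u v z := V_congr2' (by
      rw [add_sub_cancel_left]; exact right_mem_L _ _)
    rw [e1, e2]
    exact hR.good hD

end CharZero

end TameStab

namespace TameStab
variable {k : Type} [Field k] [CharZero k]

omit [CharZero k] in
theorem lt_of_ev_eq_sub {u v z v' : Pol k} (hJ : J u v z ≠ 0) {φ : MvPolynomial (Fin 2) k}
    (hφ : ev u z φ = v' - v) (h1 : 0 < dg (ev u z (pderiv 1 φ))) :
    dg (ev u z (pderiv 1 φ)) < dg v' + W u v := by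
  have hJ' : J u z v ≠ 0 := J_ne23 hJ
  have e1 : J u (ev u z φ) v = J u v' v := by
    rw [hφ]; simp only [J, br, map_sub]; ring
  have h2 := dg_mul (ne_zero_of_dg_pos h1) hJ'
  rw [← J_ev, e1, J_swap12, dg_neg] at h2
  have := dg_J_le v' u v
  have := J_dg_pos hJ'
  linarith

/-- The exceptional configuration with degrees in ratio `4 : 6` does not occur. -/
theorem four_thirds_false {ε : ℝ} (hε : 0 < ε) {u v z : Pol k} (hu : dg u = 2 * ε)
    (hv : dg v = 4 / 3 * ε) (hz1 : 7 / 3 * ε < dg z) (hz2 : dg z < 3 * ε)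
    (hD : W u v ≤ 7 / 3 * ε) (hW : 8 / 3 * ε + W u v ≤ W u z)
    (hvz : W v z = W u z - 2 / 3 * ε) (hM : MinC u v z) (hG : Good (V u v z)) : False := by
  have hcomb := hM.ne_comb hG.J_ne
  have hcomb' := hM.swap.ne_comb (J_ne12 hG.J_ne)
  have hD0 : 0 ≤ W u v := W_nonneg _ _
  have hvu : W v u = W u v := W_comm _ _
  have hzu : W z u = W u z := W_comm _ _
  have hzv : W z v = W v z := W_comm _ _
  rw [V_swap12] at hG
  have hres1 : NonRes (dg v) (dg u) := by
    refine nonRes_of (by linarith) (by linarith) (by linarith) fun m e => ?_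
    have := nat_eq_of_mul hε 3 (2 * m) (by push_cast; rw [hu, hv] at e; linarith)
    omega
  have hres2 : NonRes (dg v) (dg z) :=
    nonRes_of (by linarith) (by linarith) (by linarith) fun m => by simpa using hcomb 0 m
  have hres3 : NonRes (dg u) (dg z) :=
    nonRes_of (by linarith) (by linarith) (by linarith) fun m => by simpa using hcomb m 0
  rcases hG.inv ⟨by linarith, by linarith, by linarith⟩ with
    hB | hF | hF | hF | ⟨X, Y, Z, Z1, f, δ', hK, hG', hV⟩
  · refine base_incommensurable (a := v) (b := u) ?_ ?_ (by linarith) (by linarith) (by linarith)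
      3 2 (by norm_num) (by push_cast; linarith)
    · rw [← hB]; exact fst_mem_V _ _ _
    · rw [← hB]; exact snd_mem_V _ _ _
  · refine hF.false hres1 hcomb' fun s t hs ht => Or.inl ⟨?_, ?_, hM.swap⟩
    · exact hs.resolve_right (by linarith)
    · exact ht.resolve_right (by linarith)
  · refine hF.false hres2 (fun n m e => ?_) fun s t hs ht => Or.inr ?_
    · rcases m with _ | m
      · exact hres1.2 n (by simpa using e)
      · push_cast at e
        nlinarith [mul_nonneg (Nat.cast_nonneg n : (0:ℝ) ≤ n) (dg_nonneg v),
          mul_nonneg (Nat.cast_nonneg m : (0:ℝ) ≤ m) (dg_nonneg z)]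
    · rw [hs.resolve_right (by linarith), C_0, zero_mul, add_zero,
        W_add_eq ((W_C_mul_le _ _ _).trans_lt (by linarith))]
      linarith
  · refine hF.false hres3 (fun n m e => ?_) fun s t _ _ => Or.inr ?_
    · rcases n with _ | n <;> rcases m with _ | m <;> push_cast at e
      · linarith
      · nlinarith [mul_nonneg (Nat.cast_nonneg m : (0:ℝ) ≤ m) (dg_nonneg z)]
      · nlinarith [mul_nonneg (Nat.cast_nonneg n : (0:ℝ) ≤ n) (dg_nonneg u)]
      · nlinarith [mul_nonneg (Nat.cast_nonneg n : (0:ℝ) ≤ n) (dg_nonneg u),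
          mul_nonneg (Nat.cast_nonneg m : (0:ℝ) ≤ m) (dg_nonneg z)]
    · refine le_trans ?_ (W_pair (by linarith) (by linarith))
      linarith
  · obtain ⟨-, h2, h3, -, -⟩ := hK.sorted (hK.J_ne hG') hV (by linarith) (by linarith)
    have := hK.2.2.2.2.1
    have := W_nonneg X Y
    linarith

theorem RL.good_line_of_lt {d : ℝ} {u v z v' : Pol k} (H : Sd k d) (hd : dg u + dg v + dg z ≤ d)
    (hR : RL u v z) (hD : Dist u v z) (huz : dg u < dg z) (hvz : dg v < dg z)
    (hres : NonRes (dg u) (dg z)) (hvu : ∀ n : ℕ, dg v ≠ n * dg u) (hA : v' - v ∈ A u z)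
    (hle : dg v' ≤ dg v) : Good (V u v' z) := by
  have hJ := hR.J_ne
  have hI := Ind12 hJ
  have hIz := Ind13 hJ
  have hu0 := hI.dg_pos
  have hv0 := hI.symm.dg_pos
  obtain ⟨φ, hφ⟩ := mem_A.1 hA
  have hdφ : dg (ev u z φ) ≤ dg v := by
    rw [hφ]; exact (dg_sub_le _ _).trans (max_le hle le_rfl)
  rcases drop_lt_max hIz hres (φ := φ) (lt_max_of_lt_right (by linarith)) with
    hN | ⟨p, ε, hε, hodd, hp3, hxy, h1, h2⟩
  · obtain ⟨P, hP⟩ := hN.exists_aeval hu0.le (by linarith)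
    exact hR.good_of_eq_aeval H hd (hφ ▸ hP) hle
  have hp : 3 * ε ≤ p * ε := by
    have : (3:ℝ) ≤ p := by exact_mod_cast hp3
    nlinarith
  obtain ⟨hu, hz⟩ : dg u = 2 * ε ∧ dg z = p * ε := by
    rcases hxy with h | ⟨e1, e2⟩
    · exact h
    · linarith
  rw [sub_mul] at h1
  rw [mul_assoc, hz] at h2
  have hΔ := hIz.W_pos
  have hlt := lt_of_ev_eq_sub hJ hφ (by linarith)
  have hres' : NonRes (dg u) (dg v) := nonRes_of hu0 hD.1 (by linarith) hvu
  obtain ⟨z0, hA0, hM⟩ := exists_minC u v z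
  have hz0 : dg z0 < dg z := by
    obtain ⟨z1, hA1, hlt1, -⟩ := hR
    exact (hM.le_of hA0 hA1).trans_lt hlt1
  have hG0 : Good (V u v z0) := hR.good_of_sub H hd hA0
  obtain ⟨ψ, hψ⟩ := mem_A.1 hA0
  have hdψ : dg (ev u v ψ) = p * ε := by rw [hψ, dg_sub_of_lt hz0, hz]
  have hp4 : p = 3 ∨ 5 * ε ≤ p * ε := by
    rcases Nat.lt_or_ge p 5 with h | h
    · left; obtain ⟨r, hr⟩ := hodd; omega
    · right
      have : (5:ℝ) ≤ p := by exact_mod_cast h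
      nlinarith
  rcases parachute hI hres' ψ with hN | ⟨p', q', ε', hε', hcop, hp2, hq2, e1, e2, h3, h4⟩
  · obtain ⟨n, -, hn⟩ := hN.exists_eq (by rw [hdψ]; linarith)
    rw [hdψ, hu] at hn
    have en : (0:ℝ) ≤ n 0 * ε := by positivity
    have key : p = 3 ∧ dg v = 3 / 2 * ε := by
      rcases hm : n 1 with _ | _ | _ | m <;> rw [hm] at hn <;> push_cast at hn
      · have := nat_eq_of_mul hε (2 * n 0) p (by push_cast; linarith)
        obtain ⟨r, hr⟩ := hodd
        omega
      · rcases h0 : n 0 with _ | m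
        · rw [h0] at hn; simp at hn; linarith
        · rw [h0] at hn; push_cast at hn
          nlinarith [mul_nonneg (Nat.cast_nonneg m : (0:ℝ) ≤ m) hε.le]
      · rcases hp4 with rfl | h5
        · refine ⟨rfl, ?_⟩
          push_cast at *
          rcases h0 : n 0 with _ | m
          · rw [h0] at hn; simp at hn; linarith
          · rw [h0] at hn; push_cast at hn
            nlinarith [mul_nonneg (Nat.cast_nonneg m : (0:ℝ) ≤ m) hε.le]
        · linarith
      · have : (0:ℝ) ≤ m * dg v := by positivity
        exfalso
        rcases hp4 with rfl | h5
        · push_cast at *; nlinarith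
        · nlinarith
    obtain ⟨rfl, hv⟩ := key
    push_cast at *
    have hR' : RL u z v := RL_of_quadratic (δ := ε) H (by linarith) hu hz hv (by linarith)
      (by linarith) hR
    rw [V_swap23]
    exact hR'.good_of_sub H (by linarith) hA
  · exfalso
    have h5 : ((p':ℝ) * q' - p' - q') * ε' = p' * q' * ε' - p' * ε' - q' * ε' := by ring
    rw [h5, hdψ] at h3
    have h6 : ((p' * q' : ℕ) : ℝ) * ε' < ((2 * p' + q' : ℕ) : ℝ) * ε' := by
      push_cast; linarith
    have h7 : p' * q' < 2 * p' + q' := by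
      exact_mod_cast lt_of_mul_lt_mul_right h6 hε'.le
    have h8 : q' = 2 ∨ (q' = 3 ∧ p' = 2) := by
      rcases Nat.lt_or_ge q' 4 with h | h
      · interval_cases q' <;> omega
      · exfalso; nlinarith
    rcases h8 with rfl | ⟨rfl, rfl⟩
    · have e3 : ε' = ε := by push_cast at e1; linarith
      subst e3
      have h9 : ((p:ℕ):ℝ) * ε' < ((p' + 2 : ℕ):ℝ) * ε' := by push_cast; linarith
      have h10 : (p':ℝ) * ε' < p * ε' := by linarith
      have h11 : p < p' + 2 := by exact_mod_cast lt_of_mul_lt_mul_right h9 hε'.le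
      have h12 : p' < p := by exact_mod_cast lt_of_mul_lt_mul_right h10 hε'.le
      obtain ⟨r, hr⟩ := hodd
      have : p' = 2 * r := by omega
      rw [this, Nat.coprime_mul_iff_left] at hcop
      exact absurd hcop.1 (by decide)
    · push_cast at *
      have e3 : ε' = 2 / 3 * ε := by linarith
      have hp5 : p = 3 := by
        rcases hp4 with h | h
        · exact h
        · linarith
      subst hp5
      push_cast at *
      subst e3
      have h9 := h4 (by rw [hdψ]; linarith)
      have hψ1 : pderiv 1 ψ ≠ 0 := by
        intro h; rw [h, map_zero, dg_zero] at h9; linarith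
      have w1 := W_ev hI hψ1
      have w2 : W u z0 = W u (ev u v ψ) := by
        have : z0 = ev u v ψ + z := by rw [hψ]; ring
        rw [this, W_add_eq (by linarith)]
      have w3 := W_le_add u z0
      have w4 := TM_eq hG0.J_ne (by linarith)
      exact four_thirds_false hε hu (by linarith) (by linarith) (by linarith) (by linarith)
        (by linarith) (by linarith) hM hG0

end TameStab

namespace TameStab
variable {k : Type} [Field k]

theorem ne_mul_of_lt {a b : ℝ} (ha : 0 < a) (h : a < b) (n : ℕ) : a ≠ n * b := by
  intro e
  rcases n with _ | n
  · simp at e; linarith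
  · push_cast at e
    nlinarith [(Nat.cast_nonneg n : (0:ℝ) ≤ n)]

theorem two_mul_le_of_eq_mul {a b : ℝ} (ha : 0 < a) (h : a ≠ b) (hb : 0 ≤ b) {n : ℕ}
    (e : a = n * b) : 2 * b ≤ a := by
  rcases n with _ | _ | n
  · simp at e; linarith
  · simp at e; exact (h e).elim
  · push_cast at e
    nlinarith [(Nat.cast_nonneg n : (0:ℝ) ≤ n)]

variable [CharZero k]

theorem RL.good_line_of_gt {d : ℝ} {u v z v' : Pol k} (H : Sd k d) (hd : dg u + dg v + dg z ≤ d)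
    (hR : RL u v z) (hD : Dist u v z) (hzu : dg z < dg u) (hvz : dg v < dg z)
    (hres : NonRes (dg u) (dg z)) (hA : v' - v ∈ A u z)
    (hle : dg v' ≤ dg v) : Good (V u v' z) := by
  have hJ := hR.J_ne
  have hI := Ind12 hJ
  have hIz := Ind13 hJ
  have hu0 := hI.dg_pos
  have hv0 := hI.symm.dg_pos
  obtain ⟨φ, hφ⟩ := mem_A.1 hA
  have hdφ : dg (ev u z φ) ≤ dg v := by
    rw [hφ]; exact (dg_sub_le _ _).trans (max_le hle le_rfl)
  rcases drop_lt_max hIz hres (φ := φ) (lt_max_of_lt_right (by linarith)) with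
    hN | ⟨p, ε, hε, hodd, hp3, hxy, h1, h2⟩
  · obtain ⟨P, hP⟩ := hN.exists_aeval hu0.le (by linarith)
    exact hR.good_of_eq_aeval H hd (hφ ▸ hP) hle
  have hp : 3 * ε ≤ p * ε := by
    have : (3:ℝ) ≤ p := by exact_mod_cast hp3
    nlinarith
  obtain ⟨hu, hz⟩ : dg u = p * ε ∧ dg z = 2 * ε := by
    rcases hxy with ⟨e1, e2⟩ | h
    · linarith
    · exact h
  have hΔ := hIz.W_pos
  obtain rfl : p = 3 := by
    have h3 : (p:ℝ) * ε < ((4:ℕ):ℝ) * ε := by push_cast; linarith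
    have : p < 4 := by exact_mod_cast lt_of_mul_lt_mul_right h3 hε.le
    omega
  push_cast at *
  have hlt := lt_of_ev_eq_sub hJ hφ (by linarith)
  obtain ⟨z0, hA0, hM⟩ := exists_minC u v z
  have hz0 : dg z0 < dg z := by
    obtain ⟨z1, hA1, hlt1, -⟩ := hR
    exact (hM.le_of hA0 hA1).trans_lt hlt1
  have hG0 : Good (V u v z0) := hR.good_of_sub H hd hA0
  by_cases huv : dg u = 2 * dg v
  · have hv : dg v = 3 / 2 * ε := by linarith
    obtain ⟨P, hP1, hP2⟩ := exists_min_aeval u hv0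
    obtain ⟨u1, hu1⟩ : ∃ u1, u1 = u + Polynomial.aeval v P := ⟨_, rfl⟩
    rw [← hu1] at hP1 hP2
    have hW : W v u1 = W u v := by rw [hu1, W_add_of_aeval, W_comm]
    have lo := W_le_add v u1
    have hi : dg u1 < dg u := by
      refine lt_of_le_of_ne (by simpa using hP2 0) fun e => hP1 2 (by norm_num) ?_
      rw [e, huv]; norm_num
    have hA1 : A u1 v = A u v := by rw [hu1, A_add_aeval]
    have hAu : u1 - u ∈ A v z := by
      rw [hu1, add_sub_cancel_left]; exact aeval_mem_left _ _ _
    have hG1 : Good (V u1 v z0) := H.mv1 (by linarith) hG0 (by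
      rw [hu1, add_sub_cancel_left]; exact aeval_mem_left _ _ _)
    have hres1 : NonRes (dg u1) (dg v) := by
      refine ⟨fun m e => ?_, fun m e => ?_⟩
      · rcases m with _ | m
        · simp at e; linarith
        · exact hP1 (m + 1) (by omega) e
      · have := two_mul_le_of_eq_mul hv0 (fun e => hP1 1 (by norm_num) (by rw [← e]; simp))
          (dg_nonneg _) e
        linarith
    obtain ⟨ψ, hψ⟩ := mem_A.1 (hA1.symm ▸ hA0)
    have hdψ : dg (ev u1 v ψ) = 2 * ε := by rw [hψ, dg_sub_of_lt hz0, hz]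
    have hN := noDrop_of_le_W (Ind12 hG1.J_ne) hres1 (φ := ψ) (by rw [hdψ, W_comm, hW]; linarith)
    obtain ⟨n, -, hn⟩ := hN.exists_eq (by rw [hdψ]; linarith)
    have hu1 : dg u1 = 2 * ε := by
      rw [hdψ, hv] at hn
      rcases h0 : n 0 with _ | _ | m <;> rw [h0] at hn <;> push_cast at hn
      · have := nat_eq_of_mul hε (3 * n 1) 4 (by push_cast; linarith)
        omega
      · rcases h1 : n 1 with _ | m <;> rw [h1] at hn <;> push_cast at hn
        · linarith
        · nlinarith [mul_nonneg (Nat.cast_nonneg m : (0:ℝ) ≤ m) hε.le]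
      · nlinarith [mul_nonneg (Nat.cast_nonneg m : (0:ℝ) ≤ m) (dg_nonneg u1),
          mul_nonneg (Nat.cast_nonneg (n 1) : (0:ℝ) ≤ (n 1)) hε.le]
    obtain ⟨a, b, c, e, hE⟩ := ev_quad (φ := ψ) fun n hn => by
      have := hN n hn
      rw [hdψ, hu1, hv] at this
      have h2 : ((4 * n 0 + 3 * n 1 : ℕ) : ℝ) * ε ≤ ((4 : ℕ) : ℝ) * ε := by push_cast; linarith
      have := Nat.cast_le.1 (le_of_mul_le_mul_right h2 hε)
      omega
    have ha : a = 0 := by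
      by_contra ha
      have h3 : dg (C a * v ^ 2) = 3 * ε := by rw [dg_C_mul ha, dg_pow, hv]; push_cast; ring
      have h4 : dg (C b * v + C c * u1) ≤ 2 * ε :=
        (dg_add_le _ _).trans (max_le ((dg_C_mul_le _ _).trans (by linarith))
          ((dg_C_mul_le _ _).trans hu1.le))
      rw [hE, dg_add_C, add_assoc, dg_add_eq (by linarith)] at hdψ
      linarith
    have hV : V u1 v z0 = V u1 v z := by
      refine V_congr3' (mem_L.2 ⟨c, b, e, ?_⟩)
      rw [← hψ, hE, ha]; simp; ring
    have hR' : RL z v u := ⟨u1, by rwa [A_swap], hi, by rwa [V_swap13, ← hV]⟩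
    rw [V_swap13]
    exact hR'.good_line_of_lt H (by linarith) ⟨hD.2.2.symm, hD.2.1.symm, hD.1.symm⟩ hzu
      (by linarith) hres.symm (ne_mul_of_lt hv0 hvz) (by rwa [A_swap]) hle
  · exfalso
    have hres' : NonRes (dg u) (dg v) := by
      refine (nonRes_of hv0 hD.1.symm (by linarith) fun m e => ?_).symm
      rcases m with _ | _ | _ | m <;> push_cast at e
      · linarith
      · linarith
      · exact huv (by linarith)
      · nlinarith [(Nat.cast_nonneg m : (0:ℝ) ≤ m)]
    obtain ⟨ψ, hψ⟩ := mem_A.1 hA0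
    have hdψ : dg (ev u v ψ) = 2 * ε := by rw [hψ, dg_sub_of_lt hz0, hz]
    have hN := noDrop_of_le_W hI hres' (φ := ψ) (by rw [hdψ]; linarith)
    obtain ⟨n, -, hn⟩ := hN.exists_eq (by rw [hdψ]; linarith)
    rw [hdψ, hu] at hn
    rcases h0 : n 0 with _ | m <;> rw [h0] at hn <;> push_cast at hn
    · rcases h1 : n 1 with _ | _ | m <;> rw [h1] at hn <;> push_cast at hn
      · linarith
      · exact hD.2.2 (by linarith)
      · nlinarith [mul_nonneg (Nat.cast_nonneg m : (0:ℝ) ≤ m) hv0.le]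
    · nlinarith [mul_nonneg (Nat.cast_nonneg m : (0:ℝ) ≤ m) hε.le,
        mul_nonneg (Nat.cast_nonneg (n 1) : (0:ℝ) ≤ (n 1)) hv0.le]

theorem RL.good_line_low {d : ℝ} {u v z v' : Pol k} (H : Sd k d) (hd : dg u + dg v + dg z ≤ d)
    (hR : RL u v z) (hD : Dist u v z) (hvz : dg v < dg z) (hA : v' - v ∈ A u z)
    (hle : dg v' ≤ dg v) : Good (V u v' z) := by
  have hJ := hR.J_ne
  have hI := Ind12 hJ
  have hu0 := hI.dg_pos
  have hv0 := hI.symm.dg_pos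
  have hz0 : 0 < dg z := hv0.trans hvz
  by_cases h1 : ∃ n : ℕ, dg z = n * dg u
  · obtain ⟨n, hn⟩ := h1
    obtain ⟨P, hP⟩ := exists_cancel_pow hn hz0
    exact hR.good_of_lower_thd H hd hP hA hle
  by_cases h2 : ∃ n : ℕ, dg v = n * dg u
  · obtain ⟨n, hn⟩ := h2
    obtain ⟨P, hP⟩ := exists_cancel_pow hn hv0
    exact hR.good_of_lower_snd H hd hP hA
  by_cases h3 : ∃ n : ℕ, dg u = n * dg z
  · obtain ⟨r, hr⟩ := h3
    have hzu := two_mul_le_of_eq_mul hu0 hD.2.1 hz0.le hr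
    obtain ⟨P, hP⟩ := exists_cancel_pow hr hu0
    have hG : Good (V (u + Polynomial.aeval z P) v z) := by
      by_cases h4 : ∃ n : ℕ, dg u = n * dg v
      · obtain ⟨q, hq⟩ := h4
        rw [V_rot]
        refine (hR.rotate_of_eq_mul H hd hu0 hq).good_of_sub H (by linarith) ?_
        rw [add_sub_cancel_left, A_swap]; exact aeval_mem_left _ _ _
      push Not at h4
      exfalso
      obtain ⟨p, ε, hε, -, -, hx, hy, l1, l2, l3⟩ := line_data H (by linarith) hR.swap
        (by linarith) (nonRes_of hv0 hD.1.symm (by linarith) h4) hD.swap12 (by linarith)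
        fun n e => h4 (r * n) (by rw [hr, e]; push_cast; ring)
      linarith [hI.symm.W_pos]
    have hG2 := H.mv2 (by linarith) hG (g' := v') (by rwa [A_add_aeval])
    refine H.mv1 (by linarith) hG2 ?_
    rw [sub_add_cancel_left]
    exact (A v' z).neg_mem (aeval_mem (right_mem_A _ _) _)
  push Not at h1 h2 h3
  rcases lt_or_gt_of_ne hD.2.1 with huz | huz
  · exact hR.good_line_of_lt H hd hD huz hvz ⟨h3, h1⟩ h2 hA hle
  · exact hR.good_line_of_gt H hd hD huz hvz ⟨h3, h1⟩ hA hle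

/-- Lines through the third direction. -/
theorem RL.good_line {d : ℝ} {u v z v' : Pol k} (H : Sd k d) (hd : dg u + dg v + dg z ≤ d)
    (hR : RL u v z) (hD : Dist u v z) (hA : v' - v ∈ A u z) (hle : dg v' ≤ dg v) :
    Good (V u v' z) := by
  rcases lt_or_gt_of_ne hD.2.2 with hzv | hzv
  · exact hR.good_line_low H hd hD hzv hA hle
  have hJ := hR.J_ne
  have hI := Ind12 hJ
  have hIz := Ind13 hJ
  have hu0 := hI.dg_pos
  have hv0 := hI.symm.dg_pos
  have hz0 : 0 < dg z := hIz.symm.dg_pos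
  by_cases h1 : ∃ n : ℕ, dg z = n * dg u
  · obtain ⟨n, hn⟩ := h1
    obtain ⟨P, hP⟩ := exists_cancel_pow hn hz0
    exact hR.good_of_lower_thd H hd hP hA hle
  by_cases h2 : ∃ n : ℕ, dg v = n * dg u
  · obtain ⟨n, hn⟩ := h2
    obtain ⟨P, hP⟩ := exists_cancel_pow hn hv0
    exact hR.good_of_lower_snd H hd hP hA
  by_cases h3 : ∃ n : ℕ, dg u = n * dg v
  · obtain ⟨r, hr⟩ := h3
    have hvu := two_mul_le_of_eq_mul hu0 hD.1 hv0.le hr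
    rw [V_swap13]
    exact (hR.rotate_of_eq_mul H hd hu0 hr).swap.good_line_low H (by linarith)
      ⟨hD.2.2.symm, hD.2.1.symm, hD.1.symm⟩ (by linarith) (by rwa [A_swap]) hle
  push Not at h1 h2 h3
  have hsame : v' - v ∈ L u z → Good (V u v' z) := fun h => by
    rw [V_congr2' h]; exact hR.good hD
  have hq : dg (v' - v) ≤ dg v := (dg_sub_le _ _).trans (max_le hle le_rfl)
  have hΔ := hI.W_pos
  rcases lt_or_gt_of_ne hD.1 with huv | huv
  · obtain ⟨p, ε, hε, hodd, hp3, hx, hy, l1, l2, -⟩ := line_data H hd hR huv ⟨h3, h2⟩ hD hzv h1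
    have hp : 3 * ε ≤ p * ε := by
      have : (3:ℝ) ≤ p := by exact_mod_cast hp3
      nlinarith
    obtain ⟨φ, hφ⟩ := mem_A.1 hA
    rw [← hφ] at hq
    have hN := noDrop_of_le_W hIz (nonRes_of hu0 hD.2.1 (by linarith) h1) (φ := φ) (by linarith)
    have hmon : ∀ n, coeff n φ ≠ 0 → n 0 * (2 * ε) + n 1 * dg z ≤ p * ε := fun n hn => by
      have := hN n hn
      rw [hx] at this; linarith
    by_cases hK : p = 3 ∧ dg z ≤ 3 / 2 * ε
    · obtain ⟨rfl, hz2⟩ := hK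
      push_cast at *
      obtain ⟨a, b, c, e, hE⟩ := ev_quad (φ := φ) fun n hn => by
        have := hmon n hn
        rcases h0 : n 0 with _ | _ | m <;> rcases h1 : n 1 with _ | _ | _ | l <;>
          rw [h0, h1] at this <;> push_cast at this <;>
          first
          | omega
          | (exfalso; linarith)
          | (exfalso; nlinarith [mul_nonneg (Nat.cast_nonneg l : (0:ℝ) ≤ l) hz0.le])
          | (exfalso; nlinarith [mul_nonneg (Nat.cast_nonneg m : (0:ℝ) ≤ m) hε.le])
      rw [hE] at hφ
      by_cases ha : a = 0
      · refine hsame (mem_L.2 ⟨c, b, e, ?_⟩)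
        rw [← hφ, ha]; simp; ring
      · obtain ⟨z1, hA1, hlt1, hG1⟩ := hR
        have hK : KData u v z z1 a ε :=
          ⟨hx, hy, by linarith, hz2, by linarith, hA1, hlt1, ha⟩
        have hV : V u v' z = V u (v + C a * z ^ 2) z := by
          refine V_congr2' (mem_L.2 ⟨c, b, e, ?_⟩)
          linear_combination -hφ
        rw [hV]
        exact Good.exc hK hG1
    · have hz2 : p * ε < 2 * dg z := by
        by_contra! hcon
        refine hK ⟨?_, ?_⟩
        · have h5 : (p:ℝ) * ε < ((4:ℕ):ℝ) * ε := by push_cast; linarith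
          have : p < 4 := by exact_mod_cast lt_of_mul_lt_mul_right h5 hε.le
          omega
        · have h5 : (p:ℝ) * ε < ((4:ℕ):ℝ) * ε := by push_cast; linarith
          have : p < 4 := by exact_mod_cast lt_of_mul_lt_mul_right h5 hε.le
          obtain rfl : p = 3 := by omega
          push_cast at *
          linarith
      obtain ⟨P, β, hE⟩ := ev_lin (φ := φ) fun n hn => by
        have := hmon n hn
        rcases h1 : n 1 with _ | _ | l
        · exact Or.inl rfl
        · right
          refine ⟨?_, rfl⟩
          rcases h0 : n 0 with _ | m
          · rfl
          · exfalso
            rw [h0, h1] at this; push_cast at this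
            nlinarith [mul_nonneg (Nat.cast_nonneg m : (0:ℝ) ≤ m) hε.le]
        · exfalso
          rw [h1] at this; push_cast at this
          nlinarith [mul_nonneg (Nat.cast_nonneg (n 0) : (0:ℝ) ≤ n 0) hε.le,
            mul_nonneg (Nat.cast_nonneg l : (0:ℝ) ≤ l) hz0.le]
      rw [hE] at hφ
      have h6 : v + Polynomial.aeval u P = v' - C β * z := by linear_combination hφ
      have h7 := hR.good_of_eq_aeval H hd (v' := v + Polynomial.aeval u P) (P := P) (by ring) (by
        rw [h6]
        refine (dg_sub_le _ _).trans (max_le hle ((dg_C_mul_le _ _).trans hzv.le)))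
      have hV : V u v' z = V u (v + Polynomial.aeval u P) z := by
        refine V_congr2' (mem_L.2 ⟨0, β, 0, ?_⟩)
        rw [h6]; simp
      rwa [hV]
  · obtain ⟨p, ε, hε, -, hp3, hx, hy, l1, l2, l3⟩ := line_data H (by linarith) hR.swap huv
      ⟨h2, h3⟩ hD.swap12 (hzv.trans huv) (ne_mul_of_lt hz0 hzv)
    have hp : 3 * ε ≤ p * ε := by
      have : (3:ℝ) ≤ p := by exact_mod_cast hp3
      nlinarith
    have hΔ' := hI.symm.W_pos
    obtain ⟨Q, hQ⟩ := exists_aeval_of_SL (f := z) (g := u) hIz.symm (by rwa [A_swap])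
      (by rw [W_comm z u]; linarith)
    have hdeg : Q.natDegree ≤ 1 := by
      rw [hQ, dg_aeval hz0] at hq
      by_contra! h
      have : (2:ℝ) ≤ Q.natDegree := by exact_mod_cast h
      nlinarith
    obtain ⟨a, b, hab⟩ := aeval_of_natDegree_le_one hdeg
    exact hsame (mem_L.2 ⟨0, a, b, by rw [hQ, hab]; simp⟩)

end TameStab

namespace TameStab
variable {k : Type} [Field k]

theorem ev_mem_L {φ : MvPolynomial (Fin 2) k} (h : ∀ n, coeff n φ ≠ 0 → n 0 + n 1 ≤ 1)
    (f g : Pol k) : ev f g φ ∈ L f g := by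
  rw [φ.as_sum, map_sum]
  refine Submodule.sum_mem _ fun n hn => ?_
  have := h n (mem_support_iff.1 hn)
  rw [ev_monomial]
  rcases h0 : n 0 with _ | _ | a <;> rcases h1 : n 1 with _ | _ | b <;> try omega
  · simpa using C_mem_L _ _ _
  · simpa using C_mul_mem _ (right_mem_L f g)
  · simpa using C_mul_mem _ (left_mem_L f g)

theorem L_congr_left {u v : Pol k} (t : k) : L (v + C t * u) u = L v u := by
  rw [L_swap, L_swap v, L_congr2 (f := u) (g := v) one_ne_zero (a := t) (b := 0) (by simp)]

theorem RL.congr_L {x y x' y' z : Pol k} (h : L x y = L x' y') (hR : RL x y z) : RL x' y' z := by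
  obtain ⟨z0, hA, hlt, hG⟩ := hR
  exact ⟨z0, by rwa [← A_congr_L h], hlt, by rwa [← V_congr_L h]⟩

theorem V_C_mul {u v z : Pol k} {t : k} (ht : t ≠ 0) : V u v (C t * z) = V u v z :=
  V_congr3 ht (by rw [sub_self]; exact zero_mem _)

theorem RL.C_mul {x y z : Pol k} {t : k} (ht : t ≠ 0) (hR : RL x y z) : RL x y (C t * z) := by
  obtain ⟨z0, hA, hlt, hG⟩ := hR
  refine ⟨C t * z0, ?_, ?_, by rwa [V_C_mul ht]⟩
  · rw [← mul_sub]; exact C_mul_mem_A t hA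
  · rwa [dg_C_mul ht, dg_C_mul ht]

variable [CharZero k]

theorem RL.good_pair_C_mul {d : ℝ} {u v z c' : Pol k} {t : k} (H : Sd k d)
    (hd : dg u + dg v + dg z ≤ d) (hR : RL u v z) (hD : Dist u v z) (ht : t ≠ 0)
    (hzv : dg z < dg v) (hA : c' - z ∈ A u (v + C t * z)) (hle : dg c' ≤ dg z) :
    Good (V u (v + C t * z) c') := by
  have e := dg_C_mul ht z
  have := (hR.C_mul ht).good_pair H (by rwa [e]) (by rwa [Dist, e]) (by rwa [e])
    (z' := C t * c') (by rw [← mul_sub]; exact C_mul_mem_A t hA) (by rwa [e, dg_C_mul ht])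
  rwa [V_C_mul ht] at this

theorem RL.good_pair_of_lt {d : ℝ} {x y z c' : Pol k} {s t : k} (H : Sd k d)
    (hd : dg x + dg y + dg z ≤ d) (hR : RL x y z) (hD : Dist x y z) (hs : s ≠ 0)
    (hzx : dg z < dg x) (hxy : dg x < dg y) (hA : c' - z ∈ A (x + C s * z) (y + C t * z))
    (hle : dg c' ≤ dg z) : Good (V (x + C s * z) (y + C t * z) c') := by
  obtain ⟨u, hu⟩ : ∃ u, u = y + C (-(t / s)) * x := ⟨_, rfl⟩
  have hdu : dg u = dg y := by rw [hu, dg_add_eq ((dg_C_mul_le _ _).trans_lt hxy)]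
  have hL : L u x = L x y := by rw [hu, L_congr_left, L_swap]
  have hL2 : L (x + C s * z) (y + C t * z) = L u (x + C s * z) := by
    rw [L_swap u, L_congr2 (f := x + C s * z) (g := u) one_ne_zero (a := t / s) (b := 0)]
    rw [hu]
    have : C t = (C (t / s) * C s : Pol k) := by rw [← MvPolynomial.C_mul, div_mul_cancel₀ _ hs]
    rw [this]; simp; ring
  rw [V_congr_L hL2]
  rw [A_congr_L hL2] at hA
  exact (hR.congr_L hL.symm).good_pair_C_mul H (by linarith)
    ⟨by rw [hdu]; exact hD.1.symm, by rw [hdu]; exact hD.2.2, hD.2.1⟩ hs hzx hA hle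

theorem RL.lineOK_self {d : ℝ} {x y z : Pol k} (H : Sd k d) (hd : dg x + dg y + dg z ≤ d)
    (hR : RL x y z) (hD : Dist x y z) : LineOK x y z := by
  intro s t c' hs ht hA hle
  by_cases hs0 : s = 0
  · subst hs0
    rw [C_0, zero_mul, add_zero] at *
    by_cases ht0 : t = 0
    · subst ht0
      rw [C_0, zero_mul, add_zero] at *
      exact hR.good_of_sub H hd hA
    · exact hR.good_pair_C_mul H hd hD ht0 (ht.resolve_left ht0) hA hle
  by_cases ht0 : t = 0
  · subst ht0
    rw [C_0, zero_mul, add_zero] at *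
    rw [V_swap12]
    exact hR.swap.good_pair_C_mul H (by linarith) hD.swap12 hs0 (hs.resolve_left hs0)
      (by rwa [A_swap]) hle
  rcases lt_or_gt_of_ne hD.1 with h | h
  · exact hR.good_pair_of_lt H hd hD hs0 (hs.resolve_left hs0) h hA hle
  · rw [V_swap12]
    exact hR.swap.good_pair_of_lt H (by linarith) hD.swap12 ht0 (ht.resolve_left ht0) h
      (by rwa [A_swap]) hle

theorem RL.lineOK {d : ℝ} {x y z : Pol k} (H : Sd k d) (hd : dg x + dg y + dg z ≤ d)
    (hR : RL x y z) (hD : Dist x y z) : LineOK x z y := by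
  intro s t c' hs ht hA hle
  have hL : L (x + C s * y) y = L x y := L_congr_left _
  have hlow : ∀ {f : Pol k} {r : k}, r = 0 ∨ dg y < dg f → dg (f + C r * y) = dg f := by
    rintro f r (rfl | h)
    · simp
    · exact dg_add_eq ((dg_C_mul_le _ _).trans_lt h)
  have e1 := hlow hs
  have e2 := hlow ht
  have hR' : RL (x + C s * y) y (z + C t * y) := by
    obtain ⟨z0, hA0, hlt, hG⟩ := hR
    refine ⟨z0 + C t * y, ?_, ?_, ?_⟩
    · rw [add_sub_add_right_eq_sub, A_congr_L hL]; exact hA0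
    · rw [e2]
      rcases ht with rfl | h
      · simpa using hlt
      · exact (dg_add_le _ _).trans_lt (max_lt hlt ((dg_C_mul_le _ _).trans_lt h))
    · rw [V_congr_L hL, V_congr3' (h := z0) (mem_L.2 ⟨0, t, 0, by simp⟩)]
      exact hG
  rw [V_swap23]
  exact hR'.good_line H (by rw [e1, e2]; exact hd) ⟨by rw [e1]; exact hD.1, by
    rw [e1, e2]; exact hD.2.1, by rw [e2]; exact hD.2.2⟩ hA hle

omit [CharZero k] in
theorem V_shear (a b c : Pol k) (s t : k) : V (a + C s * c) (b + C t * c) c = V a b c := by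
  rw [V_congr1' (f := a) (mem_L.2 ⟨0, s, 0, by simp⟩),
    V_congr2' (g := b) (mem_L.2 ⟨0, t, 0, by simp⟩)]

set_option maxHeartbeats 800000 in
theorem base_lineOK {a b c : Pol k} (hV : V a b c = V (X 0) (X 1) (X 2)) (hab : dg a ≠ dg b)
    (ha : 1 ≤ dg a) (hb : 1 ≤ dg b) (hc : dg c < 2) : LineOK a b c := by
  intro s t c' hs ht hA hle
  have hlow : ∀ {f : Pol k} {r : k}, r = 0 ∨ dg c < dg f → dg (f + C r * c) = dg f := by
    rintro f r (rfl | h)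
    · simp
    · exact dg_add_eq ((dg_C_mul_le _ _).trans_lt h)
  have e1 := hlow hs
  have e2 := hlow ht
  have hV' := V_shear a b c s t
  obtain ⟨f, hf⟩ : ∃ f, f = a + C s * c := ⟨_, rfl⟩
  obtain ⟨g, hg⟩ : ∃ g, g = b + C t * c := ⟨_, rfl⟩
  rw [← hf, ← hg] at hV' hA ⊢
  rw [← hf] at e1
  rw [← hg] at e2
  have hGc : Good (V f g c) := by rw [hV', hV]; exact Good.base
  have hinc := base_incommensurable (a := f) (b := g) (by rw [← hV, ← hV']; exact fst_mem_V _ _ _)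
    (by rw [← hV, ← hV']; exact snd_mem_V _ _ _) (by linarith) (by linarith) (by rwa [e1, e2])
  obtain ⟨φ, hφ⟩ := mem_A.1 hA
  have hq : dg (ev f g φ) < 2 := by
    rw [hφ]; exact ((dg_sub_le _ _).trans (max_le hle le_rfl)).trans_lt hc
  have hres : NonRes (dg f) (dg g) := by
    refine ⟨fun m => by simpa using hinc 1 m one_pos, fun m e => ?_⟩
    rcases m with _ | m
    · simp at e; linarith
    · exact hinc (m + 1) 1 (by omega) (by rw [e]; push_cast; ring)
  rcases parachute (Ind12 hGc.J_ne) hres φ with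
    hN | ⟨p, q, ε, hε, -, hp2, hq2, h1, h2, -⟩
  · rw [V_congr3' (h := c)]
    · exact hGc
    · rw [← hφ]
      refine ev_mem_L (fun n hn => ?_) _ _
      have h3 := hN n hn
      by_contra! h4
      have h5 : (2:ℝ) ≤ n 0 + n 1 := by exact_mod_cast h4
      have : (0:ℝ) ≤ n 0 * (dg f - 1) := mul_nonneg (Nat.cast_nonneg _) (by linarith)
      have : (0:ℝ) ≤ n 1 * (dg g - 1) := mul_nonneg (Nat.cast_nonneg _) (by linarith)
      linarith
  · exact (hinc p q (by omega) (by rw [h1, h2]; ring)).elim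

theorem KData.lineOK {x y z z1 : Pol k} {a : k} {δ : ℝ} (hK : KData x y z z1 a δ)
    (hG : Good (V x y z1)) : LineOK z x (y + C a * z ^ 2) ∧ LineOK z (y + C a * z ^ 2) x ∧
      LineOK x (y + C a * z ^ 2) z := by
  have hJ := hK.J_ne hG
  obtain ⟨hδ, e1, e2, e3, h4, h5, h6, hD⟩ := hK.spec hJ
  obtain ⟨hx, hy, h1, h2, hW, hA1, hlt1, ha⟩ := id hK
  have hG1 : Good (V x (y + C a * z ^ 2) z) := Good.exc hK hG
  obtain ⟨f, hf⟩ : ∃ f, f = y + C a * z ^ 2 := ⟨_, rfl⟩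
  rw [← hf] at e2 e3 h4 h5 h6 hG1 ⊢
  have hIz : Ind z f := Ind_of_W_pos (by linarith)
  refine ⟨?_, ?_, ?_⟩
  · intro s t c' hs ht hA hle
    obtain rfl : s = 0 := hs.resolve_right (by linarith)
    obtain rfl : t = 0 := ht.resolve_right (by linarith)
    simp only [C_0, zero_mul, add_zero] at hA ⊢
    rw [A_swap] at hA
    obtain ⟨φ, hφ⟩ := mem_A.1 hA
    have hq : dg (ev x z φ) ≤ 3 * δ := by
      rw [hφ]; exact (dg_sub_le _ _).trans (max_le (hle.trans h5) h5)
    have hres : NonRes (dg x) (dg z) := by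
      refine (nonRes_of (by linarith) (by linarith) (by linarith) fun m e => ?_).symm
      have := two_mul_le_of_eq_mul (by linarith) (by linarith) (by linarith) e
      linarith
    have hN := noDrop_of_le_W (Ind13 hJ) hres (φ := φ) (by linarith)
    obtain ⟨a', b, c, e, hE⟩ := ev_quad (φ := φ) fun n hn => by
      have := hN n hn
      rw [hx] at this
      rcases h0 : n 0 with _ | _ | m <;> rcases h1 : n 1 with _ | _ | _ | l <;>
        rw [h0, h1] at this <;> push_cast at this <;>
        first
        | omega
        | (exfalso; linarith)
        | (exfalso; nlinarith [mul_nonneg (Nat.cast_nonneg l : (0:ℝ) ≤ l) (dg_nonneg z)])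
        | (exfalso; nlinarith [mul_nonneg (Nat.cast_nonneg m : (0:ℝ) ≤ m) hδ.le])
    rw [hE] at hφ
    have hV : V z x c' = V x (y + C (a + a') * z ^ 2) z := by
      rw [V_rot]
      refine V_congr2' (mem_L.2 ⟨c, b, e, ?_⟩)
      rw [C_add]; linear_combination -hφ + hf
    rw [hV]
    by_cases h0 : a + a' = 0
    · rw [h0, C_0, zero_mul, add_zero]
      exact Good.red ⟨by linarith, by linarith, by linarith⟩ hA1 hlt1 hG
    · exact Good.exc ⟨hx, hy, h1, h2, hW, hA1, hlt1, h0⟩ hG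
  · intro s t c' hs ht hA hle
    obtain rfl : s = 0 := hs.resolve_right (by linarith)
    simp only [C_0, zero_mul, add_zero] at hA ⊢
    have hWt : W z (f + C t * x) = W z f :=
      W_add_eq ((W_C_mul_le _ _ _).trans_lt (by rw [W_comm z x]; linarith))
    have hq : dg (c' - x) ≤ 2 * δ := (dg_sub_le _ _).trans (max_le (hle.trans hx.le) hx.le)
    obtain ⟨Q, hQ⟩ := exists_aeval_of_SL (f := z) (g := f + C t * x)
      (Ind_of_W_pos (by linarith)) hA (by linarith)
    have hdeg : Q.natDegree ≤ 1 := by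
      rw [hQ, dg_aeval (by linarith)] at hq
      by_contra! h
      have : (2:ℝ) ≤ Q.natDegree := by exact_mod_cast h
      nlinarith
    obtain ⟨α, β, hab⟩ := aeval_of_natDegree_le_one hdeg
    rw [V_congr3' (h := x) (mem_L.2 ⟨α, 0, β, by rw [hQ, hab]; simp⟩)]
    rw [V_congr2' (g := f) (mem_L.2 ⟨0, t, 0, by simp⟩), V_swap13, V_swap12, V_swap12]
    exact hG1
  · intro s t c' hs ht hA hle
    have hWp : W x f ≤ W (x + C s * z) (f + C t * z) := W_pair (by linarith) (by linarith)
    have hdx : dg (x + C s * z) = dg x := dg_add_eq ((dg_C_mul_le _ _).trans_lt (by linarith))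
    have hq : dg (c' - z) ≤ dg z := (dg_sub_le _ _).trans (max_le hle le_rfl)
    obtain ⟨Q, hQ⟩ := exists_aeval_of_SL (f := x + C s * z) (g := f + C t * z)
      (Ind_of_W_pos (by linarith)) hA (by linarith)
    obtain ⟨c, hc⟩ := eq_C_of_dg_aeval_lt (f := x + C s * z) (P := Q) (by rw [← hQ]; linarith)
    rw [V_congr3' (h := z) (by rw [hQ, hc]; exact C_mem_L _ _ _), V_shear]
    exact hG1

/-- Goodness is invariant under elementary changes of coordinates. -/
theorem Good.step {f g h h' : Pol k} (hG : Good (V f g h)) (hA : h' - h ∈ A f g) :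
    Good (V f g h') := by
  suffices ∀ d, IsDeg d → ∀ f g h h' : Pol k, dg f + dg g + dg h = d → Good (V f g h) →
      h' - h ∈ A f g → Good (V f g h') from
    this _ (((isDeg_dg f).add (isDeg_dg g)).add (isDeg_dg h)) f g h h' rfl hG hA
  refine isDeg_induction fun d _ IH f g h h' hd hG hA => ?_
  have H : Sd k d := fun f g h h' hlt => IH _ hlt
    (((isDeg_dg f).add (isDeg_dg g)).add (isDeg_dg h)) f g h h' rfl
  obtain ⟨S, hS⟩ : ∃ S, S = V f g h := ⟨_, rfl⟩
  rw [← hS] at hG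
  cases hG with
  | base =>
    have s1 := one_lt_sqrt2
    have s2 := sqrt2_lt_sqrt3
    have s3 := sqrt3_lt_two
    have d0 := dg_X0 (k := k)
    have d1 := dg_X1 (k := k)
    have d2 := dg_X2 (k := k)
    refine step_reduce hS ⟨by linarith, by linarith, by linarith⟩ (hS ▸ Good.base) hA
      (base_lineOK rfl (by linarith) (by linarith) (by linarith) (by linarith))
      (base_lineOK (V_swap23 _ _ _) (by linarith) (by linarith) (by linarith) (by linarith))
      (base_lineOK (V_rot _ _ _).symm (by linarith) (by linarith) (by linarith) (by linarith))
  | @red x y z z1 hD hA1 hlt hG1 =>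
    have hR : RL x y z := ⟨z1, hA1, hlt, hG1⟩
    have hG0 := hR.good hD
    rw [hS] at hG0
    have hd' : dg x + dg y + dg z ≤ d := hd ▸ sum_le_of_V hS.symm hG0.J_ne hD
    exact step_reduce hS hD hG0 hA (hR.lineOK_self H hd' hD) (hR.lineOK H hd' hD)
      (hR.swap.lineOK H (by linarith) hD.swap12)
  | @exc x y z z1 a δ hK hG1 =>
    have hG0 := Good.exc hK hG1
    rw [hS] at hG0
    obtain ⟨o1, o2, o3⟩ := hK.lineOK hG1
    obtain ⟨hδ, -, -, -, -, h5, h6, -⟩ := hK.spec (hK.J_ne hG1)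
    have hx := hK.1
    have hz := hK.2.2.2.1
    refine step_reduce (x := z) (y := x) (z := y + C a * z ^ 2) ?_
      ⟨by linarith, by linarith, by linarith⟩ hG0 hA o1 o2 o3
    rw [← hS, V_rot]

end TameStab

namespace TameStab
variable {k : Type} [Field k]

theorem map_V (σ : Aut3 k) (f g h : Pol k) :
    (V f g h).map σ.toLinearMap = V (σ f) (σ g) (σ h) := by
  rw [V, V, Submodule.map_span]
  congr 1
  simp [Set.image_insert_eq]

theorem map_mem_A (σ : Aut3 k) {f g p : Pol k} (h : p ∈ A f g) : σ p ∈ A (σ f) (σ g) := by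
  obtain ⟨φ, rfl⟩ := mem_A.1 h
  refine mem_A.2 ⟨φ, ?_⟩
  have : ev (σ f) (σ g) = σ.toAlgHom.comp (ev f g) := by
    refine algHom_ext fun i => ?_
    fin_cases i <;> simp [ev]
  rw [this]; rfl

theorem mem_A_of_supported {i j : Fin 3} {P : Pol k} (h : P ∈ supported k ({i, j} : Set (Fin 3))) :
    P ∈ A (X i : Pol k) (X j) := by
  rw [supported_eq_adjoin_X] at h
  refine Algebra.adjoin_le ?_ h
  rintro _ ⟨l, rfl | rfl, rfl⟩
  · exact left_mem_A _ _
  · exact right_mem_A _ _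

/-- The affine span of the images of the coordinates. -/
noncomputable def im (σ : Aut3 k) : Submodule k (Pol k) := V (σ (X 0)) (σ (X 1)) (σ (X 2))

theorem im_mul (σ τ : Aut3 k) : im (σ * τ) = (im τ).map σ.toLinearMap := by
  rw [im, im, map_V]; rfl

theorem im_mul_of_eq (σ : Aut3 k) {τ : Aut3 k} (h : im τ = im 1) : im (σ * τ) = im σ := by
  rw [im_mul, h, ← im_mul, mul_one]

theorem im_inv_of_eq {τ : Aut3 k} (h : im τ = im 1) : im τ⁻¹ = im 1 := by
  rw [← im_mul_of_eq _ h, inv_mul_cancel]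

theorem im_affine {σ : Aut3 k} (h : IsAffine k σ) : im σ = im 1 := by
  obtain ⟨M, b, ⟨u, rfl⟩, hM⟩ := h
  have hX : ∀ i, X i ∈ im (1 : Aut3 k) := by
    intro i
    fin_cases i
    exacts [fst_mem_V _ _ _, snd_mem_V _ _ _, thd_mem_V _ _ _]
  have hσ : ∀ i, σ (X i) ∈ im σ := by
    intro i
    fin_cases i
    exacts [fst_mem_V _ _ _, snd_mem_V _ _ _, thd_mem_V _ _ _]
  have h1 : ∀ i, σ (X i) ∈ im (1 : Aut3 k) := fun i => by
    rw [hM]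
    exact add_mem (sum_mem fun j _ => C_mul_mem _ (hX j)) (C_mem_V _ _ _ _)
  have h2 : ∀ i, (X i : Pol k) ∈ im σ := fun i => by
    have e : (X i : Pol k) = ∑ j, C ((u⁻¹ : (Matrix (Fin 3) (Fin 3) k)ˣ).val i j) *
        (σ (X j) - C (b j)) := by
      have e1 : ∀ j l, C ((u⁻¹ : (Matrix (Fin 3) (Fin 3) k)ˣ).val i j) * (C (u.val j l) * X l) =
          (C ((u⁻¹ : (Matrix (Fin 3) (Fin 3) k)ˣ).val i j * u.val j l) * X l : Pol k) :=
        fun j l => by rw [C_mul, mul_assoc]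
      have e2 : ∀ l, ∑ j, (u⁻¹ : (Matrix (Fin 3) (Fin 3) k)ˣ).val i j * u.val j l =
          (1 : Matrix (Fin 3) (Fin 3) k) i l := fun l => by
        rw [← Matrix.mul_apply, ← Units.val_mul, inv_mul_cancel, Units.val_one]
      simp only [hM, add_sub_cancel_right, Finset.mul_sum, e1]
      rw [Finset.sum_comm]
      simp only [← Finset.sum_mul, ← map_sum, e2, Matrix.one_apply]
      simp
    rw [e]
    exact sum_mem fun j _ => C_mul_mem _ (sub_mem (hσ j) (C_mem_V _ _ _ _))
  exact le_antisymm (V_le (C_mem_V _ _ _) (h1 0) (h1 1) (h1 2))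
    (V_le (C_mem_V _ _ _) (h2 0) (h2 1) (h2 2))

theorem inv_elementary {ε : Aut3 k} {P : Pol k} (hP : P ∈ A (X 1 : Pol k) (X 2))
    (h0 : ε (X 0) = X 0 + P) (h1 : ε (X 1) = X 1) (h2 : ε (X 2) = X 2) :
    ε⁻¹ (X 0) = X 0 + -P ∧ ε⁻¹ (X 1) = X 1 ∧ ε⁻¹ (X 2) = X 2 := by
  have e1 : ε.symm (X 1) = X 1 := by rw [AlgEquiv.symm_apply_eq, h1]
  have e2 : ε.symm (X 2) = X 2 := by rw [AlgEquiv.symm_apply_eq, h2]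
  refine ⟨?_, e1, e2⟩
  change ε.symm (X 0) = _
  rw [AlgEquiv.symm_apply_eq, map_add, h0, map_neg]
  obtain ⟨φ, rfl⟩ := mem_A.1 hP
  have : ε (ev (X 1) (X 2) φ) = ev (X 1) (X 2) φ := by
    have : ε.toAlgHom.comp (ev (X 1) (X 2)) = ev (X 1 : Pol k) (X 2) := by
      refine algHom_ext fun i => ?_
      fin_cases i
      · simpa [ev] using h1
      · simpa [ev] using h2
    exact DFunLike.congr_fun this φ
  rw [this]; ring

theorem good_mul_elementary [CharZero k] {σ ε : Aut3 k} {P : Pol k} (hG : Good (im σ))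
    (hP : P ∈ A (X 1 : Pol k) (X 2)) (h0 : ε (X 0) = X 0 + P) (h1 : ε (X 1) = X 1)
    (h2 : ε (X 2) = X 2) : Good (im (σ * ε)) := by
  rw [im] at hG ⊢
  simp only [AlgEquiv.mul_apply, h0, h1, h2]
  rw [V_rot] at hG ⊢
  refine hG.step ?_
  rw [map_add, add_sub_cancel_left]
  exact map_mem_A σ hP

theorem Good.of_tame [CharZero k] {σ : Aut3 k} (h : σ ∈ Tame k) : Good (im σ) := by
  unfold Tame at h
  induction h using Subgroup.closure_induction_right with
  | one => exact Good.base
  | mul_right x _ y hy ih =>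
    rcases hy with hy | ⟨P, hP, h0, h1, h2⟩
    · rwa [im_mul_of_eq _ (im_affine hy)]
    · exact good_mul_elementary ih (mem_A_of_supported hP) h0 h1 h2
  | mul_inv_cancel x _ y hy ih =>
    rcases hy with hy | ⟨P, hP, h0, h1, h2⟩
    · rwa [im_mul_of_eq _ (im_inv_of_eq (im_affine hy))]
    · have hP := mem_A_of_supported hP
      obtain ⟨e0, e1, e2⟩ := inv_elementary hP h0 h1 h2
      exact good_mul_elementary ih (neg_mem hP) e0 e1 e2

end TameStab

namespace TameStab
variable {k : Type} [Field k]

theorem aeval_eq_self_of_supported {s : Set (Fin 3)} {P : Pol k} (hP : P ∈ supported k s)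
    {F : Fin 3 → Pol k} (hF : ∀ i ∈ s, F i = X i) : aeval F P = P := by
  obtain ⟨Q, rfl⟩ : ∃ Q, rename ((↑) : s → Fin 3) Q = P := by
    rw [supported_eq_range_rename] at hP
    exact hP
  have h : F ∘ ((↑) : s → Fin 3) = X ∘ ((↑) : s → Fin 3) := funext fun i => hF _ i.2
  rw [aeval_rename, h, ← aeval_rename, aeval_X_left, AlgHom.id_apply]

/-- The automorphism sending `X i` to `X i + P` and fixing the other variables. -/
noncomputable def shear (i : Fin 3) (P : Pol k) (hP : P ∈ supported k ({i}ᶜ : Set (Fin 3))) :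
    Aut3 k :=
  AlgEquiv.ofAlgHom (aeval (Function.update X i (X i + P))) (aeval (Function.update X i (X i - P)))
    (algHom_ext fun j => by
      by_cases h : j = i
      · subst h
        have e := aeval_eq_self_of_supported hP (F := Function.update X j (X j + P))
          fun l hl => Function.update_of_ne hl _ _
        simp only [AlgHom.comp_apply, aeval_X, Function.update_self, map_sub, e,
          AlgHom.id_apply]
        ring
      · simp [h])
    (algHom_ext fun j => by
      by_cases h : j = i
      · subst h
        have e := aeval_eq_self_of_supported hP (F := Function.update X j (X j - P))
          fun l hl => Function.update_of_ne hl _ _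
        simp only [AlgHom.comp_apply, aeval_X, Function.update_self, map_add, e,
          AlgHom.id_apply]
        ring
      · simp [h])

theorem shear_self {i : Fin 3} {P : Pol k} (hP : P ∈ supported k ({i}ᶜ : Set (Fin 3))) :
    shear i P hP (X i) = X i + P := by
  simp [shear]

theorem shear_of_ne {i j : Fin 3} {P : Pol k} (hP : P ∈ supported k ({i}ᶜ : Set (Fin 3)))
    (h : j ≠ i) : shear i P hP (X j) = X j := by
  simp [shear, h]

theorem map_C (σ : Aut3 k) (c : k) : σ (C c) = C c := σ.commutes c

/-- The linear automorphism acting on `X 0`, `X 1` by an invertible matrix. -/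
noncomputable def lin (a b c d : k) (h : a * d - b * c ≠ 0) : Aut3 k :=
  have h1 : (C a * C d - C b * C c) * C (a * d - b * c)⁻¹ = (1 : Pol k) := by
    rw [← C_mul, ← C_mul, ← C_sub, ← C_mul, mul_inv_cancel₀ h, C_1]
  AlgEquiv.ofAlgHom (aeval ![C a * X 0 + C b * X 1, C c * X 0 + C d * X 1, X 2])
    (aeval ![C (a * d - b * c)⁻¹ * (C d * X 0 - C b * X 1),
      C (a * d - b * c)⁻¹ * (C a * X 1 - C c * X 0), X 2])
    (algHom_ext fun j => by
      fin_cases j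
      · simp only [AlgHom.comp_apply, aeval_X, map_mul, map_sub, algHom_C, Fin.zero_eta,
          Matrix.cons_val_zero, Matrix.cons_val_one, AlgHom.id_apply, algebraMap_eq]
        linear_combination X 0 * h1
      · simp only [AlgHom.comp_apply, aeval_X, map_mul, map_sub, algHom_C, Fin.mk_one,
          Matrix.cons_val_zero, Matrix.cons_val_one, AlgHom.id_apply, algebraMap_eq]
        linear_combination X 1 * h1
      · simp)
    (algHom_ext fun j => by
      fin_cases j
      · simp only [AlgHom.comp_apply, aeval_X, map_mul, map_add, algHom_C, Fin.zero_eta,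
          Matrix.cons_val_zero, Matrix.cons_val_one, AlgHom.id_apply, algebraMap_eq]
        linear_combination X 0 * h1
      · simp only [AlgHom.comp_apply, aeval_X, map_mul, map_add, algHom_C, Fin.mk_one,
          Matrix.cons_val_zero, Matrix.cons_val_one, AlgHom.id_apply, algebraMap_eq]
        linear_combination X 1 * h1
      · simp)

theorem lin_X {a b c d : k} (h : a * d - b * c ≠ 0) :
    lin a b c d h (X 0) = C a * X 0 + C b * X 1 ∧ lin a b c d h (X 1) = C c * X 0 + C d * X 1 ∧
      lin a b c d h (X 2) = X 2 := by
  simp [lin]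

theorem memK2_lin {a b c d : k} (h : a * d - b * c ≠ 0) : MemK2 k (lin a b c d h) := by
  obtain ⟨h0, h1, h2⟩ := lin_X h
  exact ⟨a, b, c, d, 1, 0, 0, 0, h, one_ne_zero, zero_mem _, zero_mem _, by simpa using h0,
    by simpa using h1, by simpa using h2⟩

theorem supported_of_mem_A {i j : Fin 3} {s : Set (Fin 3)} {P : Pol k}
    (h : P ∈ A (X i : Pol k) (X j)) (hi : i ∈ s) (hj : j ∈ s) : P ∈ supported k s :=
  A_le (X_mem_supported.2 hi) (X_mem_supported.2 hj) h

theorem memH1_shear {P : Pol k} (hP : P ∈ supported k ({1}ᶜ : Set (Fin 3)))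
    (h : P ∈ supported k ({0, 2} : Set (Fin 3))) : MemH1 k (shear 1 P hP) := by
  refine ⟨1, 1, 1, 0, 0, P, one_ne_zero, one_ne_zero, one_ne_zero, zero_mem _, h, ?_, ?_, ?_⟩
  · simpa using shear_of_ne hP (by decide)
  · simpa using shear_self hP
  · simpa using shear_of_ne hP (by decide)

theorem exists_map_eq_of_mem_A (σ : Aut3 k) {f g p : Pol k} (h : p ∈ A (σ f) (σ g)) :
    ∃ q ∈ A f g, σ q = p := by
  refine ⟨σ.symm p, ?_, by simp⟩
  simpa using map_mem_A σ.symm h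

theorem IsDeg.one_le {d : ℝ} (h : IsDeg d) (hf : 0 < d) : 1 ≤ d := by
  obtain ⟨n, rfl⟩ := h
  have h2 : (1:ℝ) ≤ √2 := one_lt_sqrt2.le
  have h3 : (1:ℝ) ≤ √3 := (one_lt_sqrt2.trans sqrt2_lt_sqrt3).le
  have : (1:ℝ) ≤ n 0 + n 1 + n 2 := by
    have : n 0 + n 1 + n 2 ≠ 0 := fun h => by
      have : n = 0 := by ext i; fin_cases i <;> simp <;> omega
      rw [this, wt_zero] at hf
      exact lt_irrefl _ hf
    exact_mod_cast Nat.one_le_iff_ne_zero.2 this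
  unfold wt
  nlinarith [mul_nonneg (Nat.cast_nonneg (n 0) : (0:ℝ) ≤ n 0) (sub_nonneg.2 h2),
    mul_nonneg (Nat.cast_nonneg (n 1) : (0:ℝ) ≤ n 1) (sub_nonneg.2 h3)]

theorem isDeg_of_two_three {δ : ℝ} (h2 : IsDeg (2 * δ)) (h3 : IsDeg (3 * δ)) : IsDeg δ := by
  obtain ⟨n, hn⟩ := h2
  obtain ⟨m, hm⟩ := h3
  have h : 3 • n = 2 • m := wt_injective (by
    simp only [succ_nsmul, zero_nsmul, zero_add, wt_add]; linarith)
  have hi : ∀ i, 3 * n i = 2 * m i := fun i => by simpa using DFunLike.congr_fun h i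
  refine ⟨m - n, ?_⟩
  have : wt (m - n) + wt n = wt m := by
    rw [← wt_add]; congr 1; ext i
    have := hi i
    simp; omega
  linarith

theorem exists_descent {G : Subgroup (Aut3 k)} (hG1 : ∀ σ, MemH1 k σ → σ ∈ G)
    (hG2 : ∀ σ, MemK2 k σ → σ ∈ G) {τ : Aut3 k} {f g h h' : Pol k} (hτ : im τ = V f g h)
    (hJ : J f g h ≠ 0) {a e : k} (ha : a ≠ 0) (hf : τ (X 2) = C a * f + C e)
    (hA : h' - h ∈ A f g) :
    ∃ κ ∈ G, (τ * κ) (X 2) = τ (X 2) ∧ im (τ * κ) = V f g h' := by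
  have hL : L f g = L (τ (X 2)) g := by
    rw [L_swap f, L_swap _ g]
    exact (L_congr2 ha (a := 0) (b := e) (by rw [hf]; simp)).symm
  rw [V_congr_L hL] at hτ
  rw [A_congr_L hL] at hA
  rw [V_congr_L hL]
  have hJ' := J_ne_of_V (V_congr_L hL) hJ
  obtain ⟨p, q, r, s, hg⟩ := mem_V.1 (show g ∈ V (τ (X 0)) (τ (X 1)) (τ (X 2)) by
    rw [← im, hτ]; exact snd_mem_V _ _ _)
  obtain ⟨p', q', r', s', hh⟩ := mem_V.1 (show h ∈ V (τ (X 0)) (τ (X 1)) (τ (X 2)) by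
    rw [← im, hτ]; exact thd_mem_V _ _ _)
  have hdet : p * q' - q * p' ≠ 0 := by
    have := J_comb (a := τ (X 2)) (a1 := 0) (a2 := 0) (a3 := 1) (a4 := 0) (by simp) hg hh
    rw [this] at hJ'
    have := left_ne_zero_of_mul hJ'
    rintro h0
    apply this
    rw [← C_0]; congr 1
    linear_combination h0
  obtain ⟨l0, l1, l2⟩ := lin_X hdet
  obtain ⟨κ, hκ⟩ : ∃ κ, κ = lin p q p' q' hdet := ⟨_, rfl⟩
  rw [← hκ] at l0 l1 l2
  have e0 : (τ * κ) (X 0) = C p * τ (X 0) + C q * τ (X 1) := by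
    rw [AlgEquiv.mul_apply, l0, map_add, map_mul, map_mul, map_C, map_C]
  have e1 : (τ * κ) (X 1) = C p' * τ (X 0) + C q' * τ (X 1) := by
    rw [AlgEquiv.mul_apply, l1, map_add, map_mul, map_mul, map_C, map_C]
  have e2 : (τ * κ) (X 2) = τ (X 2) := by rw [AlgEquiv.mul_apply, l2]
  have hL2 : L (τ (X 2)) g = L ((τ * κ) (X 2)) ((τ * κ) (X 0)) := by
    rw [e2, L_congr2 (κ := 1) (g := (τ * κ) (X 0)) one_ne_zero (a := r) (b := s)]
    rw [hg, e0, C_1]; ring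
  have hA' := hA
  rw [A_congr_L hL2] at hA
  obtain ⟨Q, hQ, hQe⟩ := exists_map_eq_of_mem_A _ hA
  have hQ1 : Q ∈ supported k ({1}ᶜ : Set (Fin 3)) := supported_of_mem_A hQ (by decide) (by decide)
  refine ⟨κ * shear 1 Q hQ1, mul_mem (hG2 _ (hκ ▸ memK2_lin hdet)) (hG1 _ (memH1_shear hQ1
    (supported_of_mem_A hQ (by decide) (by decide)))), ?_, ?_⟩
  · rw [← mul_assoc, AlgEquiv.mul_apply, shear_of_ne hQ1 (by decide), e2]
  · have f0 : (τ * κ * shear 1 Q hQ1) (X 0) = (τ * κ) (X 0) := by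
      rw [AlgEquiv.mul_apply, shear_of_ne hQ1 (by decide)]
    have f1 : (τ * κ * shear 1 Q hQ1) (X 1) = (τ * κ) (X 1) + (h' - h) := by
      rw [AlgEquiv.mul_apply, shear_self, map_add, hQe]
    have f2 : (τ * κ * shear 1 Q hQ1) (X 2) = (τ * κ) (X 2) := by
      rw [AlgEquiv.mul_apply, shear_of_ne hQ1 (by decide)]
    rw [im, ← mul_assoc, f0, f1, f2, ← V_rot, ← V_congr_L hL2, e1]
    refine V_congr3' (mem_L.2 ⟨-r', 0, -s', ?_⟩)
    rw [hh]; simp; ring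

theorem mem_of_good [CharZero k] {G : Subgroup (Aut3 k)} (hG1 : ∀ σ, MemH1 k σ → σ ∈ G)
    (hG2 : ∀ σ, MemK2 k σ → σ ∈ G) {S : Submodule k (Pol k)} (hS : Good S) {τ : Aut3 k} {α β : k}
    (hα : α ≠ 0) (h2 : τ (X 2) = C α * X 2 + C β) (hτ : im τ = S) : τ ∈ G := by
  have dg2 : dg (τ (X 2)) = 1 := by rw [h2, dg_add_C, dg_C_mul hα, dg_X2]
  induction hS generalizing τ with
  | base =>
    obtain ⟨a, b, r, s, h0⟩ := mem_V.1 (hτ ▸ fst_mem_V _ _ _ : τ (X 0) ∈ V (X 0) (X 1) (X 2))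
    obtain ⟨c, d, r', s', h1⟩ := mem_V.1 (hτ ▸ snd_mem_V _ _ _ : τ (X 1) ∈ V (X 0) (X 1) (X 2))
    have hX : ∀ r s : k, C r * X 2 + C s ∈ supported k ({2} : Set (Fin 3)) := fun r s =>
      add_mem (C_mul_mem_A r (X_mem_supported.2 rfl)) (Subalgebra.algebraMap_mem _ s)
    refine hG2 _ ⟨a, b, c, d, α, β, C r * X 2 + C s, C r' * X 2 + C s', ?_, hα, hX _ _, hX _ _,
      by rw [h0]; ring, by rw [h1]; ring, h2⟩
    have hJ : J (τ (X 0)) (τ (X 1)) (τ (X 2)) ≠ 0 :=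
      J_ne_of_V (show V (X 0) (X 1) (X 2) = _ from hτ.symm) Good.base.J_ne
    rw [J_comb h0 h1 (c := τ (X 2)) (c1 := 0) (c2 := 0) (c3 := α) (c4 := β) (by rw [h2]; simp)]
      at hJ
    have := left_ne_zero_of_mul hJ
    intro h
    apply this
    rw [← C_0]; congr 1
    linear_combination α * h
  | @red f g h h' hD hA hlt hG' ih =>
    have hG : Good (V f g h) := Good.red hD hA hlt hG'
    have hJ := hG.J_ne
    obtain ⟨a, b, c, e, he⟩ := mem_V.1 (hτ ▸ thd_mem_V _ _ _ : τ (X 2) ∈ V f g h)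
    obtain ⟨ha, hb, hc⟩ := le_dg_comb hD a b c e
    rw [← he, dg2] at ha hb hc
    have h1' := (isDeg_dg h').one_le (Ind_of_J hG'.J_ne).symm.dg_pos
    have hf1 := (isDeg_dg f).one_le (Ind12 hJ).dg_pos
    have hg1 := (isDeg_dg g).one_le (Ind_of_J hJ).dg_pos
    obtain rfl : c = 0 := by
      by_contra h
      linarith [hc h]
    have key : ∃ κ ∈ G, (τ * κ) (X 2) = τ (X 2) ∧ im (τ * κ) = V f g h' := by
      by_cases ha0 : a = 0
      · subst ha0
        have hb0 : b ≠ 0 := by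
          rintro rfl
          simp [he, dg_C] at dg2
        rw [V_swap12] at hτ ⊢
        exact exists_descent hG1 hG2 hτ (J_ne12 hJ) hb0 (e := e) (by rw [he]; simp)
          (by rwa [A_swap])
      · obtain rfl : b = 0 := by
          by_contra h
          exact hD.1 (by linarith [ha ha0, hb h])
        exact exists_descent hG1 hG2 hτ hJ ha0 (e := e) (by rw [he]; simp) hA
    obtain ⟨κ, hκ, e2, e3⟩ := key
    have := ih (e2.trans h2) e3 (by rw [e2, dg2])
    simpa using mul_mem this (inv_mem hκ)
  | @exc x y z z1 a δ hK hG' ih =>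
    exfalso
    have hJ := hK.J_ne hG'
    obtain ⟨hδ, -, -, -, -, -, h6, -⟩ := hK.spec hJ
    obtain ⟨hx, hy, hz, hz2, -⟩ := id hK
    have hD : Dist x (y + C a * z ^ 2) z := ⟨by linarith, by linarith, by linarith⟩
    obtain ⟨p, q, c, e, he⟩ := mem_V.1 (hτ ▸ thd_mem_V _ _ _ : τ (X 2) ∈ V x (y + C a * z ^ 2) z)
    obtain ⟨hp, hq, hc⟩ := le_dg_comb hD p q c e
    rw [← he, dg2] at hp hq hc
    have hz1 := (isDeg_dg z).one_le (Ind13 hJ).symm.dg_pos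
    obtain rfl : p = 0 := by
      by_contra h
      linarith [hp h]
    obtain rfl : q = 0 := by
      by_contra h
      linarith [hq h]
    have hc0 : c ≠ 0 := by
      rintro rfl
      simp [he, dg_C] at dg2
    have := hc hc0
    have := IsDeg.one_le (isDeg_of_two_three (hx ▸ isDeg_dg x) (hy ▸ isDeg_dg y)) hδ
    linarith

end TameStab

namespace TameStab

section Amalgam
variable {G : Type*} [Group G] (A B : Subgroup G)

/-- The canonical homomorphism from the amalgamated product, on Mathlib's pushout. -/
noncomputable def pushoutHom : Monoid.PushoutI (amalgIncl A B) →* G :=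
  Monoid.PushoutI.lift
    (fun i => by cases i; exacts [B.subtype, A.subtype])
    (A ⊓ B).subtype
    (by intro i; cases i <;> rfl)

theorem pushoutHom_of_true (a : amalgFam A B true) :
    pushoutHom A B (Monoid.PushoutI.of true a) = A.subtype a :=
  Monoid.PushoutI.lift_of (φ := amalgIncl A B) _ _ _ a

theorem pushoutHom_of_false (b : amalgFam A B false) :
    pushoutHom A B (Monoid.PushoutI.of false b) = B.subtype b :=
  Monoid.PushoutI.lift_of (φ := amalgIncl A B) _ _ _ b

theorem pushoutHom_base (c : ↥(A ⊓ B)) :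
    pushoutHom A B (Monoid.PushoutI.base (amalgIncl A B) c) = c :=
  Monoid.PushoutI.lift_base (φ := amalgIncl A B) _ _ _ c

theorem range_amalgToGroup : (amalgToGroup A B).range = A ⊔ B := by
  apply le_antisymm
  · rintro _ ⟨w, rfl⟩
    change pushoutHom A B w ∈ A ⊔ B
    induction w using Monoid.PushoutI.induction_on with
    | of i g =>
      cases i
      · rw [pushoutHom_of_false]; exact Subgroup.mem_sup_right (Subtype.prop (p := (· ∈ B)) g)
      · rw [pushoutHom_of_true]; exact Subgroup.mem_sup_left (Subtype.prop (p := (· ∈ A)) g)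
    | base h => rw [pushoutHom_base]; exact Subgroup.mem_sup_left h.2.1
    | mul x y hx hy => rw [map_mul]; exact mul_mem hx hy
  · exact sup_le (fun a ha => ⟨_, pushoutHom_of_true A B ⟨a, ha⟩⟩)
      fun b hb => ⟨_, pushoutHom_of_false A B ⟨b, hb⟩⟩

end Amalgam

variable {k : Type} [Field k]

theorem lin_mem_tame {a b c d : k} (h : a * d - b * c ≠ 0) : lin a b c d h ∈ Tame k := by
  obtain ⟨h0, h1, h2⟩ := lin_X h
  refine Subgroup.subset_closure (Or.inl ⟨!![a, b, 0; c, d, 0; 0, 0, 1], 0, ?_, fun i => ?_⟩)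
  · rw [Matrix.isUnit_iff_isUnit_det, isUnit_iff_ne_zero, Matrix.det_fin_three]
    simpa using h
  · fin_cases i <;> simp [Fin.sum_univ_three, h0, h1, h2]

theorem mem_tame_of_elementary_one {σ : Aut3 k} {P : Pol k}
    (hP : P ∈ A (X 0 : Pol k) (X 2)) (h0 : σ (X 0) = X 0) (h1 : σ (X 1) = X 1 + P)
    (h2 : σ (X 2) = X 2) : σ ∈ Tame k := by
  have hdet : (0:k) * 0 - 1 * 1 ≠ 0 := by simp
  have hs := lin_mem_tame hdet
  obtain ⟨s0, s1, s2⟩ := lin_X hdet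
  generalize lin (0:k) 1 1 0 hdet = s at hs s0 s1 s2
  simp only [C_0, C_1, zero_mul, one_mul, zero_add, add_zero] at s0 s1
  have : s * σ * s ∈ Tame k := by
    refine Subgroup.subset_closure (Or.inr ⟨s P, ?_, ?_, ?_, ?_⟩)
    · have := map_mem_A s hP
      rw [s0, s2] at this
      exact supported_of_mem_A this (by simp) (by simp)
    · rw [AlgEquiv.mul_apply, AlgEquiv.mul_apply, s0, h1, map_add, s1]
    · rw [AlgEquiv.mul_apply, AlgEquiv.mul_apply, s1, h0, s0]
    · rw [AlgEquiv.mul_apply, AlgEquiv.mul_apply, s2, h2, s2]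
  rwa [Subgroup.mul_mem_cancel_right _ hs, Subgroup.mul_mem_cancel_left _ hs] at this

theorem compl_zero : ({0}ᶜ : Set (Fin 3)) = {1, 2} := by
  ext i; fin_cases i <;> simp

theorem shear_zero_mem_tame {P : Pol k} (hP : P ∈ supported k ({0}ᶜ : Set (Fin 3))) :
    shear 0 P hP ∈ Tame k :=
  Subgroup.subset_closure (Or.inr ⟨P, compl_zero ▸ hP, shear_self hP, shear_of_ne hP (by decide),
    shear_of_ne hP (by decide)⟩)

theorem shear_one_mem_tame {P : Pol k} (hP : P ∈ supported k ({1}ᶜ : Set (Fin 3)))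
    (h : P ∈ A (X 0 : Pol k) (X 2)) : shear 1 P hP ∈ Tame k :=
  mem_tame_of_elementary_one h (shear_of_ne hP (by decide)) (shear_self hP)
    (shear_of_ne hP (by decide))

theorem mem_A_congr_right {f g : Pol k} {α β : k} (hα : α ≠ 0) {p : Pol k} (h : p ∈ A f g) :
    p ∈ A f (C α * g + C β) := by
  rwa [A_congr_L (L_congr2 hα (a := 0) (b := β) (f := f) (g := g) (by simp))]

theorem memH1_one_one {σ : Aut3 k} {α β : k} {t P : Pol k} (hα : α ≠ 0)
    (ht : t ∈ A (X 2 : Pol k) (X 2)) (hP : P ∈ A (X 0 : Pol k) (X 2))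
    (h0 : σ (X 0) = X 0 + t) (h1 : σ (X 1) = X 1 + P) (h2 : σ (X 2) = C α * X 2 + C β) :
    σ ∈ Tame k := by
  have key : ∀ {τ : Aut3 k}, τ (X 0) = X 0 → τ (X 1) = X 1 → τ (X 2) = C α * X 2 + C β →
      τ ∈ Tame k := fun {τ} e0 e1 e2 => by
    refine Subgroup.subset_closure (Or.inl ⟨Matrix.diagonal ![1, 1, α], ![0, 0, β], ?_, ?_⟩)
    · rw [Matrix.isUnit_iff_isUnit_det, isUnit_iff_ne_zero, Matrix.det_diagonal]
      simpa [Fin.prod_univ_three] using hα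
    · intro i; fin_cases i <;> simp [Matrix.diagonal_apply, Fin.sum_univ_three, e0, e1, e2]
  obtain ⟨q, hq, hqe⟩ := exists_map_eq_of_mem_A σ (f := X 2) (g := X 2) (p := -t) (by
    rw [h2]
    have := mem_A_congr_right (β := β) hα (neg_mem ht)
    rw [A_swap] at this
    exact mem_A_congr_right hα this)
  have hq0 : q ∈ supported k ({0}ᶜ : Set (Fin 3)) := supported_of_mem_A hq (by decide) (by decide)
  rw [← Subgroup.mul_mem_cancel_right _ (shear_zero_mem_tame hq0)]
  have e0 : (σ * shear 0 q hq0) (X 0) = X 0 := by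
    rw [AlgEquiv.mul_apply, shear_self, map_add, hqe, h0]; ring
  have e1 : (σ * shear 0 q hq0) (X 1) = X 1 + P := by
    rw [AlgEquiv.mul_apply, shear_of_ne _ (by decide), h1]
  have e2 : (σ * shear 0 q hq0) (X 2) = C α * X 2 + C β := by
    rw [AlgEquiv.mul_apply, shear_of_ne _ (by decide), h2]
  generalize σ * shear 0 q hq0 = τ at e0 e1 e2
  obtain ⟨r, hr, hre⟩ := exists_map_eq_of_mem_A τ (f := X 0) (g := X 2) (p := -P) (by
    rw [e0, e2]; exact mem_A_congr_right hα (neg_mem hP))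
  have hr1 : r ∈ supported k ({1}ᶜ : Set (Fin 3)) := supported_of_mem_A hr (by decide) (by decide)
  rw [← Subgroup.mul_mem_cancel_right _ (shear_one_mem_tame hr1 hr)]
  refine key ?_ ?_ ?_
  · rw [AlgEquiv.mul_apply, shear_of_ne _ (by decide), e0]
  · rw [AlgEquiv.mul_apply, shear_self, map_add, hre, e1]; ring
  · rw [AlgEquiv.mul_apply, shear_of_ne _ (by decide), e2]

theorem mem_A_of_supported_two {t : Pol k} (h : t ∈ supported k ({2} : Set (Fin 3))) :
    t ∈ A (X 2 : Pol k) (X 2) :=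
  mem_A_of_supported (by simpa using h)

theorem A_two_le {p : Pol k} (h : p ∈ A (X 2 : Pol k) (X 2)) : p ∈ A (X 0 : Pol k) (X 2) :=
  A_le (right_mem_A _ _) (right_mem_A _ _) h

theorem mem_tame_of_memH1 {σ : Aut3 k} (h : MemH1 k σ) : σ ∈ Tame k := by
  obtain ⟨a, d, α, β, t, P, ha, hd, hα, ht, hP, h0, h1, h2⟩ := h
  have hdet : a⁻¹ * d⁻¹ - 0 * 0 ≠ 0 := by simp [ha, hd]
  obtain ⟨l0, l1, l2⟩ := lin_X hdet
  rw [← Subgroup.mul_mem_cancel_right _ (lin_mem_tame hdet)]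
  refine memH1_one_one (t := C a⁻¹ * t) (P := C d⁻¹ * P) hα
    (C_mul_mem_A _ (mem_A_of_supported_two ht)) (C_mul_mem_A _ (mem_A_of_supported hP)) ?_ ?_
    (by rw [AlgEquiv.mul_apply, l2, h2])
  · have : C a⁻¹ * C a = (1 : Pol k) := by rw [← C_mul, inv_mul_cancel₀ ha, C_1]
    rw [AlgEquiv.mul_apply, l0, map_add, map_mul, map_mul, map_C, map_C, h0, C_0]
    linear_combination X 0 * this
  · have : C d⁻¹ * C d = (1 : Pol k) := by rw [← C_mul, inv_mul_cancel₀ hd, C_1]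
    rw [AlgEquiv.mul_apply, l1, map_add, map_mul, map_mul, map_C, map_C, h1, C_0]
    linear_combination X 1 * this

theorem mem_tame_of_memK2 {σ : Aut3 k} (h : MemK2 k σ) : σ ∈ Tame k := by
  obtain ⟨a, b, c, d, α, β, t, t', hdet, hα, ht, ht', h0, h1, h2⟩ := h
  obtain ⟨e, he⟩ : ∃ e, e = (a * d - b * c)⁻¹ := ⟨_, rfl⟩
  have he1 : (a * d - b * c) * e = 1 := by rw [he, mul_inv_cancel₀ hdet]
  have hdet' : (e * d) * (e * a) - (-(e * b)) * (-(e * c)) ≠ 0 := by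
    have : (e * d) * (e * a) - (-(e * b)) * (-(e * c)) = e := by linear_combination e * he1
    rw [this, he]; exact inv_ne_zero hdet
  obtain ⟨l0, l1, l2⟩ := lin_X hdet'
  have he2 : (C a * C d - C b * C c) * C e = (1 : Pol k) := by
    rw [← C_mul, ← C_mul, ← C_sub, ← C_mul, he1, C_1]
  rw [← Subgroup.mul_mem_cancel_right _ (lin_mem_tame hdet')]
  have ht := mem_A_of_supported_two ht
  have ht' := mem_A_of_supported_two ht'
  refine memH1_one_one (t := C (e * d) * t + C (-(e * b)) * t')
    (P := C (-(e * c)) * t + C (e * a) * t') hα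
    (add_mem (C_mul_mem_A _ ht) (C_mul_mem_A _ ht'))
    (A_two_le (add_mem (C_mul_mem_A _ ht) (C_mul_mem_A _ ht'))) ?_ ?_
    (by rw [AlgEquiv.mul_apply, l2, h2])
  · rw [AlgEquiv.mul_apply, l0, map_add, map_mul σ, map_mul σ, map_C σ (e * d),
      map_C σ (-(e * b)), h0, h1]
    simp only [C_mul, C_neg]
    linear_combination X 0 * he2
  · rw [AlgEquiv.mul_apply, l1, map_add, map_mul σ, map_mul σ, map_C σ (-(e * c)),
      map_C σ (e * a), h0, h1]
    simp only [C_mul, C_neg]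
    linear_combination X 1 * he2

theorem mem_range_iff [CharZero k] {H1 K2 : Subgroup (Aut3 k)}
    (hH1 : ∀ σ, σ ∈ H1 ↔ MemH1 k σ) (hK2 : ∀ σ, σ ∈ K2 ↔ MemK2 k σ) (σ : Aut3 k) :
    σ ∈ (amalgToGroup H1 K2).range ↔
      (σ ∈ Tame k ∧ ∃ α β : k, α ≠ 0 ∧ σ (X 2) = C α * X 2 + C β) := by
  rw [range_amalgToGroup]
  constructor
  · intro h
    refine ⟨(sup_le (fun τ hτ => mem_tame_of_memH1 ((hH1 τ).1 hτ))
      fun τ hτ => mem_tame_of_memK2 ((hK2 τ).1 hτ) : H1 ⊔ K2 ≤ Tame k) h, ?_⟩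
    have hgen : ∀ τ, τ ∈ H1 ∨ τ ∈ K2 → ∃ α β : k, α ≠ 0 ∧ τ (X 2) = C α * X 2 + C β := by
      rintro τ (hτ | hτ)
      · obtain ⟨_, _, α, β, _, _, _, _, hα, _, _, _, _, h⟩ := (hH1 τ).1 hτ
        exact ⟨α, β, hα, h⟩
      · obtain ⟨_, _, _, _, α, β, _, _, _, hα, _, _, _, _, h⟩ := (hK2 τ).1 hτ
        exact ⟨α, β, hα, h⟩
    rw [Subgroup.sup_eq_closure] at h
    induction h using Subgroup.closure_induction with
    | mem τ hτ => exact hgen τ hτ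
    | one => exact ⟨1, 0, one_ne_zero, by simp⟩
    | mul σ τ _ _ hσ hτ =>
      obtain ⟨α, β, hα, h⟩ := hσ
      obtain ⟨α', β', hα', h'⟩ := hτ
      refine ⟨α' * α, α' * β + β', mul_ne_zero hα' hα, ?_⟩
      rw [AlgEquiv.mul_apply, h', map_add, map_mul, map_C, map_C, h, C_add, C_mul, C_mul]
      ring
    | inv σ _ hσ =>
      obtain ⟨α, β, hα, h⟩ := hσ
      refine ⟨α⁻¹, -(α⁻¹ * β), inv_ne_zero hα, ?_⟩
      change σ.symm (X 2) = _
      have e : C α⁻¹ * C α = (1 : Pol k) := by rw [← C_mul, inv_mul_cancel₀ hα, C_1]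
      rw [AlgEquiv.symm_apply_eq, map_add, map_mul, map_C, map_C, h, C_neg, C_mul]
      linear_combination -X 2 * e
  · rintro ⟨hT, α, β, hα, h⟩
    exact mem_of_good (fun τ hτ => Subgroup.mem_sup_left ((hH1 τ).2 hτ))
      (fun τ hτ => Subgroup.mem_sup_right ((hK2 τ).2 hτ)) (Good.of_tame hT) hα h rfl

end TameStab

namespace TameStab
variable {k : Type} [Field k]

/-- The multidegree for the lexicographic order with `X 0 > X 1 > X 2`. -/
noncomputable def lexDeg (p : Pol k) : Fin 3 →₀ ℕ :=
  (MonomialOrder.lex : MonomialOrder (Fin 3)).degree p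

/-- The multidegree, as an element of the ordered type of exponents. -/
noncomputable def lx (p : Pol k) : (MonomialOrder.lex : MonomialOrder (Fin 3)).syn :=
  (MonomialOrder.lex : MonomialOrder (Fin 3)).toSyn (lexDeg p)

theorem lx_le_of_mem_support {p : Pol k} {n : Fin 3 →₀ ℕ} (h : n ∈ p.support) :
    (MonomialOrder.lex : MonomialOrder (Fin 3)).toSyn n ≤ lx p :=
  MonomialOrder.le_degree h

theorem lx_lt_X_of_apply_zero {p : Pol k} (h : lexDeg p 0 = 0) : lx p < lx (X 0 : Pol k) := by
  rw [lx, lx, lexDeg, lexDeg, MonomialOrder.degree_X, MonomialOrder.lex_lt_iff]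
  refine ⟨0, fun j hj => absurd hj (by simp), ?_⟩
  change lexDeg p 0 < _
  simp [h]

theorem lexDeg_zero_pos {p : Pol k} (h : lx (X 0 : Pol k) ≤ lx p) : lexDeg p 0 ≠ 0 :=
  fun h0 => h.not_gt (lx_lt_X_of_apply_zero h0)

theorem ne_zero_of_X_le {p : Pol k} (h : lx (X 0 : Pol k) ≤ lx p) : p ≠ 0 := by
  rintro rfl
  exact lexDeg_zero_pos h (by simp [lexDeg])

theorem lx_lt_X_of_supported {t : Pol k} (h : t ∈ supported k ({2} : Set (Fin 3))) :
    lx t < lx (X 0 : Pol k) := by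
  apply lx_lt_X_of_apply_zero
  by_contra h0
  have ht : t ≠ 0 := by rintro rfl; exact h0 (by simp [lexDeg])
  have := mem_supported.1 h ((mem_vars_iff_mem_support 0).2 ⟨_,
    (MonomialOrder.lex : MonomialOrder (Fin 3)).degree_mem_support ht, by
      rw [Finsupp.mem_support_iff]; exact h0⟩)
  simp at this

theorem lexDeg_mul {p q : Pol k} (hp : p ≠ 0) (hq : q ≠ 0) :
    lexDeg (p * q) = lexDeg p + lexDeg q := MonomialOrder.degree_mul hp hq

theorem lexDeg_pow (p : Pol k) (n : ℕ) : lexDeg (p ^ n) = n • lexDeg p :=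
  MonomialOrder.degree_pow p n

theorem lexDeg_C (c : k) : lexDeg (C c : Pol k) = 0 := MonomialOrder.degree_C c

theorem lx_C_mul {c : k} (hc : c ≠ 0) (p : Pol k) : lx (C c * p) = lx p := by
  by_cases hp : p = 0
  · simp [hp]
  · rw [lx, lexDeg_mul (by simpa using hc) hp, lexDeg_C, zero_add, lx]

theorem lx_zero_le (p : Pol k) : lx (0 : Pol k) ≤ lx p := by
  rw [lx, lexDeg, MonomialOrder.degree_zero, map_zero]
  exact (MonomialOrder.lex : MonomialOrder (Fin 3)).zero_le _

theorem lx_C_mul_le (c : k) (p : Pol k) : lx (C c * p) ≤ lx p := by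
  by_cases hc : c = 0
  · simpa [hc] using lx_zero_le p
  · rw [lx_C_mul hc]

theorem lx_add_le (p q : Pol k) : lx (p + q) ≤ max (lx p) (lx q) := MonomialOrder.degree_add_le

theorem lx_add_of_lt {p q : Pol k} (h : lx q < lx p) : lx (p + q) = lx p :=
  congrArg (MonomialOrder.lex : MonomialOrder (Fin 3)).toSyn (MonomialOrder.degree_add_of_lt h)

theorem lx_add_of_lt' {p q : Pol k} (h : lx p < lx q) : lx (p + q) = lx q := by
  rw [add_comm, lx_add_of_lt h]

theorem lx_le_sum {ι : Type*} {s : Finset ι} {f : ι → Pol k} (h0 : ∀ i ∈ s, f i ≠ 0)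
    (hinj : Set.InjOn (fun i => lexDeg (f i)) s) {i : ι} (hi : i ∈ s) :
    lx (f i) ≤ lx (∑ j ∈ s, f j) := by
  obtain ⟨j, hj, hmax⟩ := s.exists_max_image (fun i => lx (f i)) ⟨i, hi⟩
  refine (hmax i hi).trans (lx_le_of_mem_support ?_)
  rw [mem_support_iff, coeff_sum, Finset.sum_eq_single_of_mem j hj]
  · exact MonomialOrder.coeff_degree_ne_zero_iff.2 (h0 j hj)
  · intro l hl hlj
    refine MonomialOrder.coeff_eq_zero_of_lt (m := MonomialOrder.lex) ?_
    refine lt_of_le_of_ne (hmax l hl) fun h => hlj (hinj hl hj ?_)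
    exact (MonomialOrder.lex : MonomialOrder (Fin 3)).toSyn.injective h

theorem lexDeg_affine_two {α : k} (β : k) (hα : α ≠ 0) :
    lexDeg (C α * X 2 + C β : Pol k) = Finsupp.single 2 1 := by
  have h2 : lexDeg (C α * X 2 : Pol k) = Finsupp.single 2 1 := by
    rw [lexDeg_mul (by simpa using hα) (X_ne_zero _), lexDeg_C, zero_add]
    exact MonomialOrder.degree_X
  rw [← h2]
  refine MonomialOrder.degree_add_of_lt ?_
  change _ < (MonomialOrder.lex : MonomialOrder (Fin 3)).toSyn (lexDeg _)
  rw [h2, MonomialOrder.degree_C, map_zero, MonomialOrder.toSyn_lt_iff_ne_zero]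
  simp

theorem eq_zero_of_supported {P : Pol k} (hP : P ∈ supported k ({0, 2} : Set (Fin 3)))
    {n : Fin 3 →₀ ℕ} (hn : n ∈ P.support) : n 1 = 0 := by
  by_contra h
  have := mem_supported.1 hP ((mem_vars_iff_mem_support 1).2 ⟨n, hn, Finsupp.mem_support_iff.2 h⟩)
  simp at this

theorem map_eq_sum {P : Pol k} (hP : P ∈ supported k ({0, 2} : Set (Fin 3))) (τ : Aut3 k) :
    τ P = ∑ n ∈ P.support, C (coeff n P) * (τ (X 0) ^ n 0 * τ (X 2) ^ n 2) := by
  conv_lhs => rw [P.as_sum, map_sum]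
  refine Finset.sum_congr rfl fun n hn => ?_
  rw [monomial_eq, map_mul, map_C, Finsupp.prod_fintype _ _ (by simp), Fin.prod_univ_three,
    eq_zero_of_supported hP hn]
  simp

theorem lt_lx_map {τ : Aut3 k} {α β : k} (hα : α ≠ 0) (hτ0 : lx (X 0 : Pol k) ≤ lx (τ (X 0)))
    (hτ2 : τ (X 2) = C α * X 2 + C β) {P : Pol k} (hP : P ∈ supported k ({0, 2} : Set (Fin 3)))
    {n : Fin 3 →₀ ℕ} (hn : n ∈ P.support) (h0 : n 0 ≠ 0) (h1 : n ≠ Finsupp.single 0 1) :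
    lx (τ (X 0)) < lx (τ P) := by
  have hne0 := ne_zero_of_X_le hτ0
  have hne2 : τ (X 2) ≠ 0 := by simp
  have hpos := lexDeg_zero_pos hτ0
  have hdeg : ∀ m ∈ P.support, lexDeg (C (coeff m P) * (τ (X 0) ^ m 0 * τ (X 2) ^ m 2)) =
      m 0 • lexDeg (τ (X 0)) + m 2 • Finsupp.single 2 1 := fun m hm => by
    rw [lexDeg_mul (by simpa using hm) (mul_ne_zero (pow_ne_zero _ hne0) (pow_ne_zero _ hne2)),
      lexDeg_C, zero_add, lexDeg_mul (pow_ne_zero _ hne0) (pow_ne_zero _ hne2), lexDeg_pow,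
      lexDeg_pow, hτ2, lexDeg_affine_two β hα]
  rw [map_eq_sum hP]
  refine lt_of_lt_of_le ?_ (lx_le_sum (f := fun n => C (coeff n P) *
    (τ (X 0) ^ n 0 * τ (X 2) ^ n 2)) (fun m hm => ?_) (fun m hm l hl hml => ?_) hn)
  · obtain ⟨r, hr⟩ := Nat.exists_eq_succ_of_ne_zero h0
    rw [lx, lx, hdeg n hn, hr, Nat.succ_eq_add_one, add_smul, one_smul, add_right_comm, add_comm,
      map_add]
    refine lt_add_of_pos_right _ ?_
    rw [MonomialOrder.toSyn_lt_iff_ne_zero, ne_eq, map_eq_zero_iff _ (AddEquiv.injective _)]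
    intro h
    have e0 := DFunLike.congr_fun h 0
    have e2 := DFunLike.congr_fun h 2
    simp [hpos] at e0
    simp [e0] at e2
    refine h1 (Finsupp.ext fun i => ?_)
    fin_cases i
    · simpa [e0] using hr
    · simpa using eq_zero_of_supported hP hn
    · simpa using e2
  · exact mul_ne_zero (by simpa using hm) (mul_ne_zero (pow_ne_zero _ hne0) (pow_ne_zero _ hne2))
  · change lexDeg _ = lexDeg _ at hml
    rw [hdeg m hm, hdeg l hl] at hml
    have e0 := DFunLike.congr_fun hml 0
    have e2 := DFunLike.congr_fun hml 2
    simp [hpos] at e0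
    simp [e0] at e2
    refine Finsupp.ext fun i => ?_
    fin_cases i
    · exact e0
    · exact (eq_zero_of_supported hP hm).trans (eq_zero_of_supported hP hl).symm
    · exact e2

theorem memK2_of_support {σ : Aut3 k} {a d α β : k} {t P : Pol k} (ha : a ≠ 0) (hd : d ≠ 0)
    (hα : α ≠ 0) (ht : t ∈ supported k ({2} : Set (Fin 3)))
    (hP : P ∈ supported k ({0, 2} : Set (Fin 3))) (h0 : σ (X 0) = C a * X 0 + t)
    (h1 : σ (X 1) = C d * X 1 + P) (h2 : σ (X 2) = C α * X 2 + C β)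
    (h : ∀ n ∈ P.support, n 0 ≠ 0 → n = Finsupp.single 0 1) : MemK2 k σ := by
  refine ⟨a, 0, coeff (Finsupp.single 0 1) P, d, α, β, t,
    P - C (coeff (Finsupp.single 0 1) P) * X 0, by simpa using ⟨ha, hd⟩, hα, ht, ?_,
    by simpa using h0, by rw [h1]; ring, h2⟩
  rw [mem_supported]
  intro i hi
  obtain ⟨n, hn, hni⟩ := (mem_vars_iff_mem_support i).1 hi
  rw [mem_support_iff, coeff_sub, coeff_C_mul, coeff_X] at hn
  have hn1 : n ≠ Finsupp.single 0 1 := by rintro rfl; simp at hn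
  rw [if_neg (fun e => hn1 e.symm), mul_zero, sub_zero] at hn
  have hn := mem_support_iff.2 hn
  rw [Finsupp.mem_support_iff] at hni
  fin_cases i
  · exact absurd (h n hn hni) hn1
  · exact absurd (eq_zero_of_supported hP hn) hni
  · rfl

theorem memH1_of_memK2 {σ : Aut3 k} {a c d α β : k} {t t' : Pol k} (hdet : a * d - 0 * c ≠ 0)
    (hα : α ≠ 0) (ht : t ∈ supported k ({2} : Set (Fin 3)))
    (ht' : t' ∈ supported k ({2} : Set (Fin 3))) (h0 : σ (X 0) = C a * X 0 + C 0 * X 1 + t)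
    (h1 : σ (X 1) = C c * X 0 + C d * X 1 + t') (h2 : σ (X 2) = C α * X 2 + C β) :
    MemH1 k σ := by
  have h : a ≠ 0 ∧ d ≠ 0 := by simpa using hdet
  refine ⟨a, d, α, β, t, C c * X 0 + t', h.1, h.2, hα, ht, add_mem ?_ ?_, by simpa using h0,
    by rw [h1]; ring, h2⟩
  · exact mul_mem (Subalgebra.algebraMap_mem _ c) (X_mem_supported.2 (by simp))
  · exact supported_mono (by simp) ht'

theorem map_mem_supported_two {τ : Aut3 k} {α β : k} (hτ2 : τ (X 2) = C α * X 2 + C β)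
    {t : Pol k} (ht : t ∈ supported k ({2} : Set (Fin 3))) :
    τ t ∈ supported k ({2} : Set (Fin 3)) := by
  have h := map_mem_A τ (mem_A_of_supported_two ht)
  have h2 : C α * X 2 + C β ∈ supported k ({2} : Set (Fin 3)) :=
    add_mem (mul_mem (Subalgebra.algebraMap_mem _ α) (X_mem_supported.2 (by simp)))
      (Subalgebra.algebraMap_mem _ β)
  rw [hτ2] at h
  exact A_le h2 h2 h

/-- The ping-pong invariant: `Ready true τ` is preserved, up to negating the index, under right
multiplication by elements of the first factor outside the second, and `Ready false τ` under right
multiplication by elements of the second factor outside the first. -/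
def Ready (i : Bool) (τ : Aut3 k) : Prop :=
  (∃ α β : k, α ≠ 0 ∧ τ (X 2) = C α * X 2 + C β) ∧ lx (X 0 : Pol k) ≤ lx (τ (X 0)) ∧
    if i then lx (τ (X 1)) ≤ lx (τ (X 0)) else lx (τ (X 0)) < lx (τ (X 1))

theorem map_X_two_mul {τ g : Aut3 k} {α' β' : k} (hα' : α' ≠ 0)
    (h : ∃ α β : k, α ≠ 0 ∧ τ (X 2) = C α * X 2 + C β) (hg : g (X 2) = C α' * X 2 + C β') :
    ∃ α β : k, α ≠ 0 ∧ (τ * g) (X 2) = C α * X 2 + C β := by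
  obtain ⟨α, β, hα, h⟩ := h
  refine ⟨α' * α, α' * β + β', mul_ne_zero hα' hα, ?_⟩
  rw [AlgEquiv.mul_apply, hg, map_add, map_mul, map_C, map_C, h, C_add, C_mul, C_mul]
  ring

theorem lx_X_one_lt : lx (X 1 : Pol k) < lx (X 0 : Pol k) :=
  lx_lt_X_of_apply_zero (by rw [lexDeg, MonomialOrder.degree_X]; simp)

theorem lx_lin_le (a b : k) {p q t : Pol k} {D} (hp : lx p ≤ D) (hq : lx q ≤ D) (ht : lx t ≤ D) :
    lx (C a * p + C b * q + t) ≤ D :=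
  (lx_add_le _ _).trans (max_le ((lx_add_le _ _).trans
    (max_le ((lx_C_mul_le _ _).trans hp) ((lx_C_mul_le _ _).trans hq))) ht)

theorem lx_le_of_memK2 {σ : Aut3 k} (h : MemK2 k σ) :
    lx (σ (X 0)) ≤ lx (X 0 : Pol k) ∧ lx (σ (X 1)) ≤ lx (X 0 : Pol k) := by
  obtain ⟨a, b, c, d, α, β, t, t', hdet, hα, ht, ht', h0, h1, h2⟩ := h
  rw [h0, h1]
  exact ⟨lx_lin_le _ _ le_rfl lx_X_one_lt.le (lx_lt_X_of_supported ht).le,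
    lx_lin_le _ _ le_rfl lx_X_one_lt.le (lx_lt_X_of_supported ht').le⟩

theorem ready_one : Ready true (1 : Aut3 k) :=
  ⟨⟨1, 0, one_ne_zero, by simp⟩, le_rfl, lx_X_one_lt.le⟩

theorem Ready.mul_memH1 {τ g : Aut3 k} (hτ : Ready true τ) (hg : MemH1 k g) (hg' : ¬ MemK2 k g) :
    Ready false (τ * g) ∧ ¬ MemK2 k (τ * g) := by
  obtain ⟨hτ2, hX, hle⟩ := hτ
  simp only [if_true] at hle
  obtain ⟨a, d, α, β, t, P, ha, hd, hα, ht, hP, h0, h1, h2⟩ := hg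
  have hex : ∃ n ∈ P.support, n 0 ≠ 0 ∧ n ≠ Finsupp.single 0 1 := by
    by_contra! h
    exact hg' (memK2_of_support ha hd hα ht hP h0 h1 h2 h)
  obtain ⟨n, hn, hn0, hn1⟩ := hex
  have e2 := map_X_two_mul hα hτ2 h2
  obtain ⟨α', β', hα', hτ2⟩ := hτ2
  have e0 : lx ((τ * g) (X 0)) = lx (τ (X 0)) := by
    rw [AlgEquiv.mul_apply, h0, map_add, map_mul, map_C, lx_add_of_lt, lx_C_mul ha]
    rw [lx_C_mul ha]
    exact (lx_lt_X_of_supported (map_mem_supported_two hτ2 ht)).trans_le hX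
  have hP' := lt_lx_map hα' hX hτ2 hP hn hn0 hn1
  have e1 : lx ((τ * g) (X 1)) = lx (τ P) := by
    rw [AlgEquiv.mul_apply, h1, map_add, map_mul, map_C, lx_add_of_lt']
    rw [lx_C_mul hd]
    exact hle.trans_lt hP'
  refine ⟨⟨e2, e0 ▸ hX, ?_⟩, fun h => ?_⟩
  · rwa [if_neg Bool.false_ne_true, e0, e1]
  · exact ((lx_le_of_memK2 h).2.trans hX).not_gt (e1 ▸ hP')

theorem Ready.mul_memK2 {τ g : Aut3 k} (hτ : Ready false τ) (hg : MemK2 k g)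
    (hg' : ¬ MemH1 k g) : Ready true (τ * g) ∧ ¬ MemK2 k (τ * g) := by
  obtain ⟨hτ2, hX, hlt⟩ := hτ
  simp only [Bool.false_eq_true, if_false] at hlt
  obtain ⟨a, b, c, d, α, β, t, t', hdet, hα, ht, ht', h0, h1, h2⟩ := hg
  have hb : b ≠ 0 := by
    rintro rfl
    exact hg' (memH1_of_memK2 hdet hα ht ht' h0 h1 h2)
  have e2 := map_X_two_mul hα hτ2 h2
  obtain ⟨α', β', hα', hτ2⟩ := hτ2
  have e0 : lx ((τ * g) (X 0)) = lx (τ (X 1)) := by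
    rw [AlgEquiv.mul_apply, h0, map_add, map_add, map_mul, map_mul, map_C, map_C, add_right_comm,
      lx_add_of_lt', lx_C_mul hb]
    rw [lx_C_mul hb]
    exact (lx_add_le _ _).trans_lt (max_lt ((lx_C_mul_le _ _).trans_lt hlt)
      (((lx_lt_X_of_supported (map_mem_supported_two hτ2 ht)).trans_le hX).trans hlt))
  have e1 : lx ((τ * g) (X 1)) ≤ lx (τ (X 1)) := by
    rw [AlgEquiv.mul_apply, h1, map_add, map_add, map_mul, map_mul, map_C, map_C]
    exact lx_lin_le _ _ hlt.le le_rfl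
      (((lx_lt_X_of_supported (map_mem_supported_two hτ2 ht')).trans_le hX).trans hlt).le
  refine ⟨⟨e2, e0 ▸ hX.trans hlt.le, ?_⟩, fun h => ?_⟩
  · rwa [if_pos rfl, e0]
  · exact ((lx_le_of_memK2 h).1.trans hX).not_gt (e0 ▸ hlt)

end TameStab

namespace TameStab
section Amalgam
variable {G : Type*} [Group G] (A B : Subgroup G)

/-- The value in the ambient group of an element of one of the two factors. -/
def val : ∀ {i : Bool}, amalgFam A B i → G
  | true, a => A.subtype a
  | false, b => B.subtype b

theorem pushoutHom_of {i : Bool} (g : amalgFam A B i) :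
    pushoutHom A B (Monoid.PushoutI.of i g) = val A B g := by
  cases i
  · exact pushoutHom_of_false A B g
  · exact pushoutHom_of_true A B g

theorem amalgIncl_injective (i : Bool) : Function.Injective (amalgIncl A B i) := by
  cases i <;> exact Subgroup.inclusion_injective (by simp)

theorem mem_range_amalgIncl {i : Bool} {g : amalgFam A B i} (h : val A B g ∈ A ⊓ B) :
    g ∈ (amalgIncl A B i).range := by
  refine ⟨⟨_, h⟩, ?_⟩
  cases i <;> rfl

/-- Every element of an amalgamated product is the product of an element of the base group and a
reduced word. -/
theorem exists_reduced {ι H : Type*} {G : ι → Type*} [∀ i, Group (G i)] [Group H]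
    {φ : ∀ i, H →* G i} (hφ : ∀ i, Function.Injective (φ i)) (x : Monoid.PushoutI φ) :
    ∃ (h : H) (w : Monoid.CoprodI.Word G), Monoid.PushoutI.Reduced φ w ∧
      x = Monoid.PushoutI.base φ h * Monoid.PushoutI.ofCoprodI w.prod := by
  classical
  obtain ⟨d⟩ := Monoid.PushoutI.NormalWord.transversal_nonempty φ hφ
  obtain ⟨w, rfl⟩ := (Monoid.PushoutI.NormalWord.equiv (d := d)).symm.surjective x
  refine ⟨w.head, w.toWord, fun g hg hr => w.ne_one g hg ?_, rfl⟩
  have := @(d.compl g.1).1 (⟨g.2, hr⟩, ⟨1, d.one_mem _⟩) (1, ⟨g.2, w.normalized _ _ hg⟩) (by simp)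
  simpa using congrArg (fun p => (p.1 : G g.1)) this

/-- A ping-pong criterion for injectivity of the map from an amalgamated product. -/
theorem pushoutHom_injective (R : Bool → G → Prop) (h1 : R true 1)
    (hA : ∀ τ g, R true τ → g ∈ A → g ∉ B → R false (τ * g) ∧ τ * g ∉ B)
    (hB : ∀ τ g, R false τ → g ∈ B → g ∉ A → R true (τ * g) ∧ τ * g ∉ B) :
    Function.Injective (pushoutHom A B) := by
  have step : ∀ {i τ} (g : amalgFam A B i), R i τ → g ∉ (amalgIncl A B i).range →
      R (!i) (τ * val A B g) ∧ τ * val A B g ∉ B := by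
    intro i τ g hτ hg
    cases i
    · exact hB _ _ hτ (Subtype.prop (p := (· ∈ B)) g) fun h =>
        hg (mem_range_amalgIncl A B ⟨h, Subtype.prop (p := (· ∈ B)) g⟩)
    · exact hA _ _ hτ (Subtype.prop (p := (· ∈ A)) g) fun h =>
        hg (mem_range_amalgIncl A B ⟨Subtype.prop (p := (· ∈ A)) g, h⟩)
  have word : ∀ w : Monoid.CoprodI.Word (amalgFam A B),
      Monoid.PushoutI.Reduced (amalgIncl A B) w → ∀ τ, (∀ i, w.fstIdx = some i → R i τ) →
      w ≠ .empty →
      τ * pushoutHom A B (Monoid.PushoutI.ofCoprodI w.prod) ∉ B := by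
    intro w
    induction w using Monoid.CoprodI.Word.consRecOn with
    | empty => intro _ _ _ h; exact absurd rfl h
    | cons i g w hidx hg ih =>
      intro hw τ hτ _
      obtain ⟨hs, hsB⟩ := step g (hτ i rfl) (hw _ List.mem_cons_self)
      rw [Monoid.CoprodI.Word.prod_cons, map_mul, map_mul, ← mul_assoc,
        Monoid.PushoutI.ofCoprodI_of, pushoutHom_of]
      by_cases hwe : w = .empty
      · simpa [hwe] using hsB
      · refine ih (fun _ h => hw _ (List.mem_cons_of_mem _ h)) _ (fun j hj => ?_) hwe
        have : j ≠ i := fun e => hidx (e ▸ hj)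
        rwa [Bool.eq_not_of_ne this]
  rw [injective_iff_map_eq_one]
  intro x hx
  obtain ⟨c, w, hw, rfl⟩ := exists_reduced (amalgIncl_injective A B) x
  rw [map_mul, pushoutHom_base, mul_eq_one_iff_inv_eq] at hx
  have hc : (c : G)⁻¹ ∈ A ⊓ B := inv_mem c.2
  induction w using Monoid.CoprodI.Word.consRecOn with
  | empty =>
    have : c = 1 := by
      have : (1 : G) = (c : G)⁻¹ := by simpa using hx.symm
      ext; simpa using this.symm
    simp [this]
  | cons i g w hidx hg _ =>
    exfalso
    cases i
    · have hgr := hw _ List.mem_cons_self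
      rw [Monoid.CoprodI.Word.prod_cons, map_mul, map_mul, Monoid.PushoutI.ofCoprodI_of,
        pushoutHom_of] at hx
      by_cases hwe : w = .empty
      · apply hgr
        apply mem_range_amalgIncl
        have : val A B g = (c : G)⁻¹ := by simpa [hwe] using hx.symm
        rwa [this]
      · have := word w (fun _ h => hw _ (List.mem_cons_of_mem _ h)) 1 (fun j hj => ?_) hwe
        · apply this
          rw [one_mul, ← Subgroup.mul_mem_cancel_left B (Subtype.prop (p := (· ∈ B)) g)]
          change val A B g * _ ∈ B
          rw [← hx]
          exact hc.2
        · have : j ≠ false := fun e => hidx (e ▸ hj)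
          rw [Bool.eq_not_of_ne this]
          exact h1
    · refine word _ hw 1 (fun j hj => ?_) ?_ ?_
      · obtain rfl : true = j := Option.some.inj hj
        exact h1
      · intro h
        have := congrArg Monoid.CoprodI.Word.toList h
        simp [Monoid.CoprodI.Word.cons, Monoid.CoprodI.Word.empty] at this
      · rw [one_mul, ← hx]
        exact hc.2

end Amalgam

variable {k : Type} [Field k]

theorem amalgToGroup_injective {H1 K2 : Subgroup (Aut3 k)}
    (hH1 : ∀ σ, σ ∈ H1 ↔ MemH1 k σ) (hK2 : ∀ σ, σ ∈ K2 ↔ MemK2 k σ) :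
    Function.Injective (amalgToGroup H1 K2) := by
  refine pushoutHom_injective H1 K2 Ready ready_one (fun τ g hτ hg hg' => ?_)
    fun τ g hτ hg hg' => ?_
  all_goals rw [hH1, hK2] at *
  · exact hτ.mul_memH1 hg hg'
  · exact hτ.mul_memK2 hg hg'

end TameStab

/-- `Stab([x3]) = H1 *_{H1 ∩ K2} K2`: the canonical homomorphism from the amalgamated
product of `H1` and `K2` over their intersection to `Aut(R)` is injective, with image
`Stab([x3]) = {σ ∈ Tame(k^3) : σ(x3) = α·x3 + β, α ∈ k^*}`. -/
theorem stab_eq_amalgam_H1_K2 (k : Type) [Field k] [CharZero k]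
    (H1 K2 : Subgroup (Aut3 k))
    (hH1 : ∀ σ, σ ∈ H1 ↔ MemH1 k σ) (hK2 : ∀ σ, σ ∈ K2 ↔ MemK2 k σ) :
    Function.Injective (amalgToGroup H1 K2) ∧
    ∀ σ : Aut3 k, σ ∈ (amalgToGroup H1 K2).range ↔
      (σ ∈ Tame k ∧ ∃ α β : k, α ≠ 0 ∧ σ (X 2) = C α * X 2 + C β) :=
  ⟨TameStab.amalgToGroup_injective hH1 hK2, TameStab.mem_range_iff hH1 hK2⟩
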